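/- If κ is remarkable in L and G is Col(ω, <κ)-generic over L, then in L[G], WRP^L(γ) holds for every L-cardinal γ ≥ κ. -/

import Mathlib

/-!
Common set-theoretic infrastructure for formalizing the paper
"The strong reflecting property and Harrington's Principle".

We work over Mathlib's `ZFSet.{0}` (a model of ZFC).  First-order satisfaction
for the language of set theory (with two auxiliary unary predicates) is
defined directly; Gödel's constructible hierarchy `L` (and its relativized
versions `L[A]`), hereditarily-small sets `H_κ`, transitive collapses,
clubs, elementary submodels, admissible ordinals, and the various
reflecting properties are all defined from first principles.
-/

noncomputable section
attribute [local instance] Classical.propDecidable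
namespace SRPPaper

open ZFSet

/-- Image of a `ZFSet.{0}` under an arbitrary (classically definable) function. -/
def img (f : ZFSet.{0} → ZFSet.{0}) : ZFSet.{0} → ZFSet.{0} :=
  @ZFSet.image f (Classical.allZFSetDefinable _)

/-! ### First-order formulas and satisfaction -/

/-- First-order formulas in the language `{∈, =, A, B}` where `A`, `B` are
unary predicate symbols; variables are de Bruijn-style indices in `Fin n`. -/
inductive Fml : ℕ → Type
  | mem {n} (i j : Fin n) : Fml n
  | eq {n} (i j : Fin n) : Fml n
  | inA {n} (i : Fin n) : Fml n
  | inB {n} (i : Fin n) : Fml n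
  | not {n} : Fml n → Fml n
  | and {n} : Fml n → Fml n → Fml n
  | ex {n} : Fml (n + 1) → Fml n

/-- Satisfaction over the structure `(S, ∈, A, B)`; quantifiers range over `S`,
the new variable of `ex` gets index `0`. -/
def SatAB (S A B : Set ZFSet.{0}) : ∀ {n}, Fml n → (Fin n → ZFSet.{0}) → Prop
  | _, .mem i j, v => v i ∈ v j
  | _, .eq i j, v => v i = v j
  | _, .inA i, v => v i ∈ A
  | _, .inB i, v => v i ∈ B
  | _, .not φ, v => ¬ SatAB S A B φ v
  | _, .and φ ψ, v => SatAB S A B φ v ∧ SatAB S A B ψ v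
  | _, .ex φ, v => ∃ x ∈ S, SatAB S A B φ (Fin.cons x v)

/-- Pure `∈`-satisfaction over the structure `(S, ∈)`. -/
def Sat (S : Set ZFSet.{0}) {n} (φ : Fml n) (v : Fin n → ZFSet.{0}) : Prop :=
  SatAB S ∅ ∅ φ v

/-- Δ₀ (bounded) formulas. -/
inductive IsDelta0 : ∀ {n}, Fml n → Prop
  | mem {n} (i j : Fin n) : IsDelta0 (.mem i j)
  | eq {n} (i j : Fin n) : IsDelta0 (.eq i j)
  | inA {n} (i : Fin n) : IsDelta0 (.inA i)
  | inB {n} (i : Fin n) : IsDelta0 (.inB i)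
  | not {n} {φ : Fml n} : IsDelta0 φ → IsDelta0 (.not φ)
  | and {n} {φ ψ : Fml n} : IsDelta0 φ → IsDelta0 ψ → IsDelta0 (.and φ ψ)
  | bex {n} (j : Fin (n + 1)) {φ : Fml (n + 1)} : j ≠ 0 → IsDelta0 φ →
      IsDelta0 (.ex (.and (.mem 0 j) φ))

/-- A Gödel code for formulas. -/
def codeF : ∀ {n}, Fml n → ℕ
  | _, .mem i j => Nat.pair 0 (Nat.pair i.val j.val)
  | _, .eq i j => Nat.pair 1 (Nat.pair i.val j.val)
  | _, .inA i => Nat.pair 2 i.val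
  | _, .inB i => Nat.pair 3 i.val
  | _, .not φ => Nat.pair 4 (codeF φ)
  | _, .and φ ψ => Nat.pair 5 (Nat.pair (codeF φ) (codeF ψ))
  | _, .ex φ => Nat.pair 6 (codeF φ)

/-! ### Ordinals, von Neumann naturals -/

/-- `x` is a (von Neumann) ordinal: a transitive set of transitive sets. -/
def IsOrd (x : ZFSet.{0}) : Prop :=
  x.IsTransitive ∧ ∀ y ∈ x, ZFSet.IsTransitive y

/-- `x` is a limit ordinal. -/
def IsLimitOrd (x : ZFSet.{0}) : Prop :=
  IsOrd x ∧ x ≠ ∅ ∧ ∀ y ∈ x, ∃ z ∈ x, y ∈ z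

/-- The `n`-th von Neumann natural number. -/
def natZ : ℕ → ZFSet.{0}
  | 0 => ∅
  | n + 1 => insert (natZ n) (natZ n)

/-- Decoding of von Neumann naturals. -/
def zfToNat (x : ZFSet.{0}) : ℕ :=
  if h : ∃ n : ℕ, natZ n = x then h.choose else 0

/-! ### Coded functions, products -/

/-- The cartesian product of two `ZFSet.{0}`s (as a set of Kuratowski pairs). -/
def prodZ (a b : ZFSet.{0}) : ZFSet.{0} :=
  ZFSet.sep (fun z => ∃ x, x ∈ a ∧ ∃ y, y ∈ b ∧ z = ZFSet.pair x y)
    (ZFSet.powerset (ZFSet.powerset (a ∪ b)))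

/-- `f` codes a surjection from `a` onto `b`. -/
def IsSurjF (a b f : ZFSet.{0}) : Prop :=
  ZFSet.IsFunc a b f ∧ ∀ y, y ∈ b → ∃ x, x ∈ a ∧ ZFSet.pair x y ∈ f

/-- `f` codes an injection from `a` into `b`. -/
def IsInjF (a b f : ZFSet.{0}) : Prop :=
  ZFSet.IsFunc a b f ∧
    ∀ x₁, x₁ ∈ a → ∀ x₂, x₂ ∈ a → ∀ y, ZFSet.pair x₁ y ∈ f → ZFSet.pair x₂ y ∈ f → x₁ = x₂

/-- The set of values of a coded function `f`. -/
def imageOf (f : ZFSet.{0}) : ZFSet.{0} :=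
  ZFSet.sep (fun y => ∃ x, ZFSet.pair x y ∈ f) (ZFSet.sUnion (ZFSet.sUnion f))

/-! ### Cardinals (in `V`) -/

/-- `x` and `y` are equinumerous. -/
def EqNum (x y : ZFSet.{0}) : Prop := Nonempty (x.toSet ≃ y.toSet)

/-- `|x| ≤ |y|`. -/
def CardLE (x y : ZFSet.{0}) : Prop := Nonempty (x.toSet ↪ y.toSet)

/-- `|x| < κ`, for `κ` a cardinal: `x` injects into some member of `κ`. -/
def CardLT (x κ : ZFSet.{0}) : Prop := ∃ α, α ∈ κ ∧ CardLE x α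

/-- `κ` is a cardinal (of `V`). -/
def IsCard (κ : ZFSet.{0}) : Prop := IsOrd κ ∧ ∀ α ∈ κ, ¬ EqNum α κ

/-- `x` is unbounded (cofinal) in the ordinal `κ`. -/
def UnbIn (x κ : ZFSet.{0}) : Prop := ∀ β ∈ κ, ∃ γ ∈ x, β ∈ γ ∨ β = γ

/-- `κ` is a regular cardinal: every cofinal subset of `κ` has size `κ`. -/
def IsRegular (κ : ZFSet.{0}) : Prop :=
  IsCard κ ∧ ∀ x : ZFSet.{0}, x ⊆ κ → UnbIn x κ → EqNum x κ

/-- The least ordinal satisfying `p` (junk value `∅` if there is none). -/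
def leastOrd (p : ZFSet.{0} → Prop) : ZFSet.{0} :=
  if h : ∃ α, (IsOrd α ∧ p α) ∧ ∀ β ∈ α, ¬ (IsOrd β ∧ p β) then h.choose else ∅

/-- The cardinal `ℵₙ` of `V` (`Aleph 0 = ω`). -/
def Aleph : ℕ → ZFSet.{0}
  | 0 => ZFSet.omega
  | n + 1 => leastOrd (fun κ => IsCard κ ∧ Aleph n ∈ κ)

/-- The cardinal successor (in `V`) of `κ`. -/
def SuccCard (κ : ZFSet.{0}) : ZFSet.{0} := leastOrd (fun α => IsCard α ∧ κ ∈ α)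

/-- `X` is countable. -/
def Ctbl (X : ZFSet.{0}) : Prop := X.toSet.Countable

/-- `|X| = ω`: `X` is countably infinite. -/
def CtblInf (X : ZFSet.{0}) : Prop := X.toSet.Countable ∧ X.toSet.Infinite

/-! ### `H_κ`, elementary submodels, transitive collapse -/

/-- The class `H_κ` of sets hereditarily of cardinality `< κ`. -/
def Hset (κ : ZFSet.{0}) : Set ZFSet.{0} :=
  {x | ∃ t : ZFSet.{0}, t.IsTransitive ∧ x ∈ t ∧ CardLT t κ}

/-- `X ≺ S`: `X` is an elementary submodel of the class `(S, ∈)`. -/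
def ElemSub (X : ZFSet.{0}) (S : Set ZFSet.{0}) : Prop :=
  X.toSet ⊆ S ∧ ∀ {n : ℕ} (φ : Fml n) (v : Fin n → ZFSet.{0}),
    (∀ i, v i ∈ X) → (Sat X.toSet φ v ↔ Sat S φ v)

/-- The transitive-collapse map of (the ∈-structure on) `X`:
`collapse X y = {collapse X z | z ∈ y ∩ X}`.  For `γ ∈ X`, `collapse X γ` is
the image `γ̄` of `γ` under the transitive collapse of `X`. -/
def collapse (X : ZFSet.{0}) : ZFSet.{0} → ZFSet.{0} :=
  ZFSet.mem_wf.fix (C := fun _ => ZFSet.{0}) fun y ih =>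
    img (fun z => if h : z ∈ y then ih z h else ∅) (ZFSet.sep (fun z => z ∈ X) y)

/-- The transitive collapse of `X` (as a set). -/
def collapseSet (X : ZFSet.{0}) : ZFSet.{0} := img (fun y => collapse X y) X

/-- The transitive closure of (the members of) `x`. -/
def tcl : ZFSet.{0} → ZFSet.{0} :=
  ZFSet.mem_wf.fix (C := fun _ => ZFSet.{0}) fun x ih =>
    x ∪ ZFSet.sUnion (img (fun y => if h : y ∈ x then ih y h else ∅) x)

/-- The (von Neumann) rank of a set, as an ordinal `ZFSet.{0}`. -/
def rankZ : ZFSet.{0} → ZFSet.{0} :=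
  ZFSet.mem_wf.fix (C := fun _ => ZFSet.{0}) fun x ih =>
    ZFSet.sUnion (img (fun y => if h : y ∈ x then insert (ih y h) (ih y h) else ∅) x)

/-- The order type of a set `X` of ordinals: the unique ordinal `α` such that
`(X, ∈) ≅ (α, ∈)` (junk value `∅` if there is none). -/
def otype (X : ZFSet.{0}) : ZFSet.{0} :=
  if h : ∃ α, IsOrd α ∧ ∃ e : X.toSet ≃ α.toSet,
      ∀ a b : X.toSet, (a : ZFSet.{0}) ∈ (b : ZFSet.{0}) ↔ ((e a : ZFSet.{0}) ∈ (e b : ZFSet.{0}))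
  then h.choose else ∅

/-! ### The constructible hierarchy (relative to a predicate) -/

/-- The set of subsets of `X` definable over `(X, ∈, A)` with parameters. -/
def DefSetA (A : Set ZFSet.{0}) (X : ZFSet.{0}) : ZFSet.{0} :=
  ZFSet.sep (fun B => ∃ (n : ℕ) (φ : Fml (n + 1)) (v : Fin n → ZFSet.{0}),
      (∀ i, v i ∈ X) ∧ B = ZFSet.sep (fun z => SatAB X.toSet A ∅ φ (Fin.cons z v)) X)
    (ZFSet.powerset X)

/-- The hierarchy `L_α[A]`: `LstageA A α = ⋃_{β ∈ α} Def_A (LstageA A β)`. -/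
def LstageA (A : Set ZFSet.{0}) : ZFSet.{0} → ZFSet.{0} :=
  ZFSet.mem_wf.fix (C := fun _ => ZFSet.{0}) fun α ih =>
    ZFSet.sUnion (img (fun β => if h : β ∈ α then DefSetA A (ih β h) else ∅) α)

/-- Gödel's hierarchy `L_α`. -/
def Lstage : ZFSet.{0} → ZFSet.{0} := LstageA ∅

/-- The constructible universe `L`, as a class. -/
def LClass : Set ZFSet.{0} := {x | ∃ α, IsOrd α ∧ x ∈ Lstage α}

/-- The class `L[A]`, for a set `A`. -/
def LrelClass (A : ZFSet.{0}) : Set ZFSet.{0} := {x | ∃ α, IsOrd α ∧ x ∈ LstageA A.toSet α}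

/-- The constructible universe as computed inside a transitive (set or class)
model `W`: the union of the `L_α` for `α` an ordinal of `W`. -/
def LClassIn (W : Set ZFSet.{0}) : Set ZFSet.{0} :=
  {x | ∃ α, IsOrd α ∧ α ∈ W ∧ x ∈ Lstage α}

/-- `κ` is a cardinal in the (transitive) class `W`:
no coded surjection lying in `W` maps some `α < κ` onto `κ`. -/
def CardIn (W : Set ZFSet.{0}) (κ : ZFSet.{0}) : Prop :=
  IsOrd κ ∧ ∀ α, α ∈ κ → ∀ f, f ∈ W → ¬ IsSurjF α κ f

/-- `κ` is an `L`-cardinal. -/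
def LCard (κ : ZFSet.{0}) : Prop := CardIn LClass κ

/-! ### Clubs and stationarity on `[S]^ω` and on `κ` -/

/-- The union of an `ℕ`-indexed family of `ZFSet.{0}`s. -/
def seqUnion (f : ℕ → ZFSet.{0}) : ZFSet.{0} :=
  ZFSet.sUnion (img (fun m => f (zfToNat m)) ZFSet.omega)

/-- `C` is a club of countable subsets of `S`: every member is a countable
subset of `S`, `C` is `⊆`-cofinal in the countable subsets of `S`, and `C` is
closed under unions of countable increasing chains. -/
def ClubSub (S : Set ZFSet.{0}) (C : Set ZFSet.{0}) : Prop :=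
  (∀ X ∈ C, (X : ZFSet.{0}).toSet ⊆ S ∧ CtblInf X) ∧
  (∀ X : ZFSet.{0}, X.toSet ⊆ S → CtblInf X → ∃ Y ∈ C, X ⊆ Y) ∧
  (∀ f : ℕ → ZFSet.{0}, (∀ n, f n ∈ C) → (∀ n, f n ⊆ f (n + 1)) → seqUnion f ∈ C)

/-- `C` is stationary in `[S]^ω`: it meets every club of countable subsets. -/
def StatSub (S : Set ZFSet.{0}) (C : Set ZFSet.{0}) : Prop :=
  ∀ D : Set ZFSet.{0}, ClubSub S D → ∃ X, X ∈ C ∧ X ∈ D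

/-- `D` is a club (closed unbounded set) in the ordinal `κ`. -/
def ClubIn (κ D : ZFSet.{0}) : Prop :=
  D ⊆ κ ∧ (∀ β ∈ κ, ∃ θ, θ ∈ D ∧ β ∈ θ) ∧
  ∀ α, α ∈ κ → α ≠ ∅ → (∀ β ∈ α, ∃ θ, θ ∈ D ∧ θ ∈ α ∧ (β ∈ θ ∨ β = θ)) → α ∈ D

/-- `D` is stationary in the ordinal `κ`. -/
def StatIn (κ D : ZFSet.{0}) : Prop :=
  D ⊆ κ ∧ ∀ C : ZFSet.{0}, ClubIn κ C → ∃ θ, θ ∈ D ∧ θ ∈ C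

/-! ### The strong and weak reflecting properties -/

/-- `SRP^M(γ)` for an inner model given as a class `W`:  for some regular
cardinal `κ > γ`, whenever `X ≺ H_κ` is countable with `γ ∈ X`, the image of
`γ` under the transitive collapse of `X` is a cardinal of `W`. -/
def SRPclass (W : Set ZFSet.{0}) (γ : ZFSet.{0}) : Prop :=
  ∃ κ, IsRegular κ ∧ γ ∈ κ ∧
    ∀ X : ZFSet.{0}, ElemSub X (Hset κ) → CtblInf X → γ ∈ X → CardIn W (collapse X γ)

/-- `SRP^L(γ)`: the strong reflecting property for `L`-cardinals. -/
def SRPL (γ : ZFSet.{0}) : Prop := SRPclass LClass γ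

/-- `WRP^L(γ)`: the weak reflecting property for `L`-cardinals. -/
def WRPL (γ : ZFSet.{0}) : Prop :=
  ∃ κ, IsRegular κ ∧ γ ∈ κ ∧
    ∃ X : ZFSet.{0}, ElemSub X (Hset κ) ∧ CtblInf X ∧ γ ∈ X ∧ LCard (collapse X γ)

/-- `SRP^M_{<λ}(λ)`: for some regular `θ > λ`, every `X ≺ H_θ` with `|X| < λ`
and `λ ∈ X` collapses `λ` to a `W`-cardinal. -/
def SRPlt (W : Set ZFSet.{0}) (lam : ZFSet.{0}) : Prop :=
  ∃ θ, IsRegular θ ∧ lam ∈ θ ∧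
    ∀ X : ZFSet.{0}, ElemSub X (Hset θ) → CardLT X lam → lam ∈ X → CardIn W (collapse X lam)

/-! ### Notions relativized to a transitive (set or class) model `W` -/

/-- `κ` is a regular cardinal in `W`: `κ` is a `W`-cardinal and every coded
function in `W` from some `α < κ` into `κ` is bounded. -/
def RegularIn (W : Set ZFSet.{0}) (κ : ZFSet.{0}) : Prop :=
  CardIn W κ ∧ ∀ α, α ∈ κ → ∀ f, f ∈ W → ZFSet.IsFunc α κ f →
    ∃ β, β ∈ κ ∧ ∀ ξ y, ξ ∈ α → ZFSet.pair ξ y ∈ f → y ∈ β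

/-- `H_κ` as computed in `W`. -/
def HsetIn (W : Set ZFSet.{0}) (κ : ZFSet.{0}) : Set ZFSet.{0} :=
  {x | x ∈ W ∧ ∃ t, t ∈ W ∧ t.IsTransitive ∧ x ∈ t ∧
    ∃ f, f ∈ W ∧ ∃ α, α ∈ κ ∧ IsInjF t α f}

/-- `X` is countable in `W`. -/
def CtblIn (W : Set ZFSet.{0}) (X : ZFSet.{0}) : Prop :=
  X = ∅ ∨ ∃ f, f ∈ W ∧ IsSurjF ZFSet.omega X f

/-- `|X| = ω` in `W`: countable and infinite in `W`. -/
def CtblInfIn (W : Set ZFSet.{0}) (X : ZFSet.{0}) : Prop :=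
  CtblIn W X ∧ ∀ n, n ∈ ZFSet.omega → ∀ f, f ∈ W → ¬ IsSurjF n X f

/-- The `ω₁` of `W`. -/
def omega1In (W : Set ZFSet.{0}) : ZFSet.{0} :=
  leastOrd (fun α => CardIn W α ∧ ZFSet.omega ∈ α)

/-- The `ω₂` of `W`. -/
def omega2In (W : Set ZFSet.{0}) : ZFSet.{0} :=
  leastOrd (fun α => CardIn W α ∧ omega1In W ∈ α)

/-- The cardinal successor of `κ` as computed in `W`. -/
def SuccCardIn (W : Set ZFSet.{0}) (κ : ZFSet.{0}) : ZFSet.{0} :=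
  leastOrd (fun α => CardIn W α ∧ κ ∈ α)

/-- `WRP^L(γ)` as computed inside the (transitive) model `W`:  for some
`κ ∈ W` regular in `W` with `γ < κ` there is an `X ∈ W`, countably infinite
in `W`, with `X ≺ H_κ^W`, `γ ∈ X`, whose collapse sends `γ` to a cardinal of
the `L` of `W`. -/
def WRPLIn (W : Set ZFSet.{0}) (γ : ZFSet.{0}) : Prop :=
  ∃ κ, κ ∈ W ∧ RegularIn W κ ∧ γ ∈ κ ∧
    ∃ X, X ∈ W ∧ ElemSub X (HsetIn W κ) ∧ CtblInfIn W X ∧ γ ∈ X ∧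
      CardIn (LClassIn W) (collapse X γ)

/-- `SRP^L(γ)` as computed inside the (transitive) model `W`. -/
def SRPLIn (W : Set ZFSet.{0}) (γ : ZFSet.{0}) : Prop :=
  ∃ κ, κ ∈ W ∧ RegularIn W κ ∧ γ ∈ κ ∧
    ∀ X, X ∈ W → ElemSub X (HsetIn W κ) → CtblInfIn W X → γ ∈ X →
      CardIn (LClassIn W) (collapse X γ)

/-! ### Models of (fragments of) ZFC, semantically -/

/-- `W` is a transitive model of `ZFC⁻` (ZFC with Power Set deleted and with
Collection), rendered semantically: nonempty, transitive, closed under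
pairing and union, contains `ω`, satisfies full Separation and Collection for
first-order formulas with parameters, and Choice. -/
def ModelsZFCminus (W : Set ZFSet.{0}) : Prop :=
  (∃ x, x ∈ W) ∧
  (∀ x, x ∈ W → x.toSet ⊆ W) ∧
  (∀ x y, x ∈ W → y ∈ W → insert x (insert y (∅ : ZFSet.{0})) ∈ W) ∧
  (∀ x, x ∈ W → ZFSet.sUnion x ∈ W) ∧
  (ZFSet.omega ∈ W) ∧
  (∀ (n : ℕ) (φ : Fml (n + 1)) (v : Fin n → ZFSet.{0}), (∀ i, v i ∈ W) → ∀ a, a ∈ W →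
    ZFSet.sep (fun z => SatAB W ∅ ∅ φ (Fin.cons z v)) a ∈ W) ∧
  (∀ (n : ℕ) (φ : Fml (n + 2)) (v : Fin n → ZFSet.{0}), (∀ i, v i ∈ W) → ∀ a, a ∈ W →
    (∀ x, x ∈ a → ∃ y, y ∈ W ∧ SatAB W ∅ ∅ φ (Fin.cons x (Fin.cons y v))) →
    ∃ b, b ∈ W ∧ ∀ x, x ∈ a → ∃ y, y ∈ b ∧ SatAB W ∅ ∅ φ (Fin.cons x (Fin.cons y v))) ∧
  (∀ x, x ∈ W → (∀ y, y ∈ x → y ≠ ∅) →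
    ∃ c, c ∈ W ∧ ∀ y, y ∈ x → ∃! z, z ∈ y ∧ ZFSet.pair y z ∈ c)

/-- `W` is a transitive model of `ZFC` (with Power Set). -/
def ModelsZFC (W : Set ZFSet.{0}) : Prop :=
  ModelsZFCminus W ∧ ∀ x, x ∈ W → ∃ p, p ∈ W ∧ ∀ z, z ∈ W → (z ∈ p ↔ z ⊆ x)

/-- `W` is a model of `Z₂ = ZFC⁻ +` "every set is countable". -/
def ModelsZ2 (W : Set ZFSet.{0}) : Prop :=
  ModelsZFCminus W ∧ ∀ x, x ∈ W → CtblIn W x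

/-- `p` is the power set of `x` as computed in `W`. -/
def IsPowIn (W : Set ZFSet.{0}) (x p : ZFSet.{0}) : Prop :=
  p ∈ W ∧ ∀ z, z ∈ W → (z ∈ p ↔ z ⊆ x)

/-- `W` is a model of `Z₃ = ZFC⁻ + 𝒫(ω)` exists `+` every set has size `≤ ℶ₁`. -/
def ModelsZ3 (W : Set ZFSet.{0}) : Prop :=
  ModelsZFCminus W ∧ (∃ p, IsPowIn W ZFSet.omega p) ∧
    ∀ x, x ∈ W → ∀ p, IsPowIn W ZFSet.omega p → ∃ f, f ∈ W ∧ IsInjF x p f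

/-- `W` is a model of `Z₄ = ZFC⁻ + 𝒫(𝒫(ω))` exists `+` every set has size `≤ ℶ₂`. -/
def ModelsZ4 (W : Set ZFSet.{0}) : Prop :=
  ModelsZFCminus W ∧
    (∃ p q, IsPowIn W ZFSet.omega p ∧ IsPowIn W p q) ∧
    ∀ x, x ∈ W → ∀ p q, IsPowIn W ZFSet.omega p → IsPowIn W p q →
      ∃ f, f ∈ W ∧ IsInjF x q f

/-! ### Forcing: the Lévy collapse, genericity, generic extensions -/

/-- The Lévy collapse `Col(ω, <κ)`: finite partial functions `p` with
`p(α, n) ∈ α` for `α < κ`, `n < ω`. -/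
def ColLt (κ : ZFSet.{0}) : ZFSet.{0} :=
  ZFSet.sep (fun p => p.toSet.Finite ∧
      (∀ z, z ∈ p → ∃ α n β, α ∈ κ ∧ n ∈ ZFSet.omega ∧ β ∈ α ∧
        z = ZFSet.pair (ZFSet.pair α n) β) ∧
      (∀ α n β β', ZFSet.pair (ZFSet.pair α n) β ∈ p →
        ZFSet.pair (ZFSet.pair α n) β' ∈ p → β = β'))
    (ZFSet.powerset (prodZ (prodZ κ ZFSet.omega) (ZFSet.sUnion κ)))

/-- `G` is a filter on the partial order `P` of partial functions ordered by
reverse inclusion (`p` is stronger than `q` iff `q ⊆ p`) which meets every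
dense subset of `P` lying in the (transitive) model `W`. -/
def GenericOver (W : Set ZFSet.{0}) (P G : ZFSet.{0}) : Prop :=
  G ⊆ P ∧
  (∀ p q, p ∈ G → q ∈ P → q ⊆ p → q ∈ G) ∧
  (∀ p q, p ∈ G → q ∈ G → ∃ r, r ∈ G ∧ p ⊆ r ∧ q ⊆ r) ∧
  (∀ D, D ∈ W → D ⊆ P → (∀ p, p ∈ P → ∃ q, q ∈ D ∧ p ⊆ q) → ∃ q, q ∈ G ∧ q ∈ D)

/-- Genericity for an abstract partial order `R` (a set of pairs) on `P`:
`pair p q ∈ R` means `p` is stronger than (extends) `q`. -/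
def GenericOnP (W : Set ZFSet.{0}) (P R G : ZFSet.{0}) : Prop :=
  G ⊆ P ∧
  (∀ p q, p ∈ G → q ∈ P → ZFSet.pair p q ∈ R → q ∈ G) ∧
  (∀ p q, p ∈ G → q ∈ G → ∃ r, r ∈ G ∧ ZFSet.pair r p ∈ R ∧ ZFSet.pair r q ∈ R) ∧
  (∀ D, D ∈ W → D ⊆ P → (∀ p, p ∈ P → ∃ q, q ∈ D ∧ ZFSet.pair q p ∈ R) →
    ∃ q, q ∈ G ∧ q ∈ D)

/-- Evaluation of a forcing name `τ` by a filter `G`: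
`nameVal G τ = {nameVal G σ | ∃ p ∈ G, (σ, p) ∈ τ}`. -/
def nameVal (G : ZFSet.{0}) : ZFSet.{0} → ZFSet.{0} :=
  (ZFSet.mem_wf.transGen).fix (C := fun _ => ZFSet.{0}) fun τ ih =>
    img (fun σ => if h : Relation.TransGen (· ∈ ·) σ τ then ih σ h else ∅)
      (ZFSet.sep (fun σ => ∃ p, p ∈ G ∧ ZFSet.pair σ p ∈ τ)
        (ZFSet.sUnion (ZFSet.sUnion τ)))

/-- The generic extension `M[G]` of a transitive set model `M`, via names. -/
def extSet (M G : ZFSet.{0}) : Set ZFSet.{0} := {x | ∃ τ, τ ∈ M ∧ x = nameVal G τ}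

/-! ### Remarkable cardinals (Schindler), relative to a ground model class -/

/-- Clubs of countable subsets of `S`, as computed in the (transitive) model
`E`: the club is coded by a set `D ∈ E`, its members are subsets of `S`
countably infinite in `E`, it is cofinal among such sets lying in `E`, and it
is closed under unions of increasing `ω`-chains coded in `E`. -/
def ClubSubIn (E : Set ZFSet.{0}) (S : Set ZFSet.{0}) (D : ZFSet.{0}) : Prop :=
  D ∈ E ∧
  (∀ X, X ∈ D → X.toSet ⊆ S ∧ CtblInfIn E X) ∧
  (∀ X : ZFSet.{0}, X ∈ E → X.toSet ⊆ S → CtblInfIn E X → ∃ Y, Y ∈ D ∧ X ⊆ Y) ∧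
  (∀ g, g ∈ E → ZFSet.IsFunc ZFSet.omega D g →
    (∀ n y y', n ∈ ZFSet.omega → ZFSet.pair n y ∈ g →
      ZFSet.pair (insert n n) y' ∈ g → y ⊆ y') →
    ZFSet.sUnion (imageOf g) ∈ D)

/-- Stationarity of a collection `C` of countable subsets of `S`, as computed
in the model `E`. -/
def StatSubIn (E : Set ZFSet.{0}) (S : Set ZFSet.{0}) (C : Set ZFSet.{0}) : Prop :=
  ∀ D : ZFSet.{0}, ClubSubIn E S D → ∃ X, X ∈ C ∧ X ∈ D

/-- `X` condenses remarkably (with ground model `W`, extension operation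
`Ext` sending a generic object to the corresponding extension of `W`,
collapse height `δ`, target `θ`, and generic `G`):  `X = ran(π)` for some
elementary `π : (H_β^{W[G∩H_α^W]}, ∈, H_β^W, G∩H_α^W) → (H_θ^{W[G]}, ∈, H_θ^W, G)`
with `α = crit(π) < β < δ` and `β` a cardinal of `W`. -/
def CondensesRemarkably (W : Set ZFSet.{0}) (Ext : ZFSet.{0} → Set ZFSet.{0})
    (δ θ G X : ZFSet.{0}) : Prop :=
  ∃ (f : ZFSet.{0} → ZFSet.{0}) (α β : ZFSet.{0}), IsOrd α ∧ α ∈ β ∧ β ∈ δ ∧ CardIn W β ∧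
    (∀ ξ, ξ ∈ α → f ξ = ξ) ∧ f α ≠ α ∧
    (let Gα : ZFSet.{0} := ZFSet.sep (fun p => p ∈ HsetIn W α) G
     let Dom : Set ZFSet.{0} := HsetIn (Ext Gα) β
     let Cod : Set ZFSet.{0} := HsetIn (Ext G) θ
     Set.MapsTo f Dom Cod ∧ X.toSet = f '' Dom ∧
     ∀ (n : ℕ) (φ : Fml n) (v : Fin n → ZFSet.{0}), (∀ i, v i ∈ Dom) →
       (SatAB Dom W Gα.toSet φ v ↔ SatAB Cod W G.toSet φ (f ∘ v)))

/-- `δ` is `θ`-remarkable, in the sense of the (transitive) ground model `W`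
with extensions given by `Ext`: for every `G` which is `Col(ω, <δ)`-generic
over `W`, in `W[G]` the set of countable `X ⊆ H_θ^{W[G]}` which condense
remarkably is stationary. -/
def ThetaRemarkableVia (W : Set ZFSet.{0}) (Ext : ZFSet.{0} → Set ZFSet.{0})
    (δ θ : ZFSet.{0}) : Prop :=
  ∀ G, GenericOver W (ColLt δ) G →
    StatSubIn (Ext G) (HsetIn (Ext G) θ)
      {X | CondensesRemarkably W Ext δ θ G X}

/-- `δ` is remarkable in the sense of `(W, Ext)`:  `θ`-remarkable for every
regular (in `W`) `θ > δ`. -/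
def RemarkableVia (W : Set ZFSet.{0}) (Ext : ZFSet.{0} → Set ZFSet.{0}) (δ : ZFSet.{0}) : Prop :=
  ∀ θ, RegularIn W θ → δ ∈ θ → ThetaRemarkableVia W Ext δ θ

/-! ### Indiscernibles and sharps -/

/-- `I` is a set (or class) of ordinal indiscernibles for the structure
`(S, ∈, A)`. -/
def IndiscFor (S A : Set ZFSet.{0}) (I : Set ZFSet.{0}) : Prop :=
  (∀ x ∈ I, IsOrd x ∧ x ∈ S) ∧
  ∀ (n : ℕ) (φ : Fml n) (v w : Fin n → ZFSet.{0}),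
    (∀ i, v i ∈ I) → (∀ i, w i ∈ I) →
    (∀ i j : Fin n, i < j → v i ∈ v j) → (∀ i j : Fin n, i < j → w i ∈ w j) →
    (SatAB S A ∅ φ v ↔ SatAB S A ∅ φ w)

/-- `0♯` exists: for some uncountable limit ordinal `λ`, `L_λ` has an
uncountable set of indiscernibles. -/
def ZeroSharpExists : Prop :=
  ∃ lam : ZFSet.{0}, IsLimitOrd lam ∧ ¬ lam.toSet.Countable ∧
    ∃ I : ZFSet.{0}, ¬ I.toSet.Countable ∧ IndiscFor (Lstage lam).toSet ∅ I.toSet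

/-- The sharp of `L[A]` exists: for some uncountable limit ordinal `λ`, the
structure `(L_λ[A], ∈, A)` has an uncountable set of indiscernibles. -/
def SharpOverExists (A : ZFSet.{0}) : Prop :=
  ∃ lam : ZFSet.{0}, IsLimitOrd lam ∧ ¬ lam.toSet.Countable ∧
    ∃ I : ZFSet.{0}, ¬ I.toSet.Countable ∧
      IndiscFor (LstageA A.toSet lam).toSet A.toSet I.toSet

/-- `I` is a closed unbounded proper class of ordinals. -/
def ProperClassClub (I : Set ZFSet.{0}) : Prop :=
  (∀ x ∈ I, IsOrd x) ∧
  (∀ α, IsOrd α → ∃ β, IsOrd β ∧ α ∈ β ∧ β ∈ I) ∧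
  (∀ α, IsOrd α → α ≠ ∅ → (∀ β ∈ α, ∃ θ, θ ∈ I ∧ θ ∈ α ∧ (β ∈ θ ∨ β = θ)) → α ∈ I)

/-- `s` is (a real coding) `0♯`: there is a closed unbounded proper class `I`
of Silver indiscernibles for `L` and `s` is the set of codes of formulas
satisfied in `L` by increasing tuples from `I`. -/
def IsZeroSharpReal (s : ZFSet.{0}) : Prop :=
  s ⊆ ZFSet.omega ∧
  ∃ I : Set ZFSet.{0}, ProperClassClub I ∧ IndiscFor LClass ∅ I ∧
    s = ZFSet.sep (fun m => ∃ (n : ℕ) (φ : Fml n) (v : Fin n → ZFSet.{0}),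
          (∀ i, v i ∈ I) ∧ (∀ i j : Fin n, i < j → v i ∈ v j) ∧
          Sat LClass φ v ∧ m = natZ (Nat.pair n (codeF φ))) ZFSet.omega

/-! ### Admissible ordinals and Harrington's Principle -/

/-- The (graph of the) function `f` is `Σ₁`-definable with parameters over the
structure `(S, ∈)`. -/
def Sigma1DefOver (S : Set ZFSet.{0}) (f : ZFSet.{0} → ZFSet.{0}) : Prop :=
  ∃ (n : ℕ) (ψ : Fml (n + 3)), IsDelta0 ψ ∧
    ∃ p : Fin n → ZFSet.{0}, (∀ i, p i ∈ S) ∧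
      ∀ a b, a ∈ S → b ∈ S →
        (f a = b ↔ Sat S (Fml.ex ψ) (Fin.cons a (Fin.cons b p)))

/-- `α` is `x`-admissible: `α > ω` is a limit ordinal and no
`Σ₁(L_α[x])`-definable function maps some `δ < α` cofinally into `α`. -/
def Admissible (x α : ZFSet.{0}) : Prop :=
  IsLimitOrd α ∧ ZFSet.omega ∈ α ∧
  ¬ ∃ δ, δ ∈ α ∧ ∃ f : ZFSet.{0} → ZFSet.{0},
      Sigma1DefOver (LstageA x.toSet α).toSet f ∧
      (∀ β, β ∈ δ → f β ∈ α) ∧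
      ∀ ξ, ξ ∈ α → ∃ β, β ∈ δ ∧ (ξ ∈ f β ∨ ξ = f β)

/-- The generalized Harrington Principle `HP(M)` for the inner model given by
the class `W`: there is a real `x` such that every `x`-admissible ordinal is a
cardinal of `W`. -/
def HPclass (W : Set ZFSet.{0}) : Prop :=
  ∃ x : ZFSet.{0}, x ⊆ ZFSet.omega ∧ ∀ α, Admissible x α → CardIn W α

/-- Harrington's Principle `HP(L)`. -/
def HPL : Prop := HPclass LClass

/-- `HP(L)` as computed inside the (transitive) model `W`. -/
def HPLIn (W : Set ZFSet.{0}) : Prop :=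
  ∃ x, x ∈ W ∧ x ⊆ ZFSet.omega ∧
    ∀ α, α ∈ W → Admissible x α → CardIn (LClassIn W) α

/-! ### Inner models, elementary embeddings, rigidity, covering -/

/-- `W` is an inner model: a transitive proper class containing all ordinals
and satisfying ZFC. -/
def InnerModelClass (W : Set ZFSet.{0}) : Prop :=
  (∀ x, x ∈ W → x.toSet ⊆ W) ∧ (∀ α : ZFSet.{0}, IsOrd α → α ∈ W) ∧ ModelsZFC W

/-- `j` is an elementary embedding of the class `(W, ∈)` into itself. -/
def ElemEmbOn (W : Set ZFSet.{0}) (j : ZFSet.{0} → ZFSet.{0}) : Prop :=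
  Set.MapsTo j W W ∧
  ∀ (n : ℕ) (φ : Fml n) (v : Fin n → ZFSet.{0}),
    (∀ i, v i ∈ W) → (Sat W φ v ↔ Sat W φ (j ∘ v))

/-- `W` has the rigidity property: there is no nontrivial elementary embedding
from `W` to `W`. -/
def RigidClass (W : Set ZFSet.{0}) : Prop :=
  ¬ ∃ j : ZFSet.{0} → ZFSet.{0}, ElemEmbOn W j ∧ ∃ x, x ∈ W ∧ j x ≠ x

/-- `W` has the full covering property: every set `X` of ordinals is covered
by some `Y ∈ W` with `|Y| = |X| + ω₁`. -/
def FullCovering (W : Set ZFSet.{0}) : Prop :=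
  ∀ X : ZFSet.{0}, (∀ z ∈ X, IsOrd z) →
    ∃ Y, Y ∈ W ∧ X ⊆ Y ∧ Nonempty (Y.toSet ≃ (X.toSet ⊕ (Aleph 1).toSet))

/-- The restriction `M|θ` of the inner model `W`: its elements of rank `< θ`. -/
def restrictTo (W : Set ZFSet.{0}) (θ : ZFSet.{0}) : Set ZFSet.{0} :=
  {x | x ∈ W ∧ rankZ x ∈ θ}

/-- The class `S` is definable (with parameters) in `H_θ`. -/
def DefinableInH (θ : ZFSet.{0}) (S : Set ZFSet.{0}) : Prop :=
  ∃ (n : ℕ) (φ : Fml (n + 1)) (v : Fin n → ZFSet.{0}),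
    (∀ i, v i ∈ Hset θ) ∧ ∀ x, x ∈ Hset θ → (x ∈ S ↔ Sat (Hset θ) φ (Fin.cons x v))

/-- `ν` is weakly inaccessible in `W`: a regular limit cardinal of `W`. -/
def WeaklyInaccIn (W : Set ZFSet.{0}) (ν : ZFSet.{0}) : Prop :=
  RegularIn W ν ∧ ZFSet.omega ∈ ν ∧
    ∀ β, β ∈ ν → ∃ δ, δ ∈ ν ∧ β ∈ δ ∧ CardIn W δ

/-! ### Measures, `κ`-models and `0†` -/

/-- `⟨L[U], ∈, U⟩ ⊨ "U is a normal ultrafilter over κ"`:  `L[U]` is a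
`κ`-model. -/
def IsKappaModel (κ U : ZFSet.{0}) : Prop :=
  IsOrd κ ∧ ZFSet.omega ∈ κ ∧ U ∈ LrelClass U ∧
  (∀ X, X ∈ U → X ⊆ κ ∧ X ∈ LrelClass U) ∧ κ ∈ U ∧ (∅ : ZFSet.{0}) ∉ U ∧
  (∀ X Y, X ∈ U → Y ∈ U → X ∩ Y ∈ U) ∧
  (∀ X Y, X ∈ U → Y ∈ LrelClass U → X ⊆ Y → Y ⊆ κ → Y ∈ U) ∧
  (∀ X, X ∈ LrelClass U → X ⊆ κ → (X ∈ U ∨ κ \ X ∈ U)) ∧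
  (∀ α, α ∈ κ → (insert α ∅ : ZFSet.{0}) ∉ U) ∧
  (∀ δ g, δ ∈ κ → g ∈ LrelClass U → ZFSet.IsFunc δ (ZFSet.powerset κ) g →
    (∀ ξ y, ZFSet.pair ξ y ∈ g → y ∈ U) →
    ZFSet.sep (fun β => ∀ ξ, ξ ∈ δ → ∀ y, ZFSet.pair ξ y ∈ g → β ∈ y) κ ∈ U) ∧
  (∀ f X, f ∈ LrelClass U → X ∈ U → ZFSet.IsFunc κ κ f →
    (∀ α, α ∈ X → α ≠ ∅ → ∀ y, ZFSet.pair α y ∈ f → y ∈ α) →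
    ∃ β Y, β ∈ κ ∧ Y ∈ U ∧ ∀ α, α ∈ Y → ZFSet.pair α β ∈ f)

/-- `0†` exists: there is a `κ`-model (for some `κ`) and a nontrivial
elementary embedding from that model to itself with critical point
greater than `κ`. -/
def ZeroDaggerExists : Prop :=
  ∃ κ U : ZFSet.{0}, IsKappaModel κ U ∧
    ∃ j : ZFSet.{0} → ZFSet.{0}, ElemEmbOn (LrelClass U) j ∧
      ∃ η, IsOrd η ∧ κ ∈ η ∧ (∀ β, β ∈ η → j β = β) ∧ j η ≠ η

/-- `U` witnesses that `κ` is a measurable cardinal (in `V`): `U` is a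
`κ`-complete nonprincipal normal ultrafilter on `κ`. -/
def IsMeasureOn (κ U : ZFSet.{0}) : Prop :=
  IsOrd κ ∧ ZFSet.omega ∈ κ ∧
  (∀ X, X ∈ U → X ⊆ κ) ∧ κ ∈ U ∧ (∅ : ZFSet.{0}) ∉ U ∧
  (∀ X Y, X ∈ U → Y ∈ U → X ∩ Y ∈ U) ∧
  (∀ X Y, X ∈ U → X ⊆ Y → Y ⊆ κ → Y ∈ U) ∧
  (∀ X : ZFSet.{0}, X ⊆ κ → (X ∈ U ∨ κ \ X ∈ U)) ∧
  (∀ α, α ∈ κ → (insert α ∅ : ZFSet.{0}) ∉ U) ∧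
  (∀ x : ZFSet.{0}, x.toSet ⊆ U.toSet → CardLT x κ → x ≠ ∅ →
    ZFSet.sep (fun β => ∀ y, y ∈ x → β ∈ y) κ ∈ U) ∧
  (∀ f X, X ∈ U → ZFSet.IsFunc κ κ f →
    (∀ α, α ∈ X → α ≠ ∅ → ∀ y, ZFSet.pair α y ∈ f → y ∈ α) →
    ∃ β Y, β ∈ κ ∧ Y ∈ U ∧ ∀ α, α ∈ Y → ZFSet.pair α β ∈ f)

/-- `κ` is a measurable cardinal. -/
def IsMeasurable (κ : ZFSet.{0}) : Prop := ∃ U, IsMeasureOn κ U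

/-- `U ∈ W` witnesses measurability of `κ` inside the inner model `W`. -/
def MeasurableIn (W : Set ZFSet.{0}) (κ U : ZFSet.{0}) : Prop :=
  U ∈ W ∧ IsOrd κ ∧ ZFSet.omega ∈ κ ∧
  (∀ X, X ∈ U → X ⊆ κ) ∧ κ ∈ U ∧ (∅ : ZFSet.{0}) ∉ U ∧
  (∀ X Y, X ∈ U → Y ∈ U → X ∩ Y ∈ U) ∧
  (∀ X Y, X ∈ U → Y ∈ W → X ⊆ Y → Y ⊆ κ → Y ∈ U) ∧
  (∀ X, X ∈ W → X ⊆ κ → (X ∈ U ∨ κ \ X ∈ U)) ∧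
  (∀ α, α ∈ κ → (insert α ∅ : ZFSet.{0}) ∉ U) ∧
  (∀ δ g, δ ∈ κ → g ∈ W → ZFSet.IsFunc δ (ZFSet.powerset κ) g →
    (∀ ξ y, ZFSet.pair ξ y ∈ g → y ∈ U) →
    ZFSet.sep (fun β => ∀ ξ, ξ ∈ δ → ∀ y, ZFSet.pair ξ y ∈ g → β ∈ y) κ ∈ U)

/-- There is an inner model with a measurable cardinal. -/
def ExistsInnerModelMeasurable : Prop :=
  ∃ W : Set ZFSet.{0}, InnerModelClass W ∧ ∃ κ U, MeasurableIn W κ U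

/-! ### Core-model-like inner models -/

/-- `W` satisfies the GCH. -/
def GCHIn (W : Set ZFSet.{0}) : Prop :=
  ∀ κ, CardIn W κ → (ZFSet.omega ∈ κ ∨ ZFSet.omega = κ) →
    ∃ f, f ∈ W ∧ IsInjF (ZFSet.sep (fun z => z ∈ W) (ZFSet.powerset κ))
      (SuccCardIn W κ) f

/-- `W` has the condensation property: the transitive collapse of any
elementary submodel of an initial segment of `W` is again an initial segment
of `W`. -/
def CondensationFor (W : Set ZFSet.{0}) : Prop :=
  ∀ θ : ZFSet.{0}, IsOrd θ → ∀ X : ZFSet.{0},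
    X.toSet ⊆ restrictTo W θ → ElemSub X (restrictTo W θ) →
    ∃ θ', IsOrd θ' ∧ (collapseSet X).toSet = restrictTo W θ'

/-- The properties of the Dodd–Jensen core model `K` (below a measurable
cardinal) which are relevant here: `K` is an inner model satisfying the GCH,
with condensation, and (by Dodd–Jensen, given that there is no inner model
with a measurable) the rigidity property. -/
def CoreModelProps (W : Set ZFSet.{0}) : Prop :=
  InnerModelClass W ∧ GCHIn W ∧ CondensationFor W ∧ RigidClass W

/-! ### `L(ℝ)`, determinacy, and `HOD` -/

/-- The base of the `L(ℝ)` hierarchy: the transitive closure of `{𝒫(ω)}`. -/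
def lrBase : ZFSet.{0} :=
  insert (ZFSet.powerset ZFSet.omega) (tcl (ZFSet.powerset ZFSet.omega))

/-- The hierarchy `L_α(ℝ)`. -/
def LRstage : ZFSet.{0} → ZFSet.{0} :=
  ZFSet.mem_wf.fix (C := fun _ => ZFSet.{0}) fun α ih =>
    lrBase ∪ ZFSet.sUnion
      (img (fun β => if h : β ∈ α then DefSetA ∅ (ih β h) else ∅) α)

/-- The class `L(ℝ)`. -/
def LRClass : Set ZFSet.{0} := {x | ∃ α, IsOrd α ∧ x ∈ LRstage α}

/-- The `ZFSet` coding the function `ω → ω` given by `g`. -/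
def seqCode (g : ℕ → ℕ) : ZFSet.{0} :=
  img (fun m => ZFSet.pair m (natZ (g (zfToNat m)))) ZFSet.omega

/-- The game on `ω` with payoff `A` (a set of coded functions `ω → ω`) is
determined: one of the two players has a winning strategy. -/
def DeterminedZ (A : ZFSet.{0}) : Prop :=
  (∃ σ : List ℕ → ℕ, ∀ g : ℕ → ℕ,
    (∀ n : ℕ, g (2 * n) = σ (List.ofFn (fun i : Fin (2 * n) => g i.val))) →
    seqCode g ∈ A) ∨
  (∃ τ : List ℕ → ℕ, ∀ g : ℕ → ℕ,
    (∀ n : ℕ, g (2 * n + 1) = τ (List.ofFn (fun i : Fin (2 * n + 1) => g i.val))) →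
    seqCode g ∉ A)

/-- `AD^{L(ℝ)}`: every set of reals in `L(ℝ)` is determined.  (Since every
real, and every strategy, belongs to `L(ℝ)`, this is equivalent to `L(ℝ) ⊨ AD`.) -/
def ADinLR : Prop :=
  ∀ A, A ∈ LRClass → (∀ f, f ∈ A → ZFSet.IsFunc ZFSet.omega ZFSet.omega f) →
    DeterminedZ A

/-- `x` is ordinal definable. -/
def IsOD (x : ZFSet.{0}) : Prop :=
  ∃ (n : ℕ) (φ : Fml (n + 1)) (v : Fin n → ZFSet.{0}),
    (∀ i, IsOrd (v i)) ∧ ∀ y, (Sat Set.univ φ (Fin.cons y v) ↔ y = x)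

/-- The class `HOD` of hereditarily ordinal definable sets. -/
def HODClass : Set ZFSet.{0} :=
  {x | IsOD x ∧ ∀ y, y ∈ tcl x → IsOD y}

/-- The class `L[A]` as computed inside the (transitive) model `W`. -/
def LrelClassIn (W : Set ZFSet.{0}) (A : ZFSet.{0}) : Set ZFSet.{0} :=
  {x | ∃ α, IsOrd α ∧ α ∈ W ∧ x ∈ LstageA A.toSet α}

/-! ## The statement -/

/-! ### Uniform definability over families of structures -/

/-- A structure `(S, ∈, A, B)` for the language of `Fml`. -/
structure Str where
  S : Set ZFSet.{0}
  A : Set ZFSet.{0}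
  B : Set ZFSet.{0}

/-- Prepend a value to an infinite variable assignment. -/
def scons (x : ZFSet.{0}) (v : ℕ → ZFSet.{0}) : ℕ → ZFSet.{0}
  | 0 => x
  | n + 1 => v n

/-- Renaming of the free variables of a formula. -/
def Fml.rename : ∀ {n m : ℕ}, (Fin n → Fin m) → Fml n → Fml m
  | _, _, r, .mem i j => .mem (r i) (r j)
  | _, _, r, .eq i j => .eq (r i) (r j)
  | _, _, r, .inA i => .inA (r i)
  | _, _, r, .inB i => .inB (r i)
  | _, _, r, .not φ => .not (φ.rename r)
  | _, _, r, .and φ ψ => .and (φ.rename r) (ψ.rename r)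
  | _, _, r, .ex φ => .ex (φ.rename (Fin.cons 0 (fun i => (r i).succ)))

theorem satAB_rename (S A B : Set ZFSet.{0}) {n : ℕ} (φ : Fml n) :
    ∀ {m : ℕ} (r : Fin n → Fin m) (v : Fin m → ZFSet.{0}),
      SatAB S A B (φ.rename r) v ↔ SatAB S A B φ (fun i => v (r i)) := by
  induction φ with
  | mem i j => intros; rfl
  | eq i j => intros; rfl
  | inA i => intros; rfl
  | inB i => intros; rfl
  | not φ ih => intro m r v; exact not_congr (ih r v)
  | and φ ψ ih1 ih2 => intro m r v; exact and_congr (ih1 r v) (ih2 r v)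
  | ex φ ih =>
    intro m r v
    refine exists_congr fun x => and_congr_right fun _ => ?_
    rw [ih]
    have : (fun i => (Fin.cons x v : Fin (m + 1) → ZFSet.{0})
        ((Fin.cons 0 (fun i => (r i).succ) : Fin _ → Fin (m + 1)) i)) =
        Fin.cons x (fun i => v (r i)) := by
      funext i
      refine Fin.cases ?_ (fun i => ?_) i <;> simp
    rw [this]

/-- `P` is expressed by a single formula over all structures of the family `M`. -/
class Dfn (M : Set Str) (P : (ℕ → ZFSet.{0}) → Prop) : Prop where
  out : ∃ (n : ℕ) (φ : Fml n), ∀ m ∈ M, ∀ v : ℕ → ZFSet.{0}, (∀ k, v k ∈ m.S) →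
    (P v ↔ SatAB m.S m.A m.B φ (fun i => v i))

/-- `f` maps assignments in a structure of the family `M` into that structure, and its graph is
expressed by a single formula over all structures of `M`. -/
class DTerm (M : Set Str) (f : (ℕ → ZFSet.{0}) → ZFSet.{0}) : Prop where
  mem : ∀ m ∈ M, ∀ v : ℕ → ZFSet.{0}, (∀ k, v k ∈ m.S) → f v ∈ m.S
  graph : Dfn M (fun w => w 0 = f (fun k => w (k + 1)))

/-- All structures of the family `M` are transitive. -/
class TransFam (M : Set Str) : Prop where
  out : ∀ m ∈ M, ∀ x ∈ m.S, ∀ y ∈ x, y ∈ m.S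

/-- `M` is a family of structures with the same underlying class `E`. -/
class UnivFam (M : Set Str) (E : outParam (Set ZFSet.{0})) : Prop where
  out : ∀ m ∈ M, m.S = E

namespace Dfn

variable {M : Set Str} {P Q : (ℕ → ZFSet.{0}) → Prop}

theorem lift (h : Dfn M P) : ∃ n₀ : ℕ, ∀ n, n₀ ≤ n → ∃ φ : Fml n, ∀ m ∈ M, ∀ v : ℕ → ZFSet.{0},
    (∀ k, v k ∈ m.S) → (P v ↔ SatAB m.S m.A m.B φ (fun i => v i)) := by
  obtain ⟨n, φ, hφ⟩ := h.out
  refine ⟨n, fun n' hn => ⟨φ.rename (Fin.castLE hn), fun m hm v hv => ?_⟩⟩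
  rw [satAB_rename]
  exact hφ m hm v hv

theorem congr (hP : Dfn M P)
    (h : ∀ m ∈ M, ∀ v : ℕ → ZFSet.{0}, (∀ k, v k ∈ m.S) → (Q v ↔ P v)) : Dfn M Q := by
  obtain ⟨n, φ, hφ⟩ := hP.out
  exact ⟨n, φ, fun m hm v hv => (h m hm v hv).trans (hφ m hm v hv)⟩

theorem rename (hP : Dfn M P) (r : ℕ → ℕ) : Dfn M (fun v => P (fun k => v (r k))) := by
  obtain ⟨n, φ, hφ⟩ := hP.out
  obtain ⟨N, hN⟩ : ∃ N, ∀ i : Fin n, r i < N :=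
    ⟨(Finset.univ.sup fun i : Fin n => r i) + 1, fun i =>
      Nat.lt_succ_of_le (Finset.le_sup (f := fun i : Fin n => r i) (Finset.mem_univ i))⟩
  refine ⟨N, φ.rename (fun i => ⟨r i, hN i⟩), fun m hm v hv => ?_⟩
  rw [satAB_rename]
  exact hφ m hm (fun k => v (r k)) fun k => hv _

instance not [hP : Dfn M P] : Dfn M (fun v => ¬ P v) := by
  obtain ⟨n, φ, hφ⟩ := hP.out
  exact ⟨n, .not φ, fun m hm v hv => not_congr (hφ m hm v hv)⟩

instance and [hP : Dfn M P] [hQ : Dfn M Q] : Dfn M (fun v => P v ∧ Q v) := by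
  obtain ⟨n, hn⟩ := hP.lift
  obtain ⟨k, hk⟩ := hQ.lift
  obtain ⟨φ, hφ⟩ := hn (max n k) (le_max_left _ _)
  obtain ⟨ψ, hψ⟩ := hk (max n k) (le_max_right _ _)
  exact ⟨_, .and φ ψ, fun m hm v hv => and_congr (hφ m hm v hv) (hψ m hm v hv)⟩

instance or [Dfn M P] [Dfn M Q] : Dfn M (fun v => P v ∨ Q v) :=
  (inferInstance : Dfn M (fun v => ¬ (¬ P v ∧ ¬ Q v))).congr fun _ _ _ _ => by tauto

instance imp [Dfn M P] [Dfn M Q] : Dfn M (fun v => P v → Q v) :=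
  (inferInstance : Dfn M (fun v => ¬ (P v ∧ ¬ Q v))).congr fun _ _ _ _ => by tauto

instance iff [Dfn M P] [Dfn M Q] : Dfn M (fun v => (P v ↔ Q v)) :=
  (inferInstance : Dfn M (fun v => (P v → Q v) ∧ (Q v → P v))).congr fun _ _ _ _ => by tauto

theorem exS {Q : ZFSet.{0} → (ℕ → ZFSet.{0}) → Prop}
    (h : Dfn M (fun w => Q (w 0) (fun k => w (k + 1)))) :
    ∃ (n : ℕ) (φ : Fml n), ∀ m ∈ M, ∀ v : ℕ → ZFSet.{0}, (∀ k, v k ∈ m.S) →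
      ((∃ x ∈ m.S, Q x v) ↔ SatAB m.S m.A m.B φ (fun i => v i)) := by
  obtain ⟨n, hn⟩ := h.lift
  obtain ⟨φ, hφ⟩ := hn (n + 1) (Nat.le_succ _)
  refine ⟨n, .ex φ, fun m hm v hv => exists_congr fun x => and_congr_right fun hx => ?_⟩
  have := hφ m hm (scons x v) (fun k => by cases k <;> simp [scons, hx, hv])
  refine this.trans (iff_of_eq (congrArg _ ?_))
  funext i
  refine Fin.cases ?_ (fun i => ?_) i <;> simp [scons]

theorem comp1 {Q : ZFSet.{0} → (ℕ → ZFSet.{0}) → Prop} {f : (ℕ → ZFSet.{0}) → ZFSet.{0}}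
    (h : Dfn M (fun w => Q (w 0) (fun k => w (k + 1)))) [hf : DTerm M f] :
    Dfn M (fun v => Q (f v) v) := by
  have := hf.graph
  obtain ⟨n, φ, hφ⟩ := exS (Q := fun x v => x = f v ∧ Q x v) (M := M)
    (inferInstance : Dfn M (fun w => w 0 = f (fun k => w (k + 1)) ∧ Q (w 0) (fun k => w (k + 1))))
  refine ⟨n, φ, fun m hm v hv => Iff.trans ?_ (hφ m hm v hv)⟩
  constructor
  · intro hq
    exact ⟨f v, hf.mem m hm v hv, rfl, hq⟩
  · rintro ⟨x, -, rfl, hq⟩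
    exact hq

end Dfn

namespace Dfn

variable {M : Set Str} {f g h k : (ℕ → ZFSet.{0}) → ZFSet.{0}}

theorem mem_var (i j : ℕ) : Dfn M (fun v => v i ∈ v j) :=
  ⟨max i j + 1, .mem ⟨i, by omega⟩ ⟨j, by omega⟩, fun _ _ _ _ => Iff.rfl⟩

theorem eq_var (i j : ℕ) : Dfn M (fun v => v i = v j) :=
  ⟨max i j + 1, .eq ⟨i, by omega⟩ ⟨j, by omega⟩, fun _ _ _ _ => Iff.rfl⟩

instance _root_.SRPPaper.DTerm.var (i : ℕ) : DTerm M (fun v => v i) :=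
  ⟨fun _ _ _ hv => hv i, eq_var 0 (i + 1)⟩

theorem _root_.SRPPaper.DTerm.rename (hf : DTerm M f) (r : ℕ → ℕ) :
    DTerm M (fun v => f (fun k => v (r k))) :=
  ⟨fun m hm _ hv => hf.mem m hm _ fun _ => hv _,
    hf.graph.rename (fun | 0 => 0 | k + 1 => r k + 1)⟩

theorem of1 {R : ZFSet.{0} → Prop} (hR : Dfn M (fun v => R (v 0))) (f : (ℕ → ZFSet.{0}) → ZFSet.{0})
    [DTerm M f] : Dfn M (fun v => R (f v)) :=
  comp1 (Q := fun x _ => R x) hR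

theorem of2 {R : ZFSet.{0} → ZFSet.{0} → Prop} (hR : Dfn M (fun v => R (v 0) (v 1)))
    (f g : (ℕ → ZFSet.{0}) → ZFSet.{0}) [DTerm M f] [hg : DTerm M g] :
    Dfn M (fun v => R (f v) (g v)) := by
  have := hg.rename (· + 1)
  refine comp1 (Q := fun x v => R x (g v)) ?_
  refine comp1 (Q := fun y v => R (v 0) y) (f := fun v => g (fun k => v (k + 1))) ?_
  exact hR.rename (fun | 0 => 1 | _ => 0)

theorem of3 {R : ZFSet.{0} → ZFSet.{0} → ZFSet.{0} → Prop}
    (hR : Dfn M (fun v => R (v 0) (v 1) (v 2)))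
    (f g h : (ℕ → ZFSet.{0}) → ZFSet.{0}) [hf : DTerm M f] [hg : DTerm M g] [DTerm M h] :
    Dfn M (fun v => R (f v) (g v) (h v)) := by
  have := hf.rename (· + 2)
  have := hg.rename (· + 1)
  refine comp1 (Q := fun x v => R (f v) (g v) x) ?_
  refine comp1 (Q := fun x v => R (f fun k => v (k + 1)) x (v 0))
    (f := fun v => g fun k => v (k + 1)) ?_
  refine comp1 (Q := fun x v => R x (v 0) (v 1)) (f := fun v => f fun k => v (k + 2)) ?_
  exact hR.rename id

instance mem [DTerm M f] [DTerm M g] : Dfn M (fun v => f v ∈ g v) :=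
  of2 (R := fun a b => a ∈ b) (mem_var 0 1) f g

instance eq [DTerm M f] [DTerm M g] : Dfn M (fun v => f v = g v) :=
  of2 (R := fun a b => a = b) (eq_var 0 1) f g

instance bex [TransFam M] {Q : ZFSet.{0} → (ℕ → ZFSet.{0}) → Prop} [hf : DTerm M f]
    [h : Dfn M (fun w => Q (w 0) (fun k => w (k + 1)))] :
    Dfn M (fun v => ∃ x ∈ f v, Q x v) := by
  have := hf.rename (· + 1)
  obtain ⟨n, φ, hφ⟩ := exS (Q := fun x v => x ∈ f v ∧ Q x v) (M := M)
    (inferInstance : Dfn M (fun w => w 0 ∈ f (fun k => w (k + 1)) ∧ Q (w 0) (fun k => w (k + 1))))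
  refine ⟨n, φ, fun m hm v hv => Iff.trans ?_ (hφ m hm v hv)⟩
  constructor
  · rintro ⟨x, hx, hq⟩
    exact ⟨x, TransFam.out m hm _ (hf.mem m hm v hv) x hx, hx, hq⟩
  · rintro ⟨x, -, hx, hq⟩
    exact ⟨x, hx, hq⟩

instance ball [TransFam M] {Q : ZFSet.{0} → (ℕ → ZFSet.{0}) → Prop} [DTerm M f]
    [Dfn M (fun w => Q (w 0) (fun k => w (k + 1)))] :
    Dfn M (fun v => ∀ x ∈ f v, Q x v) :=
  (inferInstance : Dfn M (fun v => ¬ ∃ x ∈ f v, ¬ Q x v)).congr fun _ _ _ _ => by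
    simp

instance exE {E : Set ZFSet.{0}} [hE : UnivFam M E] {Q : ZFSet.{0} → (ℕ → ZFSet.{0}) → Prop}
    [h : Dfn M (fun w => Q (w 0) (fun k => w (k + 1)))] :
    Dfn M (fun v => ∃ x ∈ E, Q x v) := by
  obtain ⟨n, φ, hφ⟩ := exS h
  refine ⟨n, φ, fun m hm v hv => ?_⟩
  rw [← hφ m hm v hv, hE.out m hm]

instance allE {E : Set ZFSet.{0}} [UnivFam M E] {Q : ZFSet.{0} → (ℕ → ZFSet.{0}) → Prop}
    [Dfn M (fun w => Q (w 0) (fun k => w (k + 1)))] :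
    Dfn M (fun v => ∀ x ∈ E, Q x v) :=
  (inferInstance : Dfn M (fun v => ¬ ∃ x ∈ E, ¬ Q x v)).congr fun _ _ _ _ => by
    simp

/-! ### Basic absolute notions -/

section Basic

variable [TransFam M]

instance subset [DTerm M f] [DTerm M g] : Dfn M (fun v => f v ⊆ g v) :=
  of2 (R := fun a b => a ⊆ b) ((inferInstance : Dfn M (fun v => ∀ x ∈ v 0, x ∈ v 1)).congr
    fun _ _ _ _ => Iff.rfl) f g

instance isTransitive [DTerm M f] : Dfn M (fun v => (f v).IsTransitive) :=
  of1 (R := fun a => a.IsTransitive) (inferInstance : Dfn M (fun v => ∀ x ∈ v 0, x ⊆ v 0)) f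

instance isOrd [DTerm M f] : Dfn M (fun v => IsOrd (f v)) :=
  of1 (R := fun a => IsOrd a)
    (inferInstance : Dfn M (fun v => (v 0).IsTransitive ∧ ∀ x ∈ v 0, x.IsTransitive)) f

end Basic

end Dfn

namespace Dfn

variable {M : Set Str} [TransFam M] {f g h k : (ℕ → ZFSet.{0}) → ZFSet.{0}}

theorem isEmpty [DTerm M f] : Dfn M (fun v => f v = ∅) :=
  of1 (R := fun a => a = ∅) ((inferInstance : Dfn M (fun v => ∀ x ∈ v 0, x ≠ x)).congr
    fun _ _ _ _ => by simp [ZFSet.eq_empty]) f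

theorem eq_upair [DTerm M f] [DTerm M g] [DTerm M h] : Dfn M (fun v => f v = {g v, h v}) :=
  of3 (R := fun p a b => p = {a, b}) ((inferInstance : Dfn M (fun v =>
    v 1 ∈ v 0 ∧ v 2 ∈ v 0 ∧ ∀ x ∈ v 0, x = v 1 ∨ x = v 2)).congr
    fun _ _ _ _ => by
      constructor
      · intro h; simp [h]
      · rintro ⟨h1, h2, h3⟩
        ext x
        simp only [ZFSet.mem_pair]
        exact ⟨h3 x, by rintro (rfl | rfl) <;> assumption⟩) f g h

instance eq_pair [DTerm M f] [DTerm M g] [DTerm M h] : Dfn M (fun v => f v = pair (g v) (h v)) :=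
  of3 (R := fun p a b => p = pair a b) (by
    have i1 : ∀ i j k, Dfn M (fun v => v i = {v j, v k}) := fun i j k => eq_upair
    exact (inferInstance : Dfn M (fun v =>
      ∃ s ∈ v 0, ∃ t ∈ v 0, s = {v 1, v 1} ∧ t = {v 1, v 2} ∧ ∀ x ∈ v 0, x = s ∨ x = t)).congr
      fun _ _ v _ => by
      constructor
      · intro h
        refine ⟨{v 1}, by simp [h, ZFSet.pair], {v 1, v 2}, by simp [h, ZFSet.pair], ?_, rfl, ?_⟩
        · ext; simp
        · simp [h, ZFSet.pair]
      · rintro ⟨s, hs, t, ht, rfl, rfl, h⟩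
        have : ({v 1, v 1} : ZFSet.{0}) = {v 1} := by ext; simp
        rw [this] at hs h
        ext x
        simp only [ZFSet.pair, ZFSet.mem_pair]
        exact ⟨h x, by rintro (rfl | rfl) <;> assumption⟩) f g h

instance pair_mem [DTerm M f] [DTerm M g] [DTerm M h] : Dfn M (fun v => pair (g v) (h v) ∈ f v) :=
  of3 (R := fun p a b => pair a b ∈ p)
    ((inferInstance : Dfn M (fun v => ∃ p ∈ v 0, p = pair (v 1) (v 2))).congr
      fun _ _ _ _ => by simp) f g h

theorem _root_.SRPPaper.isFunc_iff {a b f : ZFSet.{0}} : ZFSet.IsFunc a b f ↔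
    (∀ p ∈ f, ∃ x ∈ a, ∃ y ∈ b, p = pair x y) ∧
      ∀ x ∈ a, ∃ y ∈ b, pair x y ∈ f ∧ ∀ y' ∈ b, pair x y' ∈ f → y' = y := by
  constructor
  · rintro ⟨h1, h2⟩
    refine ⟨fun p hp => by simpa [ZFSet.mem_prod] using h1 hp, fun x hx => ?_⟩
    obtain ⟨y, hy, hu⟩ := h2 x hx
    exact ⟨y, (ZFSet.pair_mem_prod.1 (h1 hy)).2, hy, fun y' _ h' => hu y' h'⟩
  · rintro ⟨h1, h2⟩
    have h1' : f ⊆ prod a b := fun p hp => by simpa [ZFSet.mem_prod] using h1 p hp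
    refine ⟨h1', fun x hx => ?_⟩
    obtain ⟨y, hy, hf, hu⟩ := h2 x hx
    exact ⟨y, hf, fun y' h' => hu y' (ZFSet.pair_mem_prod.1 (h1' h')).2 h'⟩

instance isFunc [DTerm M f] [DTerm M g] [DTerm M h] : Dfn M (fun v => IsFunc (f v) (g v) (h v)) :=
  of3 (R := fun a b f => IsFunc a b f)
    ((inferInstance : Dfn M (fun v => (∀ p ∈ v 2, ∃ x ∈ v 0, ∃ y ∈ v 1, p = pair x y) ∧
      ∀ x ∈ v 0, ∃ y ∈ v 1, pair x y ∈ v 2 ∧ ∀ y' ∈ v 1, pair x y' ∈ v 2 → y' = y)).congr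
      fun _ _ _ _ => isFunc_iff) f g h

instance isSurjF [DTerm M f] [DTerm M g] [DTerm M h] :
    Dfn M (fun v => IsSurjF (f v) (g v) (h v)) :=
  of3 (R := fun a b f => IsSurjF a b f)
    ((inferInstance : Dfn M (fun v => IsFunc (v 0) (v 1) (v 2) ∧
      ∀ y ∈ v 1, ∃ x ∈ v 0, pair x y ∈ v 2)).congr fun _ _ _ _ => Iff.rfl) f g h

theorem _root_.SRPPaper.isInjF_iff {a b f : ZFSet.{0}} : IsInjF a b f ↔ IsFunc a b f ∧
    ∀ x₁ ∈ a, ∀ x₂ ∈ a, ∀ y ∈ b, pair x₁ y ∈ f → pair x₂ y ∈ f → x₁ = x₂ :=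
  and_congr_right fun h => forall₄_congr fun _ _ _ _ => forall_congr' fun _ =>
    ⟨fun H _ => H, fun H h1 => H (ZFSet.pair_mem_prod.1 (h.1 h1)).2 h1⟩

instance isInjF [DTerm M f] [DTerm M g] [DTerm M h] :
    Dfn M (fun v => IsInjF (f v) (g v) (h v)) :=
  of3 (R := fun a b f => IsInjF a b f)
    ((inferInstance : Dfn M (fun v => IsFunc (v 0) (v 1) (v 2) ∧
      ∀ x₁ ∈ v 0, ∀ x₂ ∈ v 0, ∀ y ∈ v 1, pair x₁ y ∈ v 2 → pair x₂ y ∈ v 2 → x₁ = x₂)).congr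
      fun _ _ _ _ => isInjF_iff) f g h

end Dfn

/-! ### Classes satisfying strong separation and collection -/

/-- The one-element family consisting of the structure `(E, ∈, A)`. -/
def fam (E A : Set ZFSet.{0}) : Set Str := {⟨E, A, ∅⟩}

/-- `E` is a nonempty transitive class such that every set which is definable over `(E, ∈, A)`
belongs to `E`, and every subset of `E` is covered by a member of `E`. -/
class Mdl (E A : Set ZFSet.{0}) : Prop where
  trans : ∀ x ∈ E, ∀ y ∈ x, y ∈ E
  sep : ∀ P, Dfn (fam E A) P → ∀ v : ℕ → ZFSet.{0}, (∀ k, v k ∈ E) → ∀ y : ZFSet.{0},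
    (∀ w, w ∈ y ↔ w ∈ E ∧ P (scons w v)) → y ∈ E
  coll : ∀ y : ZFSet.{0}, (∀ w ∈ y, w ∈ E) → ∃ b ∈ E, y ⊆ b

section Mdl

variable {E A : Set ZFSet.{0}}

instance [hE : Mdl E A] : TransFam (fam E A) :=
  ⟨by rintro m rfl; exact hE.trans⟩

instance : UnivFam (fam E A) E :=
  ⟨by rintro m rfl; rfl⟩

theorem Dfn.congrE {P Q : (ℕ → ZFSet.{0}) → Prop} (hP : Dfn (fam E A) P)
    (h : ∀ v : ℕ → ZFSet.{0}, (∀ k, v k ∈ E) → (Q v ↔ P v)) : Dfn (fam E A) Q :=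
  hP.congr (by rintro m rfl; exact h)

instance Dfn.inPred {f : (ℕ → ZFSet.{0}) → ZFSet.{0}} [DTerm (fam E A) f] :
    Dfn (fam E A) (fun v => f v ∈ A) :=
  of1 (R := fun a => a ∈ A) ⟨1, .inA 0, by rintro m rfl v hv; rfl⟩ f

instance Dfn.false {M : Set Str} : Dfn M (fun _ => False) :=
  (inferInstance : Dfn M (fun v => v 0 = v 0 ∧ ¬ v 0 = v 0)).congr fun _ _ _ _ => by tauto

theorem DTerm.memE {f : (ℕ → ZFSet.{0}) → ZFSet.{0}} (hf : DTerm (fam E A) f) {v : ℕ → ZFSet.{0}}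
    (hv : ∀ k, v k ∈ E) : f v ∈ E :=
  hf.mem _ rfl v hv

theorem DTerm.mem1 {f : ZFSet.{0} → ZFSet.{0}} (hf : DTerm (fam E A) (fun v => f (v 0)))
    {x : ZFSet.{0}} (hx : x ∈ E) : f x ∈ E :=
  hf.memE (v := fun _ => x) fun _ => hx

theorem DTerm.mem2 {f : ZFSet.{0} → ZFSet.{0} → ZFSet.{0}}
    (hf : DTerm (fam E A) (fun v => f (v 0) (v 1))) {x y : ZFSet.{0}} (hx : x ∈ E) (hy : y ∈ E) :
    f x y ∈ E :=
  hf.memE (v := fun | 0 => x | _ => y) fun k => by cases k <;> assumption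

variable [hE : Mdl E A]

theorem DTerm.of_mem {f : (ℕ → ZFSet.{0}) → ZFSet.{0}}
    (hsub : ∀ v : ℕ → ZFSet.{0}, (∀ k, v k ∈ E) → ∀ w ∈ f v, w ∈ E)
    (h : Dfn (fam E A) (fun v => v 0 ∈ f (fun k => v (k + 1)))) : DTerm (fam E A) f := by
  have hm : ∀ v : ℕ → ZFSet.{0}, (∀ k, v k ∈ E) → f v ∈ E := fun v hv =>
    hE.sep _ h v hv (f v) fun w => ⟨fun hw => ⟨hsub v hv w hw, hw⟩, fun hw => hw.2⟩
  refine ⟨by rintro m rfl; exact hm, ?_⟩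
  have h' : Dfn (fam E A) (fun v => v 0 ∈ f (fun k => v (k + 2))) :=
    h.rename (fun | 0 => 0 | k + 1 => k + 2)
  refine Dfn.congrE (P := fun v => ∀ x ∈ E, x ∈ v 0 ↔ x ∈ f (fun k => v (k + 1))) ?_ ?_
  · infer_instance
  · intro v hv
    constructor
    · intro h x _; rw [h]
    · intro H
      ext x
      exact ⟨fun hx => (H x (hE.trans _ (hv 0) x hx)).1 hx,
        fun hx => (H x (hsub _ (fun k => hv _) x hx)).2 hx⟩

theorem DTerm.of_mem1 {f : ZFSet.{0} → ZFSet.{0}} (hsub : ∀ x ∈ E, ∀ w ∈ f x, w ∈ E)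
    (h : Dfn (fam E A) (fun v => v 0 ∈ f (v 1))) (g : (ℕ → ZFSet.{0}) → ZFSet.{0})
    [DTerm (fam E A) g] : DTerm (fam E A) (fun v => f (g v)) :=
  .of_mem (fun v hv w hw => hsub (g v) (DTerm.memE ‹_› hv) w hw) <| by
    have := DTerm.rename (M := fam E A) (f := g) ‹_› (· + 1)
    exact Dfn.of2 (R := fun a b => a ∈ f b) h (fun v => v 0) (fun v => g fun k => v (k + 1))

theorem DTerm.of_mem2 {f : ZFSet.{0} → ZFSet.{0} → ZFSet.{0}}
    (hsub : ∀ x ∈ E, ∀ y ∈ E, ∀ w ∈ f x y, w ∈ E)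
    (h : Dfn (fam E A) (fun v => v 0 ∈ f (v 1) (v 2))) (g k : (ℕ → ZFSet.{0}) → ZFSet.{0})
    [DTerm (fam E A) g] [DTerm (fam E A) k] : DTerm (fam E A) (fun v => f (g v) (k v)) :=
  .of_mem (fun v hv w hw => hsub (g v) (DTerm.memE ‹_› hv) (k v) (DTerm.memE ‹_› hv) w hw) <| by
    have := DTerm.rename (M := fam E A) (f := g) ‹_› (· + 1)
    have := DTerm.rename (M := fam E A) (f := k) ‹_› (· + 1)
    exact Dfn.of3 (R := fun a b c => a ∈ f b c) h (fun v => v 0) (fun v => g fun k => v (k + 1))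
      (fun v => k fun i => v (i + 1))

section Terms

variable {f g : (ℕ → ZFSet.{0}) → ZFSet.{0}}

instance DTerm.empty : DTerm (fam E A) (fun _ => ∅) :=
  .of_mem (by simp) ((inferInstance : Dfn (fam E A) (fun _ => False)).congr (by simp))

instance DTerm.insert [DTerm (fam E A) f] [DTerm (fam E A) g] :
    DTerm (fam E A) (fun v => insert (f v) (g v)) :=
  of_mem2 (f := fun a b => Insert.insert a b) (fun x hx y hy w hw => by
    rcases ZFSet.mem_insert_iff.1 hw with rfl | h
    exacts [hx, hE.trans _ hy _ h])
    ((inferInstance : Dfn (fam E A) (fun v => v 0 = v 1 ∨ v 0 ∈ v 2)).congr (by simp)) f g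

instance DTerm.singleton [DTerm (fam E A) f] : DTerm (fam E A) (fun v => {f v}) :=
  of_mem1 (f := fun a => {a}) (fun x hx w hw => by
    obtain rfl := ZFSet.mem_singleton.1 hw
    exact hx)
    ((inferInstance : Dfn (fam E A) (fun v => v 0 = v 1)).congr (by simp)) f

instance DTerm.pair [DTerm (fam E A) f] [DTerm (fam E A) g] :
    DTerm (fam E A) (fun v => pair (f v) (g v)) :=
  (inferInstance : DTerm (fam E A) (fun v => {{f v}, Insert.insert (f v) {g v}}))

instance DTerm.union [DTerm (fam E A) f] [DTerm (fam E A) g] :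
    DTerm (fam E A) (fun v => f v ∪ g v) :=
  of_mem2 (f := fun a b => a ∪ b) (fun x hx y hy w hw => by
    rcases ZFSet.mem_union.1 hw with h | h
    exacts [hE.trans _ hx _ h, hE.trans _ hy _ h])
    ((inferInstance : Dfn (fam E A) (fun v => v 0 ∈ v 1 ∨ v 0 ∈ v 2)).congr (by simp)) f g

end Terms

end Mdl

theorem mem_img {f : ZFSet.{0} → ZFSet.{0}} {x y : ZFSet.{0}} :
    y ∈ img f x ↔ ∃ z ∈ x, f z = y :=
  @ZFSet.mem_image f (Classical.allZFSetDefinable _) x y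

section Mdl

variable {E A : Set ZFSet.{0}} [hE : Mdl E A]

namespace Mdl

include hE in
theorem collect (s : ZFSet.{0}) {R : ZFSet.{0} → ZFSet.{0} → Prop}
    (h : ∀ z ∈ s, ∃ y ∈ E, R z y) : ∃ b ∈ E, ∀ z ∈ s, ∃ y ∈ b, R z y := by
  choose! g hgE hgR using h
  obtain ⟨b, hb, hsub⟩ := hE.coll (img g s) (by
    intro w hw
    obtain ⟨z, hz, rfl⟩ := mem_img.1 hw
    exact hgE z hz)
  exact ⟨b, hb, fun z hz => ⟨g z, hsub (mem_img.2 ⟨z, hz, rfl⟩), hgR z hz⟩⟩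

theorem sep1 {P : ZFSet.{0} → ZFSet.{0} → Prop} (hP : Dfn (fam E A) (fun v => P (v 0) (v 1)))
    {p y : ZFSet.{0}} (hp : p ∈ E) (hy : ∀ w, w ∈ y ↔ w ∈ E ∧ P w p) : y ∈ E :=
  hE.sep _ hP (fun _ => p) (fun _ => hp) y hy

theorem sep2 {P : ZFSet.{0} → ZFSet.{0} → ZFSet.{0} → Prop}
    (hP : Dfn (fam E A) (fun v => P (v 0) (v 1) (v 2)))
    {p q y : ZFSet.{0}} (hp : p ∈ E) (hq : q ∈ E) (hy : ∀ w, w ∈ y ↔ w ∈ E ∧ P w p q) : y ∈ E :=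
  hE.sep _ hP (fun | 0 => p | _ => q) (fun k => by cases k <;> assumption) y hy

theorem sep3 {P : ZFSet.{0} → ZFSet.{0} → ZFSet.{0} → ZFSet.{0} → Prop}
    (hP : Dfn (fam E A) (fun v => P (v 0) (v 1) (v 2) (v 3)))
    {p q r y : ZFSet.{0}} (hp : p ∈ E) (hq : q ∈ E) (hr : r ∈ E)
    (hy : ∀ w, w ∈ y ↔ w ∈ E ∧ P w p q r) : y ∈ E :=
  hE.sep _ hP (fun | 0 => p | 1 => q | _ => r)
    (fun k => by rcases k with _ | _ | k <;> assumption) y hy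

include hE in
theorem pair_mem {x y : ZFSet.{0}} (hx : x ∈ E) (hy : y ∈ E) : pair x y ∈ E :=
  DTerm.mem2 (E := E) (A := A) (f := pair) inferInstance hx hy

include hE in
theorem insert_mem {x y : ZFSet.{0}} (hx : x ∈ E) (hy : y ∈ E) : insert x y ∈ E :=
  DTerm.mem2 (E := E) (A := A) (f := fun a b => insert a b) inferInstance hx hy

include hE in
theorem fst_mem {x y : ZFSet.{0}} (h : pair x y ∈ E) : x ∈ E :=
  hE.trans {x} (hE.trans _ h _ (by simp [pair])) x (by simp)

include hE in
theorem snd_mem {x y : ZFSet.{0}} (h : pair x y ∈ E) : y ∈ E :=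
  hE.trans {x, y} (hE.trans _ h _ (by simp [pair])) y (by simp)

/-- `h` is an approximation to the function defined by recursion along `ρ` with step `Ψ`. -/
def RecApprox (E : Set ZFSet.{0}) (ρ : ZFSet.{0} → ZFSet.{0} → Prop)
    (Ψ : ZFSet.{0} → ZFSet.{0} → ZFSet.{0} → Prop) (h : ZFSet.{0}) : Prop :=
  ∀ p ∈ h, ∃ x ∈ E, ∃ y ∈ E, p = pair x y ∧ (∀ z ∈ E, ρ z x → ∃ y' ∈ E, pair z y' ∈ h) ∧
    ∃ h' ∈ E, (∀ w ∈ E, w ∈ h' ↔ w ∈ h ∧ ∃ z ∈ E, ρ z x ∧ ∃ y' ∈ E, w = pair z y') ∧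
      ∀ w ∈ E, w ∈ y ↔ Ψ w x h'

section Rec

variable {ρ : ZFSet.{0} → ZFSet.{0} → Prop} {Ψ : ZFSet.{0} → ZFSet.{0} → ZFSet.{0} → Prop}
  {f : ZFSet.{0} → ZFSet.{0}}

include hE in
theorem recApprox_val (hwf : WellFounded ρ) (hρE : ∀ x ∈ E, ∀ z, ρ z x → z ∈ E)
    (hf : ∀ x ∈ E, ∀ h ∈ E, (∀ w, w ∈ h ↔ ∃ z, ρ z x ∧ w = pair z (f z)) →
      (∀ w ∈ f x, w ∈ E) ∧ ∀ w ∈ E, w ∈ f x ↔ Ψ w x h)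
    {h : ZFSet.{0}} (hG : RecApprox E ρ Ψ h) :
    ∀ x y, pair x y ∈ h → y = f x := by
  intro x
  induction x using hwf.induction with
  | _ x ih =>
    intro y hxy
    obtain ⟨x', hx, y', hy, he, hcl, h', hh', hr, hv⟩ := hG _ hxy
    obtain ⟨rfl, rfl⟩ := pair_inj.1 he
    obtain ⟨h1, h2⟩ := hf x hx h' hh' (fun w => by
      constructor
      · intro hw
        obtain ⟨hwh, z, hz, hzx, y', hy', rfl⟩ := (hr w (hE.trans _ hh' _ hw)).1 hw
        exact ⟨z, hzx, by rw [ih z hzx y' hwh]⟩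
      · rintro ⟨z, hzx, rfl⟩
        obtain ⟨y', hy', hm⟩ := hcl z (hρE x hx z hzx) hzx
        have := ih z hzx y' hm
        subst this
        exact (hr _ (pair_mem (A := A) (hρE x hx z hzx) hy')).2
          ⟨hm, z, hρE x hx z hzx, hzx, _, hy', rfl⟩)
    ext w
    exact ⟨fun hw => (h2 w (hE.trans _ hy _ hw)).2 ((hv w (hE.trans _ hy _ hw)).1 hw),
      fun hw => (hv w (h1 w hw)).2 ((h2 w (h1 w hw)).1 hw)⟩

theorem exists_recApprox (hwf : WellFounded ρ)
    (dρ : Dfn (fam E A) (fun v => ρ (v 0) (v 1))) (hρE : ∀ x ∈ E, ∀ z, ρ z x → z ∈ E)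
    (hsm : ∀ x ∈ E, ∃ s : ZFSet.{0}, ∀ z, ρ z x → z ∈ s)
    (dΨ : Dfn (fam E A) (fun v => Ψ (v 0) (v 1) (v 2)))
    (hf : ∀ x ∈ E, ∀ h ∈ E, (∀ w, w ∈ h ↔ ∃ z, ρ z x ∧ w = pair z (f z)) →
      (∀ w ∈ f x, w ∈ E) ∧ ∀ w ∈ E, w ∈ f x ↔ Ψ w x h) (dG : Dfn (fam E A)
        (fun v => RecApprox E ρ Ψ (v 0))) :
    ∀ x ∈ E, ∃ h ∈ E, RecApprox E ρ Ψ h ∧ pair x (f x) ∈ h := by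
  intro x
  induction x using hwf.induction with
  | _ x ih =>
    intro hx
    obtain ⟨s, hs⟩ := hsm x hx
    obtain ⟨b, hb, hbz⟩ := collect (E := E) (A := A) (ZFSet.sep (fun z => ρ z x) s)
      (R := fun z h => RecApprox E ρ Ψ h ∧ pair z (f z) ∈ h) (fun z hz => by
        have hz := (ZFSet.mem_sep.1 hz).2
        obtain ⟨h, h1, h2⟩ := ih z hz (hρE x hx z hz)
        exact ⟨h, h1, h2⟩)
    replace hbz : ∀ z, ρ z x → ∃ h ∈ b, RecApprox E ρ Ψ h ∧ pair z (f z) ∈ h := fun z hz =>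
      hbz z (ZFSet.mem_sep.2 ⟨hs z hz, hz⟩)
    set U : ZFSet.{0} := ZFSet.sep (fun w => ∃ h ∈ b, RecApprox E ρ Ψ h ∧ w ∈ h) (⋃₀ b) with hU
    have memU : ∀ w, w ∈ U ↔ ∃ h ∈ b, RecApprox E ρ Ψ h ∧ w ∈ h := fun w => by
      rw [hU, ZFSet.mem_sep, ZFSet.mem_sUnion]
      exact ⟨fun h => h.2, fun h => ⟨let ⟨z, h1, _, h2⟩ := h; ⟨z, h1, h2⟩, h⟩⟩
    have hUE : U ∈ E := by
      refine sep1 (A := A) (P := fun w b => ∃ h ∈ b, RecApprox E ρ Ψ h ∧ w ∈ h) ?_ hb fun w => ?_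
      · have := dG.rename fun _ => 0
        infer_instance
      · rw [memU]
        exact ⟨fun h => ⟨let ⟨z, h1, _, h2⟩ := h; hE.trans _ (hE.trans _ hb _ h1) _ h2, h⟩,
          fun h => h.2⟩
    have valU : ∀ z y, pair z y ∈ U → y = f z := fun z y hzy => by
      obtain ⟨h, hh, hG, hm⟩ := (memU _).1 hzy
      exact recApprox_val (A := A) hwf hρE hf hG z y hm
    have memU' : ∀ z, ρ z x → pair z (f z) ∈ U := fun z hz => (memU _).2 (hbz z hz)
    have fE : ∀ z, ρ z x → f z ∈ E := fun z hz => snd_mem (A := A) (hE.trans _ hUE _ (memU' z hz))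
    set h' : ZFSet.{0} := ZFSet.sep (fun w => ∃ z ∈ E, ρ z x ∧ ∃ y' ∈ E, w = pair z y') U with hh'
    have memh' : ∀ w, w ∈ h' ↔ ∃ z, ρ z x ∧ w = pair z (f z) := fun w => by
      rw [hh', ZFSet.mem_sep]
      constructor
      · rintro ⟨hw, z, hz, hzx, y', hy', rfl⟩
        exact ⟨z, hzx, by rw [valU _ _ hw]⟩
      · rintro ⟨z, hzx, rfl⟩
        exact ⟨memU' z hzx, z, hρE x hx z hzx, hzx, f z, fE z hzx, rfl⟩
    have h'E : h' ∈ E := by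
      refine sep2 (A := A) (P := fun w U x => w ∈ U ∧ ∃ z ∈ E, ρ z x ∧ ∃ y' ∈ E, w = pair z y')
        ?_ hUE hx fun w => ?_
      · have := fun i => dρ.rename fun | 0 => 0 | _ => i
        infer_instance
      · rw [hh', ZFSet.mem_sep]
        exact ⟨fun h => ⟨hE.trans _ hUE _ h.1, h⟩, fun h => h.2⟩
    obtain ⟨h1, h2⟩ := hf x hx h' h'E memh'
    have fxE : f x ∈ E := sep2 (A := A) dΨ hx h'E fun w =>
      ⟨fun hw => ⟨h1 w hw, (h2 w (h1 w hw)).1 hw⟩, fun hw => (h2 w hw.1).2 hw.2⟩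
    have pE := pair_mem (A := A) hx fxE
    refine ⟨insert (pair x (f x)) U, insert_mem (A := A) pE hUE, ?_, by simp⟩
    intro p hp
    rcases ZFSet.mem_insert_iff.1 hp with rfl | hp
    · refine ⟨x, hx, f x, fxE, rfl, fun z hz hzx => ⟨f z, fE z hzx, by simp [memU' z hzx]⟩,
        h', h'E, fun w hw => ?_, h2⟩
      rw [memh']
      constructor
      · rintro ⟨z, hzx, rfl⟩
        exact ⟨by simp [memU' z hzx], z, hρE x hx z hzx, hzx, f z, fE z hzx, rfl⟩
      · rintro ⟨hw, z, hz, hzx, y', hy', rfl⟩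
        rcases ZFSet.mem_insert_iff.1 hw with he | hw
        · obtain ⟨rfl, rfl⟩ := pair_inj.1 he
          exact ⟨z, hzx, rfl⟩
        · exact ⟨z, hzx, by rw [valU _ _ hw]⟩
    · obtain ⟨h, hh, hG, hm⟩ := (memU _).1 hp
      obtain ⟨x', hx', y, hy, rfl, hcl, h'', hE'', hr, hv⟩ := hG _ hm
      have sub : ∀ w ∈ h, w ∈ insert (pair x (f x)) U := fun w hw => by
        simp [(memU w).2 ⟨h, hh, hG, hw⟩]
      refine ⟨x', hx', y, hy, rfl, fun z hz hzx => ?_, h'', hE'', fun w hw => ?_, hv⟩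
      · obtain ⟨y', hy', h3⟩ := hcl z hz hzx
        exact ⟨y', hy', sub _ h3⟩
      · rw [hr w hw]
        refine ⟨fun h3 => ⟨sub _ h3.1, h3.2⟩, ?_⟩
        rintro ⟨hw', z, hz, hzx, y', hy', rfl⟩
        refine ⟨?_, z, hz, hzx, y', hy', rfl⟩
        obtain ⟨y'', hy'', h3⟩ := hcl z hz hzx
        have e1 := recApprox_val (A := A) hwf hρE hf hG z y'' h3
        have e2 : y' = f z := by
          rcases ZFSet.mem_insert_iff.1 hw' with he | hw'
          · obtain ⟨rfl, rfl⟩ := pair_inj.1 he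
            rfl
          · exact valU _ _ hw'
        rwa [e2, ← e1]

theorem dterm_rec (hwf : WellFounded ρ)
    (dρ : Dfn (fam E A) (fun v => ρ (v 0) (v 1))) (hρE : ∀ x ∈ E, ∀ z, ρ z x → z ∈ E)
    (hsm : ∀ x ∈ E, ∃ s : ZFSet.{0}, ∀ z, ρ z x → z ∈ s)
    (dΨ : Dfn (fam E A) (fun v => Ψ (v 0) (v 1) (v 2)))
    (hf : ∀ x ∈ E, ∀ h ∈ E, (∀ w, w ∈ h ↔ ∃ z, ρ z x ∧ w = pair z (f z)) →
      (∀ w ∈ f x, w ∈ E) ∧ ∀ w ∈ E, w ∈ f x ↔ Ψ w x h)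
    (g : (ℕ → ZFSet.{0}) → ZFSet.{0}) [DTerm (fam E A) g] :
    DTerm (fam E A) (fun v => f (g v)) := by
  have dG : Dfn (fam E A) (fun v => RecApprox E ρ Ψ (v 0)) := by
    have := fun i j => dρ.rename fun | 0 => i | _ => j
    have := fun i j k => dΨ.rename fun | 0 => i | 1 => j | _ => k
    unfold RecApprox
    infer_instance
  have ex := exists_recApprox hwf dρ hρE hsm dΨ hf dG
  refine DTerm.of_mem1 (fun x hx w hw => ?_) ?_ g
  · obtain ⟨h, hh, -, hm⟩ := ex x hx
    exact hE.trans _ (snd_mem (A := A) (hE.trans _ hh _ hm)) _ hw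
  · refine Dfn.congrE (P := fun v => ∃ h ∈ E, RecApprox E ρ Ψ h ∧ ∃ y ∈ E, pair (v 1) y ∈ h ∧
      v 0 ∈ y) ?_ fun v hv => ?_
    · have := dG.rename fun _ => 0
      infer_instance
    · constructor
      · intro hw
        obtain ⟨h, hh, hG, hm⟩ := ex (v 1) (hv 1)
        exact ⟨h, hh, hG, _, snd_mem (A := A) (hE.trans _ hh _ hm), hm, hw⟩
      · rintro ⟨h, hh, hG, y, hy, hm, hw⟩
        rwa [← recApprox_val (A := A) hwf hρE hf hG _ _ hm]

end Rec

end Mdl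

end Mdl

/-! ### Ordinals and the constructible hierarchy -/

theorem isOrd_iff {x : ZFSet.{0}} : IsOrd x ↔ x.IsOrdinal :=
  isOrdinal_iff_forall_mem_isTransitive.symm

theorem isOrd_toZFSet (o : Ordinal.{0}) : IsOrd o.toZFSet :=
  isOrd_iff.2 (isOrdinal_toZFSet o)

theorem IsOrd.toZFSet_rank {x : ZFSet.{0}} (hx : IsOrd x) : x.rank.toZFSet = x :=
  (isOrd_iff.1 hx).toZFSet_rank_eq

theorem IsOrd.mem {x y : ZFSet.{0}} (hx : IsOrd x) (hy : y ∈ x) : IsOrd y :=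
  isOrd_iff.2 ((isOrd_iff.1 hx).mem hy)

theorem IsOrd.succ {x : ZFSet.{0}} (hx : IsOrd x) : IsOrd (insert x x) :=
  isOrd_iff.2 (isOrdinal_succ (isOrd_iff.1 hx))

theorem IsOrd.trichotomy {x y : ZFSet.{0}} (hx : IsOrd x) (hy : IsOrd y) : x ∈ y ∨ x = y ∨ y ∈ x :=
  (isOrd_iff.1 hx).mem_trichotomous (isOrd_iff.1 hy)

theorem IsOrd.trans {x y z : ZFSet.{0}} (hx : IsOrd x) (h1 : z ∈ y) (h2 : y ∈ x) : z ∈ x :=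
  hx.1 y h2 h1

theorem IsOrd.of_subset {x : ZFSet.{0}} (h1 : x.IsTransitive) (h2 : ∀ y ∈ x, IsOrd y) : IsOrd x :=
  ⟨h1, fun y hy => (h2 y hy).1⟩

theorem mem_DefSetA {A : Set ZFSet.{0}} {X y : ZFSet.{0}} :
    y ∈ DefSetA A X ↔ ∃ (n : ℕ) (φ : Fml (n + 1)) (v : Fin n → ZFSet.{0}), (∀ i, v i ∈ X) ∧
      y = ZFSet.sep (fun z => SatAB X.toSet A ∅ φ (Fin.cons z v)) X := by
  rw [DefSetA, ZFSet.mem_sep, and_iff_right_iff_imp]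
  rintro ⟨n, φ, v, -, rfl⟩
  exact ZFSet.mem_powerset.2 fun z hz => (ZFSet.mem_sep.1 hz).1

theorem mem_LstageA {A : Set ZFSet.{0}} {α x : ZFSet.{0}} :
    x ∈ LstageA A α ↔ ∃ β ∈ α, x ∈ DefSetA A (LstageA A β) := by
  rw [LstageA, WellFounded.fix_eq, ZFSet.mem_sUnion]
  constructor
  · rintro ⟨z, hz, hx⟩
    obtain ⟨β, hβ, rfl⟩ := mem_img.1 hz
    rw [dif_pos hβ] at hx
    exact ⟨β, hβ, hx⟩
  · rintro ⟨β, hβ, hx⟩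
    refine ⟨_, mem_img.2 ⟨β, hβ, rfl⟩, ?_⟩
    rwa [dif_pos hβ]

/-- The stages of `L[A]`, indexed by Lean ordinals. -/
def LO (A : Set ZFSet.{0}) (o : Ordinal.{0}) : ZFSet.{0} := LstageA A o.toZFSet

/-- The class `L[A]`, for a class `A`. -/
def LOf (A : Set ZFSet.{0}) : Set ZFSet.{0} := {x | ∃ α, IsOrd α ∧ x ∈ LstageA A α}

section LO

variable {A : Set ZFSet.{0}}

theorem mem_LO {o : Ordinal.{0}} {x : ZFSet.{0}} : x ∈ LO A o ↔ ∃ p < o, x ∈ DefSetA A (LO A p) := by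
  rw [LO, mem_LstageA]
  constructor
  · rintro ⟨β, hβ, hx⟩
    obtain ⟨p, hp, rfl⟩ := Ordinal.mem_toZFSet_iff.1 hβ
    exact ⟨p, hp, hx⟩
  · rintro ⟨p, hp, hx⟩
    exact ⟨_, Ordinal.mem_toZFSet_iff.2 ⟨p, hp, rfl⟩, hx⟩

theorem mem_LOf {x : ZFSet.{0}} : x ∈ LOf A ↔ ∃ o, x ∈ LO A o := by
  constructor
  · rintro ⟨α, hα, hx⟩
    exact ⟨α.rank, by rwa [LO, hα.toZFSet_rank]⟩
  · rintro ⟨o, ho⟩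
    exact ⟨_, isOrd_toZFSet o, ho⟩

theorem LO_mono {o p : Ordinal.{0}} (h : o ≤ p) : LO A o ⊆ LO A p := fun x hx => by
  obtain ⟨q, hq, hx⟩ := mem_LO.1 hx
  exact mem_LO.2 ⟨q, hq.trans_le h, hx⟩

theorem LO_transitive (o : Ordinal.{0}) : (LO A o).IsTransitive := fun x hx z hz => by
  obtain ⟨q, hq, hx⟩ := mem_LO.1 hx
  obtain ⟨n, φ, v, hv, rfl⟩ := mem_DefSetA.1 hx
  exact LO_mono hq.le (ZFSet.mem_sep.1 hz).1

theorem LO_mem_LO {o p : Ordinal.{0}} (h : o < p) : LO A o ∈ LO A p := by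
  refine mem_LO.2 ⟨o, h, mem_DefSetA.2 ⟨0, .eq 0 0, Fin.elim0, fun i => i.elim0, ?_⟩⟩
  ext z
  simp [SatAB]

theorem exists_le_of_mem (s : ZFSet.{0}) (g : ZFSet.{0} → Ordinal.{0}) :
    ∃ o, ∀ w ∈ s, g w ≤ o := by
  refine ⟨(img (fun w => (g w).toZFSet) s).rank, fun w hw => ?_⟩
  have := ZFSet.rank_lt_of_mem (mem_img.2 ⟨w, hw, rfl⟩ :
    (g w).toZFSet ∈ img (fun w => (g w).toZFSet) s)
  rw [Ordinal.rank_toZFSet] at this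
  exact this.le

theorem exists_subset_LO (y : ZFSet.{0}) (hy : ∀ w ∈ y, w ∈ LOf A) : ∃ o, y ⊆ LO A o := by
  have : ∀ w ∈ y, ∃ o, w ∈ LO A o := fun w hw => mem_LOf.1 (hy w hw)
  choose! g hg using this
  obtain ⟨o, ho⟩ := exists_le_of_mem y g
  exact ⟨o, fun w hw => LO_mono (ho w hw) (hg w hw)⟩

theorem exists_witness_bound (o : Ordinal.{0}) : ∃ p, o ≤ p ∧ ∀ (n : ℕ) (φ : Fml (n + 1))
    (v : Fin n → ZFSet.{0}), (∀ i, v i ∈ LO A o) →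
    (∃ x ∈ LOf A, SatAB (LOf A) A ∅ φ (Fin.cons x v)) →
    ∃ x ∈ LO A p, SatAB (LOf A) A ∅ φ (Fin.cons x v) := by
  let I := Σ n : ℕ, Fml (n + 1) × (Fin n → LO A o)
  have hex : ∀ i : I, ∃ p, (∃ x ∈ LOf A, SatAB (LOf A) A ∅ i.2.1
      (Fin.cons x fun k => (i.2.2 k : ZFSet.{0}))) → ∃ x ∈ LO A p, SatAB (LOf A) A ∅ i.2.1
      (Fin.cons x fun k => (i.2.2 k : ZFSet.{0})) := fun i => by
    by_cases h : ∃ x ∈ LOf A, SatAB (LOf A) A ∅ i.2.1 (Fin.cons x fun k => (i.2.2 k : ZFSet.{0}))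
    · obtain ⟨x, hx, hs⟩ := h
      obtain ⟨p, hp⟩ := mem_LOf.1 hx
      exact ⟨p, fun _ => ⟨x, hp, hs⟩⟩
    · exact ⟨0, fun h' => absurd h' h⟩
  choose g hg using hex
  refine ⟨max o (⨆ i, g i), le_max_left _ _, fun n φ v hv h => ?_⟩
  obtain ⟨x, hx, hs⟩ := hg ⟨n, φ, fun i => ⟨v i, hv i⟩⟩ h
  exact ⟨x, LO_mono ((Ordinal.le_iSup g _).trans (le_max_right _ _)) hx, hs⟩

/-- The reflection principle for `L[A]`, for all formulas simultaneously. -/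
theorem exists_reflecting (o : Ordinal.{0}) : ∃ p, o ≤ p ∧ ∀ (n : ℕ) (φ : Fml n)
    (v : Fin n → ZFSet.{0}), (∀ i, v i ∈ LO A p) →
    (SatAB (LO A p).toSet A ∅ φ v ↔ SatAB (LOf A) A ∅ φ v) := by
  choose g hg1 hg2 using exists_witness_bound (A := A)
  let s : ℕ → Ordinal.{0} := fun k => g^[k] o
  have hs : Monotone s := monotone_nat_of_le_succ fun k => by
    simp only [s, Function.iterate_succ_apply']
    exact hg1 _
  have hmem : ∀ x ∈ LO A (⨆ k, s k), ∃ k, x ∈ LO A (s k) := fun x hx => by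
    obtain ⟨q, hq, hx⟩ := mem_LO.1 hx
    obtain ⟨k, hk⟩ := (Ordinal.lt_iSup_iff).1 hq
    exact ⟨k, mem_LO.2 ⟨q, hk, hx⟩⟩
  have hle : ∀ k, s k ≤ ⨆ k, s k := fun k => Ordinal.le_iSup s k
  refine ⟨⨆ k, s k, hle 0, fun n φ => ?_⟩
  induction φ with
  | mem i j => intros; rfl
  | eq i j => intros; rfl
  | inA i => intros; rfl
  | inB i => intros; rfl
  | not φ ih => intro v hv; exact not_congr (ih v hv)
  | and φ ψ ih1 ih2 => intro v hv; exact and_congr (ih1 v hv) (ih2 v hv)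
  | @ex n φ ih =>
    intro v hv
    have hcons : ∀ x ∈ LO A (⨆ k, s k), ∀ i, (Fin.cons x v : Fin (n + 1) → ZFSet.{0}) i ∈
        LO A (⨆ k, s k) := fun x hx i => by
      refine Fin.cases ?_ (fun i => ?_) i
      · simpa using hx
      · simpa using hv i
    constructor
    · rintro ⟨x, hx, h⟩
      exact ⟨x, mem_LOf.2 ⟨_, hx⟩, (ih _ (hcons x hx)).1 h⟩
    · intro h
      choose k hk using fun i => hmem (v i) (hv i)
      obtain ⟨x, hx, h'⟩ := hg2 (s (Finset.univ.sup k)) n φ v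
        (fun i => LO_mono (hs (Finset.le_sup (Finset.mem_univ i))) (hk i)) h
      have hx' : x ∈ LO A (⨆ k, s k) := LO_mono (by
        have := hle (Finset.univ.sup k + 1)
        simp only [s, Function.iterate_succ_apply'] at this
        exact this) hx
      exact ⟨x, hx', (ih _ (hcons x hx')).2 h'⟩

instance LOf.mdl : Mdl (LOf A) A where
  trans x hx y hy := by
    obtain ⟨o, ho⟩ := mem_LOf.1 hx
    exact mem_LOf.2 ⟨o, LO_transitive o x ho hy⟩
  coll y hy := by
    obtain ⟨o, ho⟩ := exists_subset_LO y hy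
    exact ⟨LO A o, mem_LOf.2 ⟨_, LO_mem_LO (Order.lt_succ o)⟩, ho⟩
  sep P hP v hv y hy := by
    obtain ⟨n, hn⟩ := hP.lift
    obtain ⟨φ, hφ⟩ := hn (n + 1) (Nat.le_succ _)
    obtain ⟨o, ho⟩ := exists_subset_LO y fun w hw => ((hy w).1 hw).1
    choose g hg using fun k => mem_LOf.1 (hv k)
    obtain ⟨p, hp, hr⟩ := exists_reflecting (A := A) (max o (⨆ k, g k))
    have hvp : ∀ k, v k ∈ LO A p := fun k =>
      LO_mono ((Ordinal.le_iSup g k).trans ((le_max_right _ _).trans hp)) (hg k)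
    refine mem_LOf.2 ⟨Order.succ p, mem_LO.2 ⟨p, Order.lt_succ p, mem_DefSetA.2
      ⟨n, φ, fun i => v i, fun i => hvp i, ?_⟩⟩⟩
    have key : ∀ w ∈ LO A p, (SatAB (LO A p).toSet A ∅ φ (Fin.cons w fun i : Fin n => v i) ↔
        P (scons w v)) := fun w hw => by
      have hw' : w ∈ LOf A := mem_LOf.2 ⟨p, hw⟩
      rw [hr _ φ _ (fun i => by
        refine Fin.cases ?_ (fun i => ?_) i
        · simpa using hw
        · simpa using hvp i), hφ _ rfl (scons w v) (fun k => by cases k <;> simp [scons, hw', hv])]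
      refine iff_of_eq (congrArg _ ?_)
      funext i
      refine Fin.cases ?_ (fun i => ?_) i <;> simp [scons]
    ext w
    rw [ZFSet.mem_sep]
    constructor
    · intro hw
      have hwp := LO_mono ((le_max_left _ _).trans hp) (ho hw)
      exact ⟨hwp, (key w hwp).2 ((hy w).1 hw).2⟩
    · rintro ⟨hw, hs⟩
      exact (hy w).2 ⟨mem_LOf.2 ⟨p, hw⟩, (key w hw).1 hs⟩

end LO

/-! ### Natural numbers and Gödel pairing -/

theorem natZ_eq (n : ℕ) : natZ n = (n : Ordinal.{0}).toZFSet := by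
  induction n with
  | zero => simp [natZ]
  | succ n ih => rw [natZ, ih, Nat.cast_succ, Ordinal.toZFSet_add_one]

theorem natZ_inj {m n : ℕ} (h : natZ m = natZ n) : m = n := by
  rw [natZ_eq, natZ_eq] at h
  exact_mod_cast Ordinal.toZFSet_injective h

theorem isOrd_natZ (n : ℕ) : IsOrd (natZ n) := by
  rw [natZ_eq]
  exact isOrd_toZFSet _

theorem mem_natZ {n : ℕ} {x : ZFSet.{0}} : x ∈ natZ n ↔ ∃ m < n, natZ m = x := by
  rw [natZ_eq, Ordinal.mem_toZFSet_iff]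
  constructor
  · rintro ⟨a, ha, rfl⟩
    obtain ⟨m, rfl⟩ := Ordinal.lt_omega0.1 (ha.trans (Ordinal.natCast_lt_omega0 n))
    exact ⟨m, by exact_mod_cast ha, natZ_eq m⟩
  · rintro ⟨m, hm, rfl⟩
    exact ⟨m, by exact_mod_cast hm, (natZ_eq m).symm⟩

theorem mem_omega {x : ZFSet.{0}} : x ∈ ZFSet.omega ↔ ∃ n : ℕ, natZ n = x := by
  have key : ∀ n : ℕ, ZFSet.mk (PSet.ofNat n) = natZ n := fun n => by
    induction n with
    | zero => rfl
    | succ n ih => rw [natZ, ← ih]; rfl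
  constructor
  · refine Quotient.inductionOn x fun x => ?_
    rintro ⟨⟨n⟩, hn⟩
    refine ⟨n, ?_⟩
    rw [← key]
    exact (ZFSet.sound hn).symm
  · rintro ⟨n, rfl⟩
    rw [← key]
    exact ⟨⟨n⟩, PSet.Equiv.refl _⟩

theorem natZ_mem_omega (n : ℕ) : natZ n ∈ ZFSet.omega := mem_omega.2 ⟨n, rfl⟩

theorem isOrd_omega : IsOrd ZFSet.omega := by
  refine .of_subset (fun x hx y hy => ?_) fun x hx => ?_
  · obtain ⟨n, rfl⟩ := mem_omega.1 hx
    obtain ⟨m, -, rfl⟩ := mem_natZ.1 hy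
    exact natZ_mem_omega m
  · obtain ⟨n, rfl⟩ := mem_omega.1 hx
    exact isOrd_natZ n

theorem mem_omega_iff_isOrd {x : ZFSet.{0}} : x ∈ ZFSet.omega ↔ IsOrd x ∧
    (x = ∅ ∨ ∃ m ∈ x, x = insert m m) ∧ ∀ k ∈ x, k = ∅ ∨ ∃ m ∈ k, k = insert m m := by
  have h0 : ∀ n, natZ n = ∅ ∨ ∃ m ∈ natZ n, natZ n = insert m m := fun n => by
    cases n with
    | zero => exact .inl rfl
    | succ n => exact .inr ⟨natZ n, by simp [natZ], rfl⟩
  constructor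
  · intro hx
    obtain ⟨n, rfl⟩ := mem_omega.1 hx
    refine ⟨isOrd_natZ n, h0 n, fun k hk => ?_⟩
    obtain ⟨m, -, rfl⟩ := mem_natZ.1 hk
    exact h0 m
  · induction x using ZFSet.inductionOn with
    | _ x ih =>
      rintro ⟨ho, rfl | ⟨m, hm, he⟩, hk⟩
      · exact ZFSet.omega_zero
      · rw [he]
        exact ZFSet.omega_succ (ih m hm ⟨ho.mem hm, hk m hm, fun k hkm => hk k (ho.trans hkm hm)⟩)

theorem union_toZFSet (o p : Ordinal.{0}) : o.toZFSet ∪ p.toZFSet = (max o p).toZFSet := by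
  rcases le_total o p with h | h
  · rw [max_eq_right h]
    ext x
    simp only [ZFSet.mem_union]
    exact ⟨fun hx => hx.elim (fun h' => Ordinal.toZFSet_monotone h h') id, .inr⟩
  · rw [max_eq_left h]
    ext x
    simp only [ZFSet.mem_union]
    exact ⟨fun hx => hx.elim id (fun h' => Ordinal.toZFSet_monotone h h'), .inl⟩

/-- The max-lexicographic order on pairs of ordinals. -/
def MaxLex (z x : ZFSet.{0}) : Prop :=
  ∃ a' b' a b, IsOrd a' ∧ IsOrd b' ∧ IsOrd a ∧ IsOrd b ∧ z = pair a' b' ∧ x = pair a b ∧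
    (a' ∪ b' ∈ a ∪ b ∨ a' ∪ b' = a ∪ b ∧ (a' ∈ a ∨ a' = a ∧ b' ∈ b))

/-- The max-lexicographic order on pairs of Lean ordinals. -/
def OrdLex (p q : Ordinal.{0} × Ordinal.{0}) : Prop :=
  max p.1 p.2 < max q.1 q.2 ∨ max p.1 p.2 = max q.1 q.2 ∧ (p.1 < q.1 ∨ p.1 = q.1 ∧ p.2 < q.2)

theorem ordLex_wf : WellFounded OrdLex := by
  refine Subrelation.wf (r := InvImage (Prod.Lex (· < ·) (Prod.Lex (· < ·) (· < ·)))
    fun p : Ordinal.{0} × Ordinal.{0} => (max p.1 p.2, p.1, p.2)) ?_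
    (InvImage.wf _ (WellFounded.prod_lex Ordinal.lt_wf
      (WellFounded.prod_lex Ordinal.lt_wf Ordinal.lt_wf)))
  rintro ⟨a', b'⟩ ⟨a, b⟩ h
  simp only [OrdLex] at h
  simp only [InvImage, Prod.lex_def]
  exact h

theorem ordLex_trans {p q r : Ordinal.{0} × Ordinal.{0}} (h1 : OrdLex p q) (h2 : OrdLex q r) :
    OrdLex p r := by
  unfold OrdLex at *
  grind

theorem ordLex_tri (p q : Ordinal.{0} × Ordinal.{0}) : OrdLex p q ∨ p = q ∨ OrdLex q p := by
  obtain ⟨a, b⟩ := p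
  obtain ⟨c, d⟩ := q
  simp only [OrdLex, Prod.mk.injEq]
  grind

/-- The pair of von Neumann ordinals coded by a pair of Lean ordinals. -/
def opair (p : Ordinal.{0} × Ordinal.{0}) : ZFSet.{0} := pair p.1.toZFSet p.2.toZFSet

theorem opair_inj {p q} (h : opair p = opair q) : p = q := by
  obtain ⟨h1, h2⟩ := pair_inj.1 h
  exact Prod.ext (Ordinal.toZFSet_injective h1) (Ordinal.toZFSet_injective h2)

theorem maxLex_iff {z x : ZFSet.{0}} :
    MaxLex z x ↔ ∃ p q, z = opair p ∧ x = opair q ∧ OrdLex p q := by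
  constructor
  · rintro ⟨a', b', a, b, ha', hb', ha, hb, rfl, rfl, h⟩
    refine ⟨(a'.rank, b'.rank), (a.rank, b.rank), ?_, ?_, ?_⟩
    · simp [opair, ha'.toZFSet_rank, hb'.toZFSet_rank]
    · simp [opair, ha.toZFSet_rank, hb.toZFSet_rank]
    · rw [← ha'.toZFSet_rank, ← hb'.toZFSet_rank, ← ha.toZFSet_rank, ← hb.toZFSet_rank] at h
      simpa [union_toZFSet, Ordinal.toZFSet_mem_toZFSet_iff, Ordinal.toZFSet_injective.eq_iff,
        OrdLex] using h
  · rintro ⟨p, q, rfl, rfl, h⟩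
    refine ⟨_, _, _, _, isOrd_toZFSet _, isOrd_toZFSet _, isOrd_toZFSet _, isOrd_toZFSet _,
      rfl, rfl, ?_⟩
    simpa [union_toZFSet, Ordinal.toZFSet_mem_toZFSet_iff, Ordinal.toZFSet_injective.eq_iff,
        OrdLex] using h

theorem maxLex_opair {z : ZFSet.{0}} {q} : MaxLex z (opair q) ↔ ∃ p, z = opair p ∧ OrdLex p q := by
  rw [maxLex_iff]
  constructor
  · rintro ⟨p, q', rfl, h, h'⟩
    obtain rfl := opair_inj h
    exact ⟨p, rfl, h'⟩
  · rintro ⟨p, rfl, h⟩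
    exact ⟨p, q, rfl, rfl, h⟩

theorem maxLex_wf : WellFounded MaxLex := by
  have : ∀ p, Acc MaxLex (opair p) := fun p => by
    induction p using ordLex_wf.induction with
    | _ p ih =>
      refine ⟨_, fun z hz => ?_⟩
      obtain ⟨q, rfl, h⟩ := maxLex_opair.1 hz
      exact ih q h
  refine ⟨fun x => ⟨_, fun z hz => ?_⟩⟩
  obtain ⟨p, q, rfl, -⟩ := maxLex_iff.1 hz
  exact this p

theorem maxLex_small (x : ZFSet.{0}) : ∃ s : ZFSet.{0}, ∀ z, MaxLex z x → z ∈ s := by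
  by_cases h : ∃ q, x = opair q
  · obtain ⟨q, rfl⟩ := h
    refine ⟨prod (Order.succ (max q.1 q.2)).toZFSet (Order.succ (max q.1 q.2)).toZFSet,
      fun z hz => ?_⟩
    obtain ⟨p, rfl, h⟩ := maxLex_opair.1 hz
    have : max p.1 p.2 ≤ max q.1 q.2 := by
      unfold OrdLex at h
      grind
    refine ZFSet.pair_mem_prod.2 ⟨?_, ?_⟩ <;>
      rw [Ordinal.toZFSet_mem_toZFSet_iff, Order.lt_succ_iff]
    exacts [(le_max_left _ _).trans this, (le_max_right _ _).trans this]
  · refine ⟨∅, fun z hz => ?_⟩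
    obtain ⟨p, q, -, rfl, -⟩ := maxLex_iff.1 hz
    exact absurd ⟨q, rfl⟩ h

/-- The Gödel pairing function, as a function on pairs. -/
def gpair : ZFSet.{0} → ZFSet.{0} :=
  maxLex_wf.fix fun x ih => img (fun z => if h : MaxLex z x then ih z h else ∅)
    (ZFSet.sep (fun z => MaxLex z x) (maxLex_small x).choose)

theorem mem_gpair {x w : ZFSet.{0}} : w ∈ gpair x ↔ ∃ z, MaxLex z x ∧ w = gpair z := by
  rw [gpair, WellFounded.fix_eq, mem_img]
  constructor
  · rintro ⟨z, hz, rfl⟩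
    have hz := (ZFSet.mem_sep.1 hz).2
    exact ⟨z, hz, dif_pos hz⟩
  · rintro ⟨z, hz, rfl⟩
    exact ⟨z, ZFSet.mem_sep.2 ⟨(maxLex_small x).choose_spec z hz, hz⟩, dif_pos hz⟩

/-- The Gödel code of a pair of ordinals. -/
def gp (a b : ZFSet.{0}) : ZFSet.{0} := gpair (pair a b)

theorem isOrd_gpair (x : ZFSet.{0}) : IsOrd (gpair x) := by
  induction x using maxLex_wf.induction with
  | _ x ih =>
    refine .of_subset (fun y hy w hw => ?_) fun y hy => ?_
    · obtain ⟨z, hz, rfl⟩ := mem_gpair.1 hy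
      obtain ⟨z', hz', rfl⟩ := mem_gpair.1 hw
      obtain ⟨p, q, rfl, rfl, h⟩ := maxLex_iff.1 hz
      obtain ⟨p', rfl, h'⟩ := maxLex_opair.1 hz'
      exact mem_gpair.2 ⟨_, maxLex_opair.2 ⟨p', rfl, ordLex_trans h' h⟩, rfl⟩
    · obtain ⟨z, hz, rfl⟩ := mem_gpair.1 hy
      exact ih z hz

theorem isOrd_gp (a b : ZFSet.{0}) : IsOrd (gp a b) := isOrd_gpair _

theorem gpair_opair_inj {p q} (h : gpair (opair p) = gpair (opair q)) : p = q := by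
  rcases ordLex_tri p q with h' | h' | h'
  · have : gpair (opair p) ∈ gpair (opair q) := mem_gpair.2 ⟨_, maxLex_opair.2 ⟨p, rfl, h'⟩, rfl⟩
    rw [h] at this
    exact absurd this (ZFSet.mem_irrefl _)
  · exact h'
  · have : gpair (opair q) ∈ gpair (opair p) := mem_gpair.2 ⟨_, maxLex_opair.2 ⟨q, rfl, h'⟩, rfl⟩
    rw [h] at this
    exact absurd this (ZFSet.mem_irrefl _)

theorem opair_rank {a b : ZFSet.{0}} (ha : IsOrd a) (hb : IsOrd b) :
    opair (a.rank, b.rank) = pair a b := by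
  simp [opair, ha.toZFSet_rank, hb.toZFSet_rank]

theorem gp_inj {a b c d : ZFSet.{0}} (ha : IsOrd a) (hb : IsOrd b) (hc : IsOrd c) (hd : IsOrd d)
    (h : gp a b = gp c d) : a = c ∧ b = d := by
  rw [gp, gp, ← opair_rank ha hb, ← opair_rank hc hd] at h
  have := congrArg opair (gpair_opair_inj h)
  rwa [opair_rank ha hb, opair_rank hc hd, pair_inj] at this

theorem toZFSet_le_gpair (p : Ordinal.{0} × Ordinal.{0}) :
    max p.1 p.2 ≤ (gpair (opair p)).rank := by
  have step : ∀ q, OrdLex q p → (gpair (opair q)).rank < (gpair (opair p)).rank := fun q hq =>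
    ZFSet.rank_lt_of_mem (mem_gpair.2 ⟨_, maxLex_opair.2 ⟨q, rfl, hq⟩, rfl⟩)
  induction p using ordLex_wf.induction with
  | _ p ih =>
    refine le_of_forall_lt fun c hc => ?_
    have h : OrdLex (c, c) p := .inl (by simpa using hc)
    refine lt_of_le_of_lt ?_ (step _ h)
    simpa using ih _ h fun q hq => ZFSet.rank_lt_of_mem
      (mem_gpair.2 ⟨_, maxLex_opair.2 ⟨q, rfl, hq⟩, rfl⟩)

theorem subset_of_rank_le {a b : ZFSet.{0}} (ha : IsOrd a) (hb : IsOrd b) (h : a.rank ≤ b.rank) :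
    a ⊆ b :=
  (IsOrdinal.rank_le_iff_subset (isOrd_iff.1 ha) (isOrd_iff.1 hb)).1 h

theorem left_subset_gp {a b : ZFSet.{0}} (ha : IsOrd a) (hb : IsOrd b) : a ⊆ gp a b := by
  refine subset_of_rank_le ha (isOrd_gp a b) ?_
  have := toZFSet_le_gpair (a.rank, b.rank)
  rw [opair_rank ha hb] at this
  exact (le_max_left _ _).trans this

theorem right_subset_gp {a b : ZFSet.{0}} (ha : IsOrd a) (hb : IsOrd b) : b ⊆ gp a b := by
  refine subset_of_rank_le hb (isOrd_gp a b) ?_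
  have := toZFSet_le_gpair (a.rank, b.rank)
  rw [opair_rank ha hb] at this
  exact (le_max_right _ _).trans this

theorem gp_natZ_mem_omega (m n : ℕ) : gp (natZ m) (natZ n) ∈ ZFSet.omega := by
  set x := gp (natZ m) (natZ n) with hx
  by_contra hno
  have hsub : ZFSet.omega ⊆ x := by
    rcases isOrd_omega.trichotomy (isOrd_gp (natZ m) (natZ n)) with h | h | h
    · exact (isOrd_gp _ _).1 _ h
    · rw [h]
    · exact absurd h hno
  have hfin : {w | w ∈ x}.Finite := by
    have hp : x = gpair (opair (m, n)) := by rw [hx, gp, opair, natZ_eq, natZ_eq]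
    refine ((((Set.finite_Iio (max m n + 1)).prod (Set.finite_Iio (max m n + 1)))).image
      fun p : ℕ × ℕ => gp (natZ p.1) (natZ p.2)).subset ?_
    intro w hw
    rw [Set.mem_ofPred_eq, hp, mem_gpair] at hw
    obtain ⟨z, hz, rfl⟩ := hw
    obtain ⟨⟨a, b⟩, rfl, h⟩ := maxLex_opair.1 hz
    have hle : max a b ≤ max (m : Ordinal.{0}) n := by
      simp only [OrdLex] at h
      exact h.elim (fun h => h.le) fun h => h.1.le
    have hlt : ((max m n : ℕ) : Ordinal.{0}) < Ordinal.omega0 := Ordinal.natCast_lt_omega0 _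
    have hle' : max a b ≤ ((max m n : ℕ) : Ordinal.{0}) := by
      refine hle.trans (max_le ?_ ?_)
      · exact_mod_cast le_max_left m n
      · exact_mod_cast le_max_right m n
    obtain ⟨a, rfl⟩ := Ordinal.lt_omega0.1 (((le_max_left _ _).trans hle').trans_lt hlt)
    obtain ⟨b, rfl⟩ := Ordinal.lt_omega0.1 (((le_max_right _ _).trans hle').trans_lt hlt)
    have h1 : (a : Ordinal.{0}) ≤ ((max m n : ℕ) : Ordinal.{0}) := (le_max_left _ _).trans hle'
    have h2 : (b : Ordinal.{0}) ≤ ((max m n : ℕ) : Ordinal.{0}) := (le_max_right _ _).trans hle'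
    refine ⟨(a, b), ⟨?_, ?_⟩, by simp [gp, opair, natZ_eq]⟩
    · exact Nat.lt_succ_of_le (by exact_mod_cast h1)
    · exact Nat.lt_succ_of_le (by exact_mod_cast h2)
  exact Set.infinite_of_injective_forall_mem (f := natZ) (fun _ _ => natZ_inj)
    (fun n => hsub (natZ_mem_omega n)) hfin

section Mdl

variable {E A : Set ZFSet.{0}} [hE : Mdl E A]

include hE in
theorem Mdl.isOrd_mem {a : ZFSet.{0}} (ha : IsOrd a) : a ∈ E := by
  induction a using ZFSet.inductionOn with
  | _ a ih =>
    obtain ⟨b, hb, hab⟩ := hE.coll a fun w hw => ih w hw (ha.mem hw)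
    set o : ZFSet.{0} := ZFSet.sep (fun x => IsOrd x ∧ x ⊆ b) b with ho
    have hoE : o ∈ E := by
      refine sep1 (A := A) (P := fun x b => x ∈ b ∧ IsOrd x ∧ x ⊆ b) inferInstance hb fun w => ?_
      rw [ho, ZFSet.mem_sep]
      exact ⟨fun h => ⟨hE.trans _ hb _ h.1, h⟩, fun h => h.2⟩
    have hoo : IsOrd o := by
      refine .of_subset (fun x hx y hy => ?_) fun x hx => (ZFSet.mem_sep.1 hx).2.1
      obtain ⟨hxb, hxo, hsub⟩ := ZFSet.mem_sep.1 hx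
      exact ZFSet.mem_sep.2 ⟨hsub hy, hxo.mem hy, fun z hz => hsub (hxo.trans hz hy)⟩
    have hao : a ⊆ o := fun x hx =>
      ZFSet.mem_sep.2 ⟨hab hx, ha.mem hx, fun z hz => hab (ha.trans hz hx)⟩
    rcases (IsOrdinal.subset_iff_eq_or_mem (isOrd_iff.1 ha) (isOrd_iff.1 hoo)).1 hao with h | h
    · rwa [h]
    · exact hE.trans _ hoE _ h

instance DTerm.omega : DTerm (fam E A) (fun _ => ZFSet.omega) := by
  refine .of_mem (fun v hv w hw => Mdl.isOrd_mem (A := A) (isOrd_omega.mem hw)) ?_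
  exact (inferInstance : Dfn (fam E A) (fun v => IsOrd (v 0) ∧
    (v 0 = ∅ ∨ ∃ m ∈ v 0, v 0 = Insert.insert m m) ∧
    ∀ k ∈ v 0, k = ∅ ∨ ∃ m ∈ k, k = Insert.insert m m)).congr
    fun _ _ _ _ => mem_omega_iff_isOrd

instance DTerm.natZ (n : ℕ) : DTerm (fam E A) (fun _ => natZ n) := by
  induction n with
  | zero => exact DTerm.empty
  | succ n ih => exact (inferInstance : DTerm (fam E A) fun _ =>
    Insert.insert (SRPPaper.natZ n) (SRPPaper.natZ n))

theorem Dfn.maxLex : Dfn (fam E A) (fun v => MaxLex (v 0) (v 1)) := by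
  refine Dfn.congrE (P := fun v => ∃ a' ∈ E, ∃ b' ∈ E, ∃ a ∈ E, ∃ b ∈ E, IsOrd a' ∧ IsOrd b' ∧
    IsOrd a ∧ IsOrd b ∧ v 0 = ZFSet.pair a' b' ∧ v 1 = ZFSet.pair a b ∧
    (a' ∪ b' ∈ a ∪ b ∨ a' ∪ b' = a ∪ b ∧ (a' ∈ a ∨ a' = a ∧ b' ∈ b))) inferInstance fun v hv => ?_
  constructor
  · rintro ⟨a', b', a, b, ha', hb', ha, hb, h⟩
    have := fun {x} => Mdl.isOrd_mem (E := E) (A := A) (a := x)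
    exact ⟨a', this ha', b', this hb', a, this ha, b, this hb, ha', hb', ha, hb, h⟩
  · rintro ⟨a', -, b', -, a, -, b, -, h⟩
    exact ⟨a', b', a, b, h⟩

instance DTerm.gpair {f : (ℕ → ZFSet.{0}) → ZFSet.{0}} [DTerm (fam E A) f] :
    DTerm (fam E A) (fun v => gpair (f v)) := by
  refine Mdl.dterm_rec (f := SRPPaper.gpair) maxLex_wf Dfn.maxLex (fun x hx z hz => ?_)
    (fun x _ => maxLex_small x) (Ψ := fun w x h => ∃ z ∈ E, ZFSet.pair z w ∈ h) inferInstance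
    (fun x hx h hh hw => ⟨fun w hwf => ?_, fun w hwE => ?_⟩) f
  · obtain ⟨p, q, rfl, -⟩ := maxLex_iff.1 hz
    exact Mdl.pair_mem (A := A) (Mdl.isOrd_mem (A := A) (isOrd_toZFSet _))
      (Mdl.isOrd_mem (A := A) (isOrd_toZFSet _))
  · obtain ⟨z, -, rfl⟩ := mem_gpair.1 hwf
    exact Mdl.isOrd_mem (A := A) (isOrd_gpair _)
  · rw [mem_gpair]
    constructor
    · rintro ⟨z, hz, rfl⟩
      have : ZFSet.pair z (SRPPaper.gpair z) ∈ h := (hw _).2 ⟨z, hz, rfl⟩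
      exact ⟨z, Mdl.fst_mem (A := A) (hE.trans _ hh _ this), this⟩
    · rintro ⟨z, hz, hm⟩
      obtain ⟨z', h1, h2⟩ := (hw _).1 hm
      obtain ⟨rfl, rfl⟩ := pair_inj.1 h2
      exact ⟨z, h1, rfl⟩

instance DTerm.gp {f g : (ℕ → ZFSet.{0}) → ZFSet.{0}} [DTerm (fam E A) f] [DTerm (fam E A) g] :
    DTerm (fam E A) (fun v => gp (f v) (g v)) :=
  (inferInstance : DTerm (fam E A) (fun v => SRPPaper.gpair (ZFSet.pair (f v) (g v))))

end Mdl

/-! ### Satisfaction inside a model -/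

/-- Encoding of a finite sequence as a set-theoretic function, in reversed order. -/
def enc {n : ℕ} (v : Fin n → ZFSet.{0}) : ZFSet.{0} :=
  ZFSet.range fun i : Fin n => pair (natZ i.rev) (v i)

theorem mem_enc {n : ℕ} {v : Fin n → ZFSet.{0}} {w : ZFSet.{0}} :
    w ∈ enc v ↔ ∃ i : Fin n, w = pair (natZ i.rev) (v i) := by
  simp [enc, eq_comm]

theorem pair_mem_enc {n : ℕ} {v : Fin n → ZFSet.{0}} {a x : ZFSet.{0}} :
    pair a x ∈ enc v ↔ ∃ i : Fin n, a = natZ i.rev ∧ x = v i := by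
  simp [mem_enc, pair_inj]

theorem pair_rev_mem_enc {n : ℕ} {v : Fin n → ZFSet.{0}} {i : Fin n} {x : ZFSet.{0}} :
    pair (natZ i.rev) x ∈ enc v ↔ x = v i := by
  rw [pair_mem_enc]
  constructor
  · rintro ⟨j, h, rfl⟩
    obtain rfl : i = j := Fin.rev_injective (Fin.ext (natZ_inj h))
    rfl
  · rintro rfl
    exact ⟨i, rfl, rfl⟩

theorem enc_cons {n : ℕ} (x : ZFSet.{0}) (v : Fin n → ZFSet.{0}) :
    enc (Fin.cons x v : Fin (n + 1) → ZFSet.{0}) = insert (pair (natZ n) x) (enc v) := by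
  ext w
  rw [mem_enc, Fin.exists_fin_succ, ZFSet.mem_insert_iff, mem_enc]
  simp

theorem isFunc_enc {n : ℕ} {v : Fin n → ZFSet.{0}} {X : ZFSet.{0}} (hv : ∀ i, v i ∈ X) :
    IsFunc (natZ n) X (enc v) := by
  rw [isFunc_iff]
  constructor
  · intro p hp
    obtain ⟨i, rfl⟩ := mem_enc.1 hp
    exact ⟨_, mem_natZ.2 ⟨i.rev, i.rev.2, rfl⟩, _, hv i, rfl⟩
  · intro x hx
    obtain ⟨m, hm, rfl⟩ := mem_natZ.1 hx
    have : m = (Fin.rev (Fin.rev ⟨m, hm⟩)).val := by simp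
    rw [this]
    exact ⟨_, hv _, pair_rev_mem_enc.2 rfl, fun y' _ h' => pair_rev_mem_enc.1 h'⟩

theorem exists_enc {n : ℕ} {X t : ZFSet.{0}} (ht : IsFunc (natZ n) X t) :
    ∃ v : Fin n → ZFSet.{0}, (∀ i, v i ∈ X) ∧ t = enc v := by
  obtain ⟨h1, h2⟩ := isFunc_iff.1 ht
  choose! f hfX hft hfu using h2
  have hr : ∀ i : Fin n, natZ i ∈ natZ n := fun i => mem_natZ.2 ⟨i, i.2, rfl⟩
  refine ⟨fun i => f (natZ i.rev), fun i => hfX _ (hr _), ?_⟩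
  ext w
  rw [mem_enc]
  constructor
  · intro hw
    obtain ⟨x, hx, y, hy, rfl⟩ := h1 w hw
    obtain ⟨m, hm, rfl⟩ := mem_natZ.1 hx
    exact ⟨Fin.rev ⟨m, hm⟩, by simp [hfu _ hx y hy hw]⟩
  · rintro ⟨i, rfl⟩
    exact hft _ (hr _)

theorem isFunc_enc_dom {n m : ℕ} {v : Fin n → ZFSet.{0}} {X : ZFSet.{0}}
    (h : IsFunc (natZ m) X (enc v)) : m = n := by
  obtain ⟨w, hw, he⟩ := exists_enc h
  have key : ∀ {n m : ℕ} {v : Fin n → ZFSet.{0}} {w : Fin m → ZFSet.{0}}, enc v = enc w →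
      n ≤ m := fun {n m v w} he => by
    cases n with
    | zero => exact Nat.zero_le _
    | succ n =>
      have : pair (natZ (Fin.rev (0 : Fin (n + 1)))) (v 0) ∈ enc w := he ▸ pair_rev_mem_enc.2 rfl
      obtain ⟨i, hi, -⟩ := pair_mem_enc.1 this
      have := natZ_inj hi
      simp at this
      omega
  exact le_antisymm (key he.symm) (key he)

/-- The ordinal coding a formula node with label `o`, arity `n` and subnodes `a`, `b`. -/
def cd4 (o n a b : ZFSet.{0}) : ZFSet.{0} := gp (insert a a) (gp (insert b b) (gp o n))

theorem insert_self_inj {a b : ZFSet.{0}} (ha : IsOrd a) (hb : IsOrd b)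
    (h : insert a a = insert b b) : a = b := by
  rw [← ha.toZFSet_rank, ← hb.toZFSet_rank, ← Ordinal.toZFSet_add_one,
    ← Ordinal.toZFSet_add_one] at h
  have := Ordinal.toZFSet_injective h
  rw [← ha.toZFSet_rank, ← hb.toZFSet_rank]
  congr 1
  simpa using this

theorem isOrd_cd4 (o n a b : ZFSet.{0}) : IsOrd (cd4 o n a b) := isOrd_gp _ _

theorem cd4_inj {o n a b o' n' a' b' : ZFSet.{0}} (ho : IsOrd o) (hn : IsOrd n) (ha : IsOrd a)
    (hb : IsOrd b) (ho' : IsOrd o') (hn' : IsOrd n') (ha' : IsOrd a') (hb' : IsOrd b')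
    (h : cd4 o n a b = cd4 o' n' a' b') : o = o' ∧ n = n' ∧ a = a' ∧ b = b' := by
  obtain ⟨h1, h2⟩ := gp_inj ha.succ (isOrd_gp _ _) ha'.succ (isOrd_gp _ _) h
  obtain ⟨h3, h4⟩ := gp_inj hb.succ (isOrd_gp _ _) hb'.succ (isOrd_gp _ _) h2
  obtain ⟨h5, h6⟩ := gp_inj ho hn ho' hn' h4
  exact ⟨h5, h6, insert_self_inj ha ha' h1, insert_self_inj hb hb' h3⟩

theorem left_mem_cd4 {o n a b : ZFSet.{0}} (ha : IsOrd a) : a ∈ cd4 o n a b :=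
  left_subset_gp ha.succ (isOrd_gp _ _) (by simp)

theorem right_mem_cd4 {o n a b : ZFSet.{0}} (ha : IsOrd a) (hb : IsOrd b) : b ∈ cd4 o n a b :=
  right_subset_gp ha.succ (isOrd_gp _ _) (left_subset_gp hb.succ (isOrd_gp _ _) (by simp))

/-- The inductive step in the evaluation of formula codes; `F a t` says that `t` satisfies the
formula with code `a`. -/
def SatStep (B : Set ZFSet.{0}) (X t o n a b : ZFSet.{0}) (F : ZFSet.{0} → ZFSet.{0} → Prop) :
    Prop :=
  (o = natZ 0 ∧ ∃ x ∈ X, ∃ y ∈ X, pair a x ∈ t ∧ pair b y ∈ t ∧ x ∈ y) ∨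
  (o = natZ 1 ∧ ∃ x ∈ X, pair a x ∈ t ∧ pair b x ∈ t) ∨
  (o = natZ 2 ∧ ∃ x ∈ X, pair a x ∈ t ∧ x ∈ B) ∨
  (o = natZ 3 ∧ ¬ F a t) ∨
  (o = natZ 4 ∧ F a t ∧ F b t) ∨
  (o = natZ 5 ∧ ∃ x ∈ X, F a (insert (pair n x) t))

/-- The set of (encoded) assignments satisfying the formula coded by `e` in `(X, ∈, B)`. -/
def fv (B : Set ZFSet.{0}) (X : ZFSet.{0}) : ZFSet.{0} → ZFSet.{0} :=
  ZFSet.mem_wf.fix fun e ih => ZFSet.sep (fun t => ∃ o n a b, IsOrd o ∧ IsOrd a ∧ IsOrd b ∧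
    n ∈ ZFSet.omega ∧ e = cd4 o n a b ∧ IsFunc n X t ∧
    SatStep B X t o n a b fun z t => t ∈ if h : z ∈ e then ih z h else ∅)
    (ZFSet.powerset (prod ZFSet.omega X))

theorem SatStep.congr {B : Set ZFSet.{0}} {X t o n a b : ZFSet.{0}}
    {F F' : ZFSet.{0} → ZFSet.{0} → Prop} (ha : ∀ t, F a t ↔ F' a t) (hb : ∀ t, F b t ↔ F' b t) :
    SatStep B X t o n a b F ↔ SatStep B X t o n a b F' := by
  simp only [SatStep, ha, hb]

theorem mem_fv {B : Set ZFSet.{0}} {X e t : ZFSet.{0}} : t ∈ fv B X e ↔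
    ∃ o n a b, IsOrd o ∧ IsOrd a ∧ IsOrd b ∧ n ∈ ZFSet.omega ∧ e = cd4 o n a b ∧ IsFunc n X t ∧
      SatStep B X t o n a b fun z t => t ∈ fv B X z := by
  rw [fv, WellFounded.fix_eq, ZFSet.mem_sep, and_iff_right_of_imp]
  · refine exists_congr fun o => exists_congr fun n => exists_congr fun a => exists_congr fun b =>
      and_congr_right fun ho => and_congr_right fun ha => and_congr_right fun hb =>
      and_congr_right fun hn => and_congr_right fun he => and_congr_right fun hf => ?_
    subst he
    exact SatStep.congr (fun t => by rw [dif_pos (left_mem_cd4 ha)])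
      fun t => by rw [dif_pos (right_mem_cd4 ha hb)]
  · rintro ⟨o, n, a, b, -, -, -, hn, -, hf, -⟩
    refine ZFSet.mem_powerset.2 fun p hp => ?_
    have := hf.1 hp
    rw [ZFSet.mem_prod] at this ⊢
    obtain ⟨x, hx, y, hy, rfl⟩ := this
    exact ⟨x, isOrd_omega.trans hx hn, y, hy, rfl⟩

theorem mem_fv_cd4 {B : Set ZFSet.{0}} {X o n a b t : ZFSet.{0}} (ho : IsOrd o)
    (hn : n ∈ ZFSet.omega) (ha : IsOrd a) (hb : IsOrd b) : t ∈ fv B X (cd4 o n a b) ↔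
      IsFunc n X t ∧ SatStep B X t o n a b fun z t => t ∈ fv B X z := by
  rw [mem_fv]
  constructor
  · rintro ⟨o', n', a', b', ho', ha', hb', hn', he, h⟩
    obtain ⟨rfl, rfl, rfl, rfl⟩ := cd4_inj ho (isOrd_omega.mem hn) ha hb ho' (isOrd_omega.mem hn')
      ha' hb' he
    exact h
  · intro h
    exact ⟨o, n, a, b, ho, ha, hb, hn, rfl, h⟩

/-- The ordinal code of a formula. -/
def Fml.code : ∀ {n : ℕ}, Fml n → ZFSet.{0}
  | n, .mem i j => cd4 (natZ 0) (natZ n) (natZ i.rev) (natZ j.rev)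
  | n, .eq i j => cd4 (natZ 1) (natZ n) (natZ i.rev) (natZ j.rev)
  | n, .inA i => cd4 (natZ 2) (natZ n) (natZ i.rev) ∅
  | n, .inB _ => cd4 (natZ 6) (natZ n) ∅ ∅
  | n, .not φ => cd4 (natZ 3) (natZ n) φ.code ∅
  | n, .and φ ψ => cd4 (natZ 4) (natZ n) φ.code ψ.code
  | n, .ex φ => cd4 (natZ 5) (natZ n) φ.code ∅

theorem Fml.isOrd_code {n : ℕ} (φ : Fml n) : IsOrd φ.code := by
  cases φ <;> exact isOrd_cd4 _ _ _ _

theorem natZ_inj_iff {m n : ℕ} : natZ m = natZ n ↔ m = n := ⟨natZ_inj, fun h => h ▸ rfl⟩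

theorem isOrd_empty : IsOrd (∅ : ZFSet.{0}) := isOrd_natZ 0

theorem enc_mem_fv_code {B : Set ZFSet.{0}} {X : ZFSet.{0}} {n : ℕ} (φ : Fml n) :
    ∀ v : Fin n → ZFSet.{0}, (∀ i, v i ∈ X) →
      (enc v ∈ fv B X φ.code ↔ SatAB X.toSet B ∅ φ v) := by
  induction φ with
  | mem i j =>
    intro v hv
    rw [Fml.code, mem_fv_cd4 (isOrd_natZ _) (natZ_mem_omega _) (isOrd_natZ _) (isOrd_natZ _),
      and_iff_right (isFunc_enc hv)]
    simp [SatStep, natZ_inj_iff, pair_rev_mem_enc, SatAB, hv, -Fin.val_rev]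
  | eq i j =>
    intro v hv
    rw [Fml.code, mem_fv_cd4 (isOrd_natZ _) (natZ_mem_omega _) (isOrd_natZ _) (isOrd_natZ _),
      and_iff_right (isFunc_enc hv)]
    simp [SatStep, natZ_inj_iff, pair_rev_mem_enc, SatAB, hv, -Fin.val_rev]
    exact eq_comm
  | inA i =>
    intro v hv
    rw [Fml.code, mem_fv_cd4 (isOrd_natZ _) (natZ_mem_omega _) (isOrd_natZ _) isOrd_empty,
      and_iff_right (isFunc_enc hv)]
    simp [SatStep, natZ_inj_iff, pair_rev_mem_enc, SatAB, hv, -Fin.val_rev]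
  | inB i =>
    intro v hv
    rw [Fml.code, mem_fv_cd4 (isOrd_natZ _) (natZ_mem_omega _) isOrd_empty isOrd_empty,
      and_iff_right (isFunc_enc hv)]
    simp [SatStep, natZ_inj_iff, SatAB]
  | not φ ih =>
    intro v hv
    rw [Fml.code, mem_fv_cd4 (isOrd_natZ _) (natZ_mem_omega _) φ.isOrd_code isOrd_empty,
      and_iff_right (isFunc_enc hv)]
    simp [SatStep, natZ_inj_iff, SatAB, ih v hv]
  | and φ ψ ih1 ih2 =>
    intro v hv
    rw [Fml.code, mem_fv_cd4 (isOrd_natZ _) (natZ_mem_omega _) φ.isOrd_code ψ.isOrd_code,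
      and_iff_right (isFunc_enc hv)]
    simp [SatStep, natZ_inj_iff, SatAB, ih1 v hv, ih2 v hv]
  | ex φ ih =>
    intro v hv
    rw [Fml.code, mem_fv_cd4 (isOrd_natZ _) (natZ_mem_omega _) φ.isOrd_code isOrd_empty,
      and_iff_right (isFunc_enc hv)]
    simp only [SatStep, natZ_inj_iff, SatAB, ← enc_cons]
    have hc : ∀ x ∈ X, ∀ i, (Fin.cons x v : Fin _ → ZFSet.{0}) i ∈ X := fun x hx i => by
      refine Fin.cases ?_ (fun i => ?_) i
      · simpa using hx
      · simpa using hv i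
    simp only [Nat.reduceEqDiff, OfNat.ofNat_ne_zero, false_and, false_or, true_and]
    exact exists_congr fun x => and_congr_right fun hx => ih _ (hc x hx)

theorem exists_fml_of_code (B : Set ZFSet.{0}) (X e : ZFSet.{0}) : ∀ n : ℕ, ∃ φ : Fml n,
    ∀ v : Fin n → ZFSet.{0}, (∀ i, v i ∈ X) → (enc v ∈ fv B X e ↔ SatAB X.toSet B ∅ φ v) := by
  induction e using ZFSet.inductionOn with
  | _ e ih =>
    intro n
    have bot : ∃ φ : Fml n, ∀ v, ¬ SatAB X.toSet B ∅ φ v :=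
      ⟨.ex (.not (.eq 0 0)), fun v => by simp [SatAB]⟩
    obtain ⟨bot, hbot⟩ := bot
    by_cases he : ∃ o a b, IsOrd o ∧ IsOrd a ∧ IsOrd b ∧ e = cd4 o (natZ n) a b
    · obtain ⟨o, a, b, ho, ha, hb, rfl⟩ := he
      have hiff : ∀ v : Fin n → ZFSet.{0}, (∀ i, v i ∈ X) →
          (enc v ∈ fv B X (cd4 o (natZ n) a b) ↔
            SatStep B X (enc v) o (natZ n) a b fun z t => t ∈ fv B X z) := fun v hv => by
        rw [mem_fv_cd4 ho (natZ_mem_omega _) ha hb, and_iff_right (isFunc_enc hv)]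
      suffices h : ∃ φ : Fml n, ∀ v : Fin n → ZFSet.{0}, (∀ i, v i ∈ X) →
          ((SatStep B X (enc v) o (natZ n) a b fun z t => t ∈ fv B X z) ↔
            SatAB X.toSet B ∅ φ v) by
        obtain ⟨φ, hφ⟩ := h
        exact ⟨φ, fun v hv => (hiff v hv).trans (hφ v hv)⟩
      by_cases h0 : o = natZ 0
      · subst h0
        by_cases hij : ∃ i j : Fin n, a = natZ i.rev ∧ b = natZ j.rev
        · obtain ⟨i, j, rfl, rfl⟩ := hij
          exact ⟨.mem i j, fun v hv => by
            simp [SatStep, natZ_inj_iff, pair_rev_mem_enc, SatAB, hv, -Fin.val_rev]⟩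
        · refine ⟨bot, fun v hv => iff_of_false ?_ (hbot v)⟩
          simp only [SatStep, natZ_inj_iff, pair_mem_enc]
          simp only [OfNat.zero_ne_ofNat, zero_ne_one, false_and, or_false, true_and]
          rintro ⟨x, -, y, -, ⟨i, hi, -⟩, ⟨j, hj, -⟩, -⟩
          exact hij ⟨i, j, hi, hj⟩
      by_cases h1 : o = natZ 1
      · subst h1
        by_cases hij : ∃ i j : Fin n, a = natZ i.rev ∧ b = natZ j.rev
        · obtain ⟨i, j, rfl, rfl⟩ := hij
          exact ⟨.eq i j, fun v hv => by
            simp [SatStep, natZ_inj_iff, pair_rev_mem_enc, SatAB, hv, -Fin.val_rev]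
            exact eq_comm⟩
        · refine ⟨bot, fun v hv => iff_of_false ?_ (hbot v)⟩
          simp only [SatStep, h0, natZ_inj_iff, pair_mem_enc]
          simp only [OfNat.one_ne_ofNat, false_and, or_false, false_or, true_and]
          rintro ⟨x, -, ⟨i, hi, -⟩, ⟨j, hj, -⟩⟩
          exact hij ⟨i, j, hi, hj⟩
      by_cases h2 : o = natZ 2
      · subst h2
        by_cases hij : ∃ i : Fin n, a = natZ i.rev
        · obtain ⟨i, rfl⟩ := hij
          exact ⟨.inA i, fun v hv => by
            simp [SatStep, natZ_inj_iff, pair_rev_mem_enc, SatAB, hv, -Fin.val_rev]⟩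
        · refine ⟨bot, fun v hv => iff_of_false ?_ (hbot v)⟩
          simp only [SatStep, h0, h1, natZ_inj_iff, pair_mem_enc]
          simp only [Nat.reduceEqDiff, false_and, or_false, false_or, true_and]
          rintro ⟨x, -, ⟨i, hi, -⟩, -⟩
          exact hij ⟨i, hi⟩
      by_cases h3 : o = natZ 3
      · subst h3
        obtain ⟨φ, hφ⟩ := ih a (left_mem_cd4 ha) n
        exact ⟨.not φ, fun v hv => by simp [SatStep, natZ_inj_iff, SatAB, hφ v hv]⟩
      by_cases h4 : o = natZ 4
      · subst h4
        obtain ⟨φ, hφ⟩ := ih a (left_mem_cd4 ha) n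
        obtain ⟨ψ, hψ⟩ := ih b (right_mem_cd4 ha hb) n
        exact ⟨.and φ ψ, fun v hv => by simp [SatStep, natZ_inj_iff, SatAB, hφ v hv, hψ v hv]⟩
      by_cases h5 : o = natZ 5
      · subst h5
        obtain ⟨φ, hφ⟩ := ih a (left_mem_cd4 ha) (n + 1)
        refine ⟨.ex φ, fun v hv => ?_⟩
        have hc : ∀ x ∈ X, ∀ i, (Fin.cons x v : Fin _ → ZFSet.{0}) i ∈ X := fun x hx i => by
          refine Fin.cases ?_ (fun i => ?_) i
          · simpa using hx
          · simpa using hv i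
        simp only [SatStep, h0, h1, h2, h3, h4, ← enc_cons, SatAB, false_and, false_or, true_and]
        exact exists_congr fun x => and_congr_right fun hx => hφ _ (hc x hx)
      · exact ⟨bot, fun v hv => iff_of_false (by simp [SatStep, h0, h1, h2, h3, h4, h5]) (hbot v)⟩
    · refine ⟨bot, fun v hv => iff_of_false ?_ (hbot v)⟩
      intro h
      obtain ⟨o, m, a, b, ho, ha, hb, hm, rfl, hf, -⟩ := mem_fv.1 h
      obtain ⟨m, rfl⟩ := mem_omega.1 hm
      obtain rfl := isFunc_enc_dom hf
      exact he ⟨o, a, b, ho, ha, hb, rfl⟩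

theorem mem_DefSetA_iff {B : Set ZFSet.{0}} {X y : ZFSet.{0}} : y ∈ DefSetA B X ↔
    y ⊆ X ∧ ∃ n ∈ ZFSet.omega, ∃ e, IsOrd e ∧ ∃ t, IsFunc n X t ∧
      ∀ z ∈ X, (z ∈ y ↔ insert (pair n z) t ∈ fv B X e) := by
  have hc : ∀ {n} {v : Fin n → ZFSet.{0}}, (∀ i, v i ∈ X) → ∀ x ∈ X, ∀ i,
      (Fin.cons x v : Fin _ → ZFSet.{0}) i ∈ X := fun {n v} hv x hx i => by
    refine Fin.cases ?_ (fun i => ?_) i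
    · simpa using hx
    · simpa using hv i
  rw [mem_DefSetA]
  constructor
  · rintro ⟨n, φ, v, hv, rfl⟩
    refine ⟨fun z hz => (ZFSet.mem_sep.1 hz).1, natZ n, natZ_mem_omega n, φ.code, φ.isOrd_code,
      enc v, isFunc_enc hv, fun z hz => ?_⟩
    rw [ZFSet.mem_sep, and_iff_right hz, ← enc_cons, enc_mem_fv_code φ _ (hc hv z hz)]
  · rintro ⟨hy, n, hn, e, he, t, ht, h⟩
    obtain ⟨n, rfl⟩ := mem_omega.1 hn
    obtain ⟨v, hv, rfl⟩ := exists_enc ht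
    obtain ⟨φ, hφ⟩ := exists_fml_of_code B X e (n + 1)
    refine ⟨n, φ, v, hv, ?_⟩
    ext z
    rw [ZFSet.mem_sep]
    constructor
    · intro hz
      refine ⟨hy hz, ?_⟩
      rw [← hφ _ (hc hv z (hy hz)), enc_cons]
      exact (h z (hy hz)).1 hz
    · rintro ⟨hz, hs⟩
      rw [← hφ _ (hc hv z hz), enc_cons] at hs
      exact (h z hz).2 hs

/-! ### Definability of the constructible hierarchy inside a model -/

section Mdl

variable {E A : Set ZFSet.{0}} [hE : Mdl E A]

theorem Mdl.sep4 {P : ZFSet.{0} → ZFSet.{0} → ZFSet.{0} → ZFSet.{0} → ZFSet.{0} → Prop}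
    (hP : Dfn (fam E A) (fun v => P (v 0) (v 1) (v 2) (v 3) (v 4)))
    {p q r s y : ZFSet.{0}} (hp : p ∈ E) (hq : q ∈ E) (hr : r ∈ E) (hs : s ∈ E)
    (hy : ∀ w, w ∈ y ↔ w ∈ E ∧ P w p q r s) : y ∈ E :=
  hE.sep _ hP (fun | 0 => p | 1 => q | 2 => r | _ => s)
    (fun k => by rcases k with _ | _ | _ | k <;> assumption) y hy

theorem Mdl.dterm_rec_mem {f : ZFSet.{0} → ZFSet.{0} → ZFSet.{0}}
    {Ψ : ZFSet.{0} → ZFSet.{0} → ZFSet.{0} → ZFSet.{0} → Prop}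
    (dΨ : Dfn (fam E A) (fun v => Ψ (v 0) (v 1) (v 2) (v 3)))
    (hf : ∀ X ∈ E, ∀ e ∈ E, ∀ h ∈ E, (∀ w, w ∈ h ↔ ∃ a ∈ e, w = pair a (f X a)) →
      (∀ w ∈ f X e, w ∈ E) ∧ ∀ w ∈ E, w ∈ f X e ↔ Ψ w X e h)
    (g₁ g₂ : (ℕ → ZFSet.{0}) → ZFSet.{0}) [DTerm (fam E A) g₁] [DTerm (fam E A) g₂] :
    DTerm (fam E A) (fun v => f (g₁ v) (g₂ v)) := by
  let ρ : ZFSet.{0} → ZFSet.{0} → Prop := fun z x => ∃ X, ∃ e, x = pair X e ∧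
    ∃ a ∈ e, z = pair X a
  let f' : ZFSet.{0} → ZFSet.{0} := fun x =>
    if h : ∃ X e, x = pair X e then f h.choose h.choose_spec.choose else ∅
  have hf' : ∀ X e, f' (pair X e) = f X e := fun X e => by
    have h : ∃ X' e', pair X e = pair X' e' := ⟨X, e, rfl⟩
    have := pair_inj.1 h.choose_spec.choose_spec
    simp only [f', dif_pos h]
    exact congr_arg₂ f this.1.symm this.2.symm
  have key := Mdl.dterm_rec (E := E) (A := A) (ρ := ρ) (f := f')
    (Ψ := fun w x h' => ∃ X ∈ E, ∃ e ∈ E, x = pair X e ∧ ∃ h ∈ E,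
      (∀ u ∈ E, u ∈ h ↔ ∃ a ∈ e, ∃ y ∈ E, u = pair a y ∧ pair (pair X a) y ∈ h') ∧ Ψ w X e h)
    ?_ ?_ ?_ ?_ ?_ ?_ (fun v => pair (g₁ v) (g₂ v))
  · simpa only [hf'] using key
  · constructor
    have : ∀ e X, Acc ρ (pair X e) := fun e => by
      induction e using ZFSet.inductionOn with
      | _ e ih =>
        intro X
        constructor
        rintro _ ⟨X', e', h, a, ha, rfl⟩
        obtain ⟨rfl, rfl⟩ := pair_inj.1 h
        exact ih a ha X
    intro x
    constructor
    rintro _ ⟨X', e', h, a, ha, rfl⟩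
    exact this a X'
  · refine Dfn.congrE (P := fun v => ∃ X ∈ E, ∃ e ∈ E, v 1 = pair X e ∧ ∃ a ∈ e, v 0 = pair X a)
      inferInstance fun v hv => ?_
    constructor
    · rintro ⟨X, e, h1, h2⟩
      have h0 := hv 1
      rw [h1] at h0
      exact ⟨X, Mdl.fst_mem (A := A) h0, e, Mdl.snd_mem (A := A) h0, h1, h2⟩
    · rintro ⟨X, -, e, -, h⟩
      exact ⟨X, e, h⟩
  · rintro _ hx _ ⟨X, e, rfl, a, ha, rfl⟩
    exact Mdl.pair_mem (A := A) (Mdl.fst_mem (A := A) hx)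
      (hE.trans _ (Mdl.snd_mem (A := A) hx) _ ha)
  · rintro x -
    by_cases h : ∃ X e, x = pair X e
    · obtain ⟨X, e, rfl⟩ := h
      refine ⟨img (fun a => pair X a) e, ?_⟩
      rintro _ ⟨X', e', h, a, ha, rfl⟩
      obtain ⟨rfl, rfl⟩ := pair_inj.1 h
      exact mem_img.2 ⟨a, ha, rfl⟩
    · exact ⟨∅, fun z ⟨X, e, h', _⟩ => (h ⟨X, e, h'⟩).elim⟩
  · have := fun i j k l => dΨ.rename fun | 0 => i | 1 => j | 2 => k | _ => l
    infer_instance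
  · intro x hx h' hh' hw'
    by_cases hx' : ∃ X e, x = pair X e
    · obtain ⟨X, e, rfl⟩ := hx'
      have hX := Mdl.fst_mem (A := A) hx
      have he := Mdl.snd_mem (A := A) hx
      have hp : ∀ a ∈ e, pair (pair X a) (f X a) ∈ h' := fun a ha =>
        (hw' _).2 ⟨pair X a, ⟨X, e, rfl, a, ha, rfl⟩, by rw [hf']⟩
      have hfE : ∀ a ∈ e, f X a ∈ E := fun a ha =>
        Mdl.snd_mem (A := A) (hE.trans _ hh' _ (hp a ha))
      have hv : ∀ a y, pair (pair X a) y ∈ h' → y = f X a := fun a y hy => by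
        obtain ⟨z, -, he⟩ := (hw' _).1 hy
        obtain ⟨rfl, rfl⟩ := pair_inj.1 he
        exact hf' _ _
      let h : ZFSet.{0} := img (fun a => pair a (f X a)) e
      have hh : ∀ w, w ∈ h ↔ ∃ a ∈ e, w = pair a (f X a) := fun w => by
        simp only [h, mem_img, eq_comm]
      have hhu : ∀ u, u ∈ h ↔ ∃ a ∈ e, ∃ y ∈ E, u = pair a y ∧ pair (pair X a) y ∈ h' := fun u => by
        rw [hh]
        constructor
        · rintro ⟨a, ha, rfl⟩
          exact ⟨a, ha, _, hfE a ha, rfl, hp a ha⟩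
        · rintro ⟨a, ha, y, -, rfl, hy⟩
          exact ⟨a, ha, by rw [hv a y hy]⟩
      have hhE : h ∈ E := Mdl.sep3 (A := A) (P := fun u X e h' =>
        ∃ a ∈ e, ∃ y ∈ E, u = pair a y ∧ pair (pair X a) y ∈ h') inferInstance hX he hh' fun u => by
          rw [hhu, iff_and_self]
          rintro ⟨a, ha, y, hy, rfl, -⟩
          exact Mdl.pair_mem (A := A) (hE.trans _ he _ ha) hy
      obtain ⟨h1, h2⟩ := hf X hX e he h hhE hh
      rw [hf']
      refine ⟨h1, fun w hw => ?_⟩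
      rw [h2 w hw]
      constructor
      · intro hΨ
        exact ⟨X, hX, e, he, rfl, h, hhE, fun u _ => hhu u, hΨ⟩
      · rintro ⟨X', -, e', -, hxe, h₂, hh₂, hu, hΨ⟩
        obtain ⟨rfl, rfl⟩ := pair_inj.1 hxe
        have : h₂ = h := by
          ext u
          rw [hhu]
          constructor
          · exact fun hu' => (hu u (hE.trans _ hh₂ _ hu')).1 hu'
          · intro hu'
            refine (hu u ?_).2 hu'
            obtain ⟨a, ha, y, hy, rfl, -⟩ := hu'
            exact Mdl.pair_mem (A := A) (hE.trans _ he _ ha) hy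
        rwa [this] at hΨ
    · have : f' x = ∅ := dif_neg hx'
      rw [this]
      refine ⟨by simp, fun w _ => iff_of_false (by simp) ?_⟩
      rintro ⟨X, -, e, -, rfl, -⟩
      exact hx' ⟨X, e, rfl⟩

include hE in
theorem Mdl.enc_mem {n : ℕ} (v : Fin n → ZFSet.{0}) (hv : ∀ i, v i ∈ E) : enc v ∈ E := by
  induction n with
  | zero =>
    have : enc v = ∅ := by
      refine (ZFSet.eq_empty _).2 fun w hw => ?_
      obtain ⟨i, -⟩ := mem_enc.1 hw
      exact i.elim0
    rw [this]
    exact Mdl.isOrd_mem (A := A) isOrd_empty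
  | succ n ih =>
    rw [← Fin.cons_self_tail v, enc_cons]
    exact Mdl.insert_mem (A := A) (Mdl.pair_mem (A := A) (Mdl.isOrd_mem (A := A) (isOrd_natZ n))
      (hv 0)) (ih _ fun i => hv i.succ)

include hE in
theorem Mdl.isFunc_mem {n X t : ZFSet.{0}} (hX : X ∈ E) (hn : n ∈ ZFSet.omega)
    (ht : IsFunc n X t) : t ∈ E := by
  obtain ⟨n, rfl⟩ := mem_omega.1 hn
  obtain ⟨v, hv, rfl⟩ := exists_enc ht
  exact Mdl.enc_mem (A := A) v fun i => hE.trans _ hX _ (hv i)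

instance DTerm.cd4 {f g h k : (ℕ → ZFSet.{0}) → ZFSet.{0}} [DTerm (fam E A) f]
    [DTerm (fam E A) g] [DTerm (fam E A) h] [DTerm (fam E A) k] :
    DTerm (fam E A) (fun v => cd4 (f v) (g v) (h v) (k v)) := by
  unfold SRPPaper.cd4
  infer_instance

section Pred

variable {B : Set ZFSet.{0}} (dB : Dfn (fam E A) (fun v => v 0 ∈ B))

include dB

set_option synthInstance.maxSize 1000 in
theorem DTerm.fv (f g : (ℕ → ZFSet.{0}) → ZFSet.{0}) [DTerm (fam E A) f] [DTerm (fam E A) g] :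
    DTerm (fam E A) (fun v => fv B (f v) (g v)) := by
  refine Mdl.dterm_rec_mem (f := SRPPaper.fv B) (Ψ := fun t X e h => ∃ o ∈ E, ∃ n ∈ E, ∃ a ∈ E,
    ∃ b ∈ E, IsOrd o ∧ IsOrd a ∧ IsOrd b ∧ n ∈ ZFSet.omega ∧ e = SRPPaper.cd4 o n a b ∧
    IsFunc n X t ∧ SatStep B X t o n a b fun z t => ∃ y ∈ E, ZFSet.pair z y ∈ h ∧ t ∈ y) ?_ ?_ f g
  · have := fun i => dB.rename fun _ => i
    simp only [SatStep]
    infer_instance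
  · intro X hX e he h hh hw
    have hF : ∀ z ∈ e, ∀ t, (t ∈ SRPPaper.fv B X z ↔ ∃ y ∈ E, ZFSet.pair z y ∈ h ∧ t ∈ y) :=
      fun z hz t => by
        have hp : ZFSet.pair z (SRPPaper.fv B X z) ∈ h := (hw _).2 ⟨z, hz, rfl⟩
        constructor
        · exact fun ht => ⟨_, Mdl.snd_mem (A := A) (hE.trans _ hh _ hp), hp, ht⟩
        · rintro ⟨y, -, hy, ht⟩
          obtain ⟨z', -, h'⟩ := (hw _).1 hy
          obtain ⟨rfl, rfl⟩ := pair_inj.1 h'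
          exact ht
    refine ⟨fun t ht => ?_, fun t ht => ?_⟩
    · obtain ⟨o, n, a, b, -, -, -, hn, -, hf, -⟩ := mem_fv.1 ht
      exact Mdl.isFunc_mem (A := A) hX hn hf
    · rw [mem_fv]
      constructor
      · rintro ⟨o, n, a, b, ho, ha, hb, hn, rfl, hf, hs⟩
        exact ⟨o, Mdl.isOrd_mem (A := A) ho, n, Mdl.isOrd_mem (A := A) (isOrd_omega.mem hn),
          a, Mdl.isOrd_mem (A := A) ha, b, Mdl.isOrd_mem (A := A) hb, ho, ha, hb, hn, rfl, hf,
          (SatStep.congr (hF _ (left_mem_cd4 ha)) (hF _ (right_mem_cd4 ha hb))).1 hs⟩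
      · rintro ⟨o, -, n, -, a, -, b, -, ho, ha, hb, hn, rfl, hf, hs⟩
        exact ⟨o, n, a, b, ho, ha, hb, hn, rfl, hf,
          (SatStep.congr (hF _ (left_mem_cd4 ha)) (hF _ (right_mem_cd4 ha hb))).2 hs⟩

theorem Mdl.mem_of_mem_DefSetA {X y : ZFSet.{0}} (hX : X ∈ E) (hy : y ∈ DefSetA B X) : y ∈ E := by
  obtain ⟨hs, n, hn, e, he, t, ht, h⟩ := mem_DefSetA_iff.1 hy
  have he := Mdl.isOrd_mem (E := E) (A := A) he
  have hF : fv B X e ∈ E := DTerm.mem2 (DTerm.fv dB (fun v => v 0) (fun v => v 1)) hX he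
  refine Mdl.sep4 (A := A) (P := fun z X n t F => z ∈ X ∧ insert (pair n z) t ∈ F) inferInstance hX
    (Mdl.isOrd_mem (A := A) (isOrd_omega.mem hn)) (Mdl.isFunc_mem (A := A) hX hn ht) hF fun z => ?_
  constructor
  · exact fun hz => ⟨hE.trans _ hX _ (hs hz), hs hz, (h z (hs hz)).1 hz⟩
  · exact fun hz => (h z hz.2.1).2 hz.2.2

theorem Dfn.mem_DefSetA (f g : (ℕ → ZFSet.{0}) → ZFSet.{0}) [DTerm (fam E A) f]
    [DTerm (fam E A) g] : Dfn (fam E A) (fun v => f v ∈ DefSetA B (g v)) := by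
  refine Dfn.of2 (R := fun a b => a ∈ DefSetA B b) ?_ f g
  refine Dfn.congrE (P := fun v => v 0 ⊆ v 1 ∧ ∃ n ∈ ZFSet.omega, ∃ e ∈ E, IsOrd e ∧ ∃ t ∈ E,
    IsFunc n (v 1) t ∧ ∀ z ∈ v 1, (z ∈ v 0 ↔ insert (pair n z) t ∈ fv B (v 1) e)) ?_ fun v hv => ?_
  · have := fun i j => DTerm.fv dB (fun v => v i) (fun v => v j)
    infer_instance
  · rw [mem_DefSetA_iff]
    refine and_congr_right fun _ => exists_congr fun n => and_congr_right fun hn => ?_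
    constructor
    · rintro ⟨e, he, t, ht, h⟩
      exact ⟨e, Mdl.isOrd_mem (A := A) he, he, t, Mdl.isFunc_mem (A := A) (hv 1) hn ht, ht, h⟩
    · rintro ⟨e, -, he, t, -, ht, h⟩
      exact ⟨e, he, t, ht, h⟩

theorem DTerm.lstage (f : (ℕ → ZFSet.{0}) → ZFSet.{0}) [DTerm (fam E A) f] :
    DTerm (fam E A) (fun v => LstageA B (f v)) := by
  refine Mdl.dterm_rec (f := LstageA B) (ρ := fun z x => z ∈ x) (Ψ := fun w x h =>
    ∃ β ∈ x, ∃ y ∈ E, ZFSet.pair β y ∈ h ∧ w ∈ DefSetA B y) ZFSet.mem_wf inferInstance hE.trans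
    (fun x _ => ⟨x, fun z hz => hz⟩) ?_ (fun x hx h hh hw => ?_) f
  · have := fun i j => Dfn.mem_DefSetA dB (fun v => v i) (fun v => v j)
    infer_instance
  · have hp : ∀ β ∈ x, ZFSet.pair β (LstageA B β) ∈ h := fun β hβ => (hw _).2 ⟨β, hβ, rfl⟩
    have hpE : ∀ β ∈ x, LstageA B β ∈ E := fun β hβ =>
      Mdl.snd_mem (A := A) (hE.trans _ hh _ (hp β hβ))
    refine ⟨fun w hw => ?_, fun w _ => ?_⟩
    · obtain ⟨β, hβ, h⟩ := mem_LstageA.1 hw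
      exact Mdl.mem_of_mem_DefSetA dB (hpE β hβ) h
    · rw [mem_LstageA]
      constructor
      · rintro ⟨β, hβ, h⟩
        exact ⟨β, hβ, _, hpE β hβ, hp β hβ, h⟩
      · rintro ⟨β, hβ, y, -, hy, h⟩
        obtain ⟨z, -, he⟩ := (hw _).1 hy
        obtain ⟨rfl, rfl⟩ := pair_inj.1 he
        exact ⟨_, hβ, h⟩

theorem Mdl.LOf_subset : LOf B ⊆ E := by
  rintro x ⟨α, hα, hx⟩
  have : LstageA B α ∈ E :=
    DTerm.mem1 (DTerm.lstage dB (fun v => v 0)) (Mdl.isOrd_mem (A := A) hα)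
  exact hE.trans _ this _ hx

end Pred

end Mdl

/-! ### A definable injection of the constructible universe into the ordinals -/

/-- `Ev A e x` means that the ordinal `e` is a code for `x` in the hierarchy relative to `A`. -/
inductive Ev (A : Set ZFSet.{0}) : ZFSet.{0} → ZFSet.{0} → Prop
  | empty : Ev A (gp (natZ 0) ∅) ∅
  | insert {n a b y t : ZFSet.{0}} (hn : n ∈ ZFSet.omega) (ha : IsOrd a) (hb : IsOrd b)
      (hy : Ev A a y) (ht : Ev A b t) :
      Ev A (gp (natZ 1) (cd4 ∅ n a b)) (Insert.insert (pair n y) t)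
  | defn {n α d b t : ZFSet.{0}} (hn : n ∈ ZFSet.omega) (hα : IsOrd α) (hd : IsOrd d)
      (hb : IsOrd b) (ht : Ev A b t) :
      Ev A (gp (natZ 2) (cd4 (gp α d) n b ∅))
        (ZFSet.sep (fun z => Insert.insert (pair n z) t ∈ fv A (LstageA A α) d) (LstageA A α))

theorem gp_label {k l : ℕ} {a b : ZFSet.{0}} (ha : IsOrd a) (hb : IsOrd b)
    (h : gp (natZ k) a = gp (natZ l) b) : k = l ∧ a = b :=
  have h := gp_inj (isOrd_natZ k) ha (isOrd_natZ l) hb h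
  ⟨natZ_inj h.1, h.2⟩

section Ev

variable {A : Set ZFSet.{0}}

theorem Ev.unique {e x : ZFSet.{0}} (h : Ev A e x) : ∀ {x'}, Ev A e x' → x = x' := by
  induction h with
  | empty =>
    intro x' h'
    generalize he : gp (natZ 0) ∅ = e at h'
    cases h' with
    | empty => rfl
    | insert _ _ _ => exact absurd (gp_label isOrd_empty (isOrd_cd4 _ _ _ _) he).1 (by simp)
    | defn _ _ _ => exact absurd (gp_label isOrd_empty (isOrd_cd4 _ _ _ _) he).1 (by simp)
  | @insert n a b y t hn ha hb _ _ ih1 ih2 =>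
    intro x' h'
    generalize he : gp (natZ 1) (cd4 ∅ n a b) = e at h'
    cases h' with
    | empty => exact absurd (gp_label (isOrd_cd4 _ _ _ _) isOrd_empty he).1 (by simp)
    | insert hn' ha' hb' hy' ht' =>
      obtain ⟨-, rfl, rfl, rfl⟩ := cd4_inj isOrd_empty (isOrd_omega.mem hn) ha hb isOrd_empty
        (isOrd_omega.mem hn') ha' hb' (gp_label (isOrd_cd4 _ _ _ _) (isOrd_cd4 _ _ _ _) he).2
      rw [ih1 hy', ih2 ht']
    | defn _ _ _ =>
      exact absurd (gp_label (isOrd_cd4 _ _ _ _) (isOrd_cd4 _ _ _ _) he).1 (by simp)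
  | @defn n α d b t hn hα hd hb _ ih =>
    intro x' h'
    generalize he : gp (natZ 2) (cd4 (gp α d) n b ∅) = e at h'
    cases h' with
    | empty => exact absurd (gp_label (isOrd_cd4 _ _ _ _) isOrd_empty he).1 (by simp)
    | insert _ _ _ =>
      exact absurd (gp_label (isOrd_cd4 _ _ _ _) (isOrd_cd4 _ _ _ _) he).1 (by simp)
    | defn hn' hα' hd' hb' ht' =>
      obtain ⟨h1, rfl, rfl, -⟩ := cd4_inj (isOrd_gp _ _) (isOrd_omega.mem hn) hb isOrd_empty
        (isOrd_gp _ _) (isOrd_omega.mem hn') hb' isOrd_empty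
        (gp_label (isOrd_cd4 _ _ _ _) (isOrd_cd4 _ _ _ _) he).2
      obtain ⟨rfl, rfl⟩ := gp_inj hα hd hα' hd' h1
      rw [ih ht']

theorem exists_ev_enc {n : ℕ} (v : Fin n → ZFSet.{0}) (hv : ∀ i, ∃ e, IsOrd e ∧ Ev A e (v i)) :
    ∃ e, IsOrd e ∧ Ev A e (enc v) := by
  induction n with
  | zero =>
    have : enc v = ∅ := by
      refine (ZFSet.eq_empty _).2 fun w hw => ?_
      obtain ⟨i, -⟩ := mem_enc.1 hw
      exact i.elim0
    rw [this]
    exact ⟨_, isOrd_gp _ _, .empty⟩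
  | succ n ih =>
    rw [← Fin.cons_self_tail v, enc_cons]
    obtain ⟨e, he, h⟩ := ih (Fin.tail v) fun i => hv i.succ
    obtain ⟨d, hd, h'⟩ := hv 0
    exact ⟨_, isOrd_gp _ _, .insert (natZ_mem_omega n) hd he h' h⟩

theorem exists_ev {x : ZFSet.{0}} (hx : x ∈ LOf A) : ∃ e, IsOrd e ∧ Ev A e x := by
  obtain ⟨o, hx⟩ := mem_LOf.1 hx
  induction o using WellFoundedLT.induction generalizing x with
  | _ o ih =>
    obtain ⟨p, hp, hx⟩ := mem_LO.1 hx
    obtain ⟨hs, n, hn, d, hd, t, ht, h⟩ := mem_DefSetA_iff.1 hx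
    obtain ⟨n, rfl⟩ := mem_omega.1 hn
    obtain ⟨v, hv, rfl⟩ := exists_enc ht
    obtain ⟨b, hb, hev⟩ := exists_ev_enc v fun i => ih p hp (mem_LOf.2 ⟨p, hv i⟩) (hv i)
    have : x = ZFSet.sep (fun z => Insert.insert (pair (natZ n) z) (enc v) ∈ fv A (LO A p) d)
        (LO A p) := by
      ext z
      rw [ZFSet.mem_sep]
      exact ⟨fun hz => ⟨hs hz, (h z (hs hz)).1 hz⟩, fun hz => (h z hz.1).2 hz.2⟩
    rw [this]
    exact ⟨_, isOrd_gp _ _, Ev.defn hn (isOrd_toZFSet p) hd hb hev⟩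

/-- The set of sets coded by `e`; it has at most one element. -/
def evset (A : Set ZFSet.{0}) (e : ZFSet.{0}) : ZFSet.{0} :=
  if h : ∃ x, Ev A e x then {h.choose} else ∅

theorem mem_evset {e x : ZFSet.{0}} : x ∈ evset A e ↔ Ev A e x := by
  rw [evset]
  split_ifs with h
  · rw [ZFSet.mem_singleton]
    exact ⟨fun h' => h' ▸ h.choose_spec, fun h' => h'.unique h.choose_spec⟩
  · exact iff_of_false (by simp) fun h' => h ⟨x, h'⟩

theorem ev_iff {e x : ZFSet.{0}} : Ev A e x ↔ (e = gp (natZ 0) ∅ ∧ x = ∅) ∨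
    (∃ n ∈ ZFSet.omega, ∃ a b, IsOrd a ∧ IsOrd b ∧ e = gp (natZ 1) (cd4 ∅ n a b) ∧
      ∃ y, Ev A a y ∧ ∃ t, Ev A b t ∧ x = insert (pair n y) t) ∨
    (∃ n ∈ ZFSet.omega, ∃ α d b, IsOrd α ∧ IsOrd d ∧ IsOrd b ∧
      e = gp (natZ 2) (cd4 (gp α d) n b ∅) ∧ ∃ t, Ev A b t ∧
      x = ZFSet.sep (fun z => insert (pair n z) t ∈ fv A (LstageA A α) d) (LstageA A α)) := by
  constructor
  · intro h
    cases h with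
    | empty => exact .inl ⟨rfl, rfl⟩
    | insert hn ha hb hy ht => exact .inr (.inl ⟨_, hn, _, _, ha, hb, rfl, _, hy, _, ht, rfl⟩)
    | defn hn hα hd hb ht => exact .inr (.inr ⟨_, hn, _, _, _, hα, hd, hb, rfl, _, ht, rfl⟩)
  · rintro (⟨rfl, rfl⟩ | ⟨n, hn, a, b, ha, hb, rfl, y, hy, t, ht, rfl⟩ |
      ⟨n, hn, α, d, b, hα, hd, hb, rfl, t, ht, rfl⟩)
    · exact .empty
    · exact .insert hn ha hb hy ht
    · exact .defn hn hα hd hb ht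

section Mdl

variable {E : Set ZFSet.{0}} [hE : Mdl E A]

set_option synthInstance.maxSize 1000 in
theorem DTerm.evset (f : (ℕ → ZFSet.{0}) → ZFSet.{0}) [DTerm (fam E A) f] :
    DTerm (fam E A) (fun v => evset A (f v)) := by
  have dA : Dfn (fam E A) (fun v => v 0 ∈ A) := inferInstance
  have dL := fun i => DTerm.lstage dA (fun v => v i)
  have LE : ∀ α, IsOrd α → LstageA A α ∈ E := fun α hα =>
    DTerm.mem1 (dL 0) (Mdl.isOrd_mem (A := A) hα)
  have dF := fun i j => DTerm.fv dA (fun v => LstageA A (v i)) (fun v => v j)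
  refine Mdl.dterm_rec (f := SRPPaper.evset A) (ρ := fun z x => z ∈ x) (Ψ := fun x e h =>
    (e = SRPPaper.gp (SRPPaper.natZ 0) ∅ ∧ x = ∅) ∨
    (∃ n ∈ ZFSet.omega, ∃ a ∈ E, ∃ b ∈ E, IsOrd a ∧ IsOrd b ∧
      e = SRPPaper.gp (SRPPaper.natZ 1) (SRPPaper.cd4 ∅ n a b) ∧
      ∃ Y ∈ E, ∃ T ∈ E, ZFSet.pair a Y ∈ h ∧ ZFSet.pair b T ∈ h ∧
      ∃ y ∈ Y, ∃ t ∈ T, x = Insert.insert (ZFSet.pair n y) t) ∨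
    (∃ n ∈ ZFSet.omega, ∃ α ∈ E, ∃ d ∈ E, ∃ b ∈ E, IsOrd α ∧ IsOrd d ∧ IsOrd b ∧
      e = SRPPaper.gp (SRPPaper.natZ 2) (SRPPaper.cd4 (SRPPaper.gp α d) n b ∅) ∧
      ∃ T ∈ E, ZFSet.pair b T ∈ h ∧ ∃ t ∈ T, ∀ z ∈ E, z ∈ x ↔ z ∈ LstageA A α ∧
        Insert.insert (ZFSet.pair n z) t ∈ SRPPaper.fv A (LstageA A α) d))
    ZFSet.mem_wf inferInstance hE.trans
    (fun x _ => ⟨x, fun z hz => hz⟩) ?_ (fun e he h hh hw => ?_) f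
  · have := Dfn.isEmpty (M := fam E A) (f := fun v => v 0)
    infer_instance
  · have hp : ∀ a ∈ e, ZFSet.pair a (SRPPaper.evset A a) ∈ h := fun a ha => (hw _).2 ⟨a, ha, rfl⟩
    have hpE : ∀ a ∈ e, SRPPaper.evset A a ∈ E := fun a ha =>
      Mdl.snd_mem (A := A) (hE.trans _ hh _ (hp a ha))
    have hu : ∀ a y, ZFSet.pair a y ∈ h → y = SRPPaper.evset A a := fun a y hy => by
      obtain ⟨z, -, he⟩ := (hw _).1 hy
      obtain ⟨rfl, rfl⟩ := pair_inj.1 he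
      rfl
    have m1 : ∀ {n a b : ZFSet.{0}}, IsOrd a → IsOrd b →
        a ∈ SRPPaper.gp (SRPPaper.natZ 1) (SRPPaper.cd4 ∅ n a b) ∧
        b ∈ SRPPaper.gp (SRPPaper.natZ 1) (SRPPaper.cd4 ∅ n a b) := fun ha hb =>
      ⟨right_subset_gp (isOrd_natZ 1) (isOrd_cd4 _ _ _ _) (left_mem_cd4 ha),
        right_subset_gp (isOrd_natZ 1) (isOrd_cd4 _ _ _ _) (right_mem_cd4 ha hb)⟩
    have m2 : ∀ {n c b : ZFSet.{0}}, IsOrd b →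
        b ∈ SRPPaper.gp (SRPPaper.natZ 2) (SRPPaper.cd4 c n b ∅) := fun hb =>
      right_subset_gp (isOrd_natZ 2) (isOrd_cd4 _ _ _ _) (left_mem_cd4 hb)
    have memE : ∀ a ∈ e, ∀ y, Ev A a y → y ∈ E := fun a ha y hy =>
      hE.trans _ (hpE a ha) _ (mem_evset.2 hy)
    have ordE : ∀ a, IsOrd a → a ∈ E := fun a ha => Mdl.isOrd_mem (A := A) ha
    refine ⟨fun x hx => ?_, fun x hx => ?_⟩
    · rcases ev_iff.1 (mem_evset.1 hx) with ⟨-, rfl⟩ | ⟨n, hn, a, b, ha, hb, rfl, y, hy, t, ht, rfl⟩ |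
        ⟨n, hn, α, d, b, hα, hd, hb, rfl, t, ht, rfl⟩
      · exact ordE _ isOrd_empty
      · exact Mdl.insert_mem (A := A) (Mdl.pair_mem (A := A) (ordE _ (isOrd_omega.mem hn))
          (memE _ (m1 ha hb).1 _ hy)) (memE _ (m1 ha hb).2 _ ht)
      · have hF : SRPPaper.fv A (LstageA A α) d ∈ E :=
          DTerm.mem2 (f := fun a b => SRPPaper.fv A (LstageA A a) b) (dF 0 1) (ordE _ hα) (ordE _ hd)
        refine Mdl.sep4 (A := A) (P := fun z X n t F => z ∈ X ∧ Insert.insert (ZFSet.pair n z) t ∈ F)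
          inferInstance (LE α hα) (ordE _ (isOrd_omega.mem hn)) (memE _ (m2 hb) _ ht) hF
          fun z => ?_
        rw [ZFSet.mem_sep]
        exact ⟨fun hz => ⟨hE.trans _ (LE α hα) _ hz.1, hz⟩, fun hz => hz.2⟩
    · rw [mem_evset, ev_iff]
      refine or_congr Iff.rfl (or_congr ?_ ?_)
      · refine exists_congr fun n => and_congr_right fun hn => ?_
        constructor
        · rintro ⟨a, b, ha, hb, rfl, y, hy, t, ht, rfl⟩
          exact ⟨a, ordE _ ha, b, ordE _ hb, ha, hb, rfl, _, hpE _ (m1 ha hb).1, _,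
            hpE _ (m1 ha hb).2, hp _ (m1 ha hb).1, hp _ (m1 ha hb).2, y, mem_evset.2 hy, t,
            mem_evset.2 ht, rfl⟩
        · rintro ⟨a, -, b, -, ha, hb, rfl, Y, -, T, -, hY, hT, y, hy, t, ht, rfl⟩
          rw [hu _ _ hY] at hy
          rw [hu _ _ hT] at ht
          exact ⟨a, b, ha, hb, rfl, y, mem_evset.1 hy, t, mem_evset.1 ht, rfl⟩
      · refine exists_congr fun n => and_congr_right fun hn => ?_
        constructor
        · rintro ⟨α, d, b, hα, hd, hb, rfl, t, ht, rfl⟩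
          exact ⟨α, ordE _ hα, d, ordE _ hd, b, ordE _ hb, hα, hd, hb, rfl, _, hpE _ (m2 hb),
            hp _ (m2 hb), t, mem_evset.2 ht, fun z _ => ZFSet.mem_sep⟩
        · rintro ⟨α, -, d, -, b, -, hα, hd, hb, rfl, T, -, hT, t, ht, hz⟩
          rw [hu _ _ hT] at ht
          refine ⟨α, d, b, hα, hd, hb, rfl, t, mem_evset.1 ht, ?_⟩
          ext z
          rw [ZFSet.mem_sep]
          exact ⟨fun h => (hz z (hE.trans _ hx _ h)).1 h,
            fun h => (hz z (hE.trans _ (LE α hα) _ h.1)).2 h⟩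

end Mdl

/-- The least code of a set. -/
def cd (A : Set ZFSet.{0}) (x : ZFSet.{0}) : ZFSet.{0} :=
  (sInf {o : Ordinal.{0} | Ev A o.toZFSet x}).toZFSet

theorem isOrd_cd (x : ZFSet.{0}) : IsOrd (cd A x) := isOrd_toZFSet _

theorem ev_cd {x : ZFSet.{0}} (hx : x ∈ LOf A) : Ev A (cd A x) x := by
  obtain ⟨e, he, h⟩ := exists_ev hx
  refine csInf_mem (s := {o : Ordinal.{0} | Ev A o.toZFSet x}) ⟨e.rank, ?_⟩
  rwa [Set.mem_ofPred_eq, he.toZFSet_rank]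

theorem cd_inj {x y : ZFSet.{0}} (hx : x ∈ LOf A) (hy : y ∈ LOf A) (h : cd A x = cd A y) :
    x = y :=
  (ev_cd hx).unique (h ▸ ev_cd hy)

theorem eq_cd_iff {x e : ZFSet.{0}} (hx : x ∈ LOf A) :
    e = cd A x ↔ IsOrd e ∧ Ev A e x ∧ ∀ e' ∈ e, ¬ Ev A e' x := by
  have key : ∀ e' ∈ cd A x, ¬ Ev A e' x := fun e' he' h => by
    obtain ⟨p, hp, rfl⟩ := Ordinal.mem_toZFSet_iff.1 he'
    exact notMem_of_lt_csInf' hp h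
  constructor
  · rintro rfl
    exact ⟨isOrd_cd x, ev_cd hx, key⟩
  · rintro ⟨h1, h2, h3⟩
    rcases h1.trichotomy (isOrd_cd x) with h | h | h
    · exact (key _ h h2).elim
    · exact h
    · exact (h3 _ h (ev_cd hx)).elim

instance DTerm.cd {f : (ℕ → ZFSet.{0}) → ZFSet.{0}} [DTerm (fam (LOf A) A) f] :
    DTerm (fam (LOf A) A) (fun v => cd A (f v)) := by
  refine DTerm.of_mem1 (f := SRPPaper.cd A)
    (fun x _ w hw => Mdl.isOrd_mem (A := A) ((isOrd_cd x).mem hw)) ?_ f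
  refine Dfn.congrE (P := fun v => ∃ e ∈ LOf A, (IsOrd e ∧ v 1 ∈ SRPPaper.evset A e ∧
    ∀ e' ∈ e, v 1 ∉ SRPPaper.evset A e') ∧ v 0 ∈ e) ?_ fun v hv => ?_
  · have := fun i => DTerm.evset (A := A) (E := LOf A) (fun v => v i)
    infer_instance
  · simp only [mem_evset, ← eq_cd_iff (hv 1)]
    constructor
    · exact fun h => ⟨_, Mdl.isOrd_mem (A := A) (isOrd_cd _), rfl, h⟩
    · rintro ⟨e, -, rfl, h⟩
      exact h

end Ev

/-! ### A closed unbounded set of countable subsets -/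

section Club

section Mdl

variable {E A : Set ZFSet.{0}} [hE : Mdl E A]

theorem Mdl.exists_isSurjF {R : ZFSet.{0} → ZFSet.{0} → ZFSet.{0} → ZFSet.{0} → Prop}
    (dR : Dfn (fam E A) (fun v => R (v 0) (v 1) (v 2) (v 3))) {d X x₀ p q : ZFSet.{0}}
    (hd : d ∈ E) (hX : X ∈ E) (hp : p ∈ E) (hq : q ∈ E) (hx₀ : x₀ ∈ X)
    (h1 : ∀ x ∈ X, ∃ n ∈ d, R n x p q)
    (h2 : ∀ n ∈ d, ∀ x ∈ X, ∀ x' ∈ X, R n x p q → R n x' p q → x = x') :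
    ∃ f ∈ E, IsSurjF d X f := by
  let Q : ZFSet.{0} → ZFSet.{0} → Prop := fun n x =>
    R n x p q ∨ (x = x₀ ∧ ∀ x' ∈ X, ¬ R n x' p q)
  let f : ZFSet.{0} := ZFSet.sep (fun w => ∃ n ∈ d, ∃ x ∈ X, w = pair n x ∧ Q n x) (prod d X)
  have mf : ∀ n x, pair n x ∈ f ↔ n ∈ d ∧ x ∈ X ∧ Q n x := fun n x => by
    simp only [f, ZFSet.mem_sep, ZFSet.pair_mem_prod]
    constructor
    · rintro ⟨-, n', hn, x', hx, he, h⟩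
      obtain ⟨rfl, rfl⟩ := pair_inj.1 he
      exact ⟨hn, hx, h⟩
    · exact fun h => ⟨⟨h.1, h.2.1⟩, n, h.1, x, h.2.1, rfl, h.2.2⟩
  refine ⟨f, ?_, ⟨fun w hw => (ZFSet.mem_sep.1 hw).1, fun n hn => ?_⟩, fun x hx => ?_⟩
  · refine hE.sep (fun v => ∃ n ∈ v 1, ∃ x ∈ v 2, v 0 = pair n x ∧
      (R n x (v 3) (v 4) ∨ (x = v 5 ∧ ∀ x' ∈ v 2, ¬ R n x' (v 3) (v 4)))) ?_
      (fun | 0 => d | 1 => X | 2 => p | 3 => q | _ => x₀) (fun k => ?_) f fun w => ?_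
    · have := fun i j k l => dR.rename fun | 0 => i | 1 => j | 2 => k | _ => l
      infer_instance
    · rcases k with _ | _ | _ | _ | k
      exacts [hd, hX, hp, hq, hE.trans _ hX _ hx₀]
    · simp only [f, ZFSet.mem_sep]
      constructor
      · rintro ⟨-, n, hn, x, hx, rfl, h⟩
        exact ⟨Mdl.pair_mem (A := A) (hE.trans _ hd _ hn) (hE.trans _ hX _ hx), n, hn, x, hx, rfl, h⟩
      · rintro ⟨-, n, hn, x, hx, rfl, h⟩
        exact ⟨ZFSet.pair_mem_prod.2 ⟨hn, hx⟩, n, hn, x, hx, rfl, h⟩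
  · by_cases h : ∃ x ∈ X, R n x p q
    · obtain ⟨x, hx, h⟩ := h
      refine ⟨x, (mf _ _).2 ⟨hn, hx, .inl h⟩, fun y hy => ?_⟩
      obtain ⟨-, hy, h' | h'⟩ := (mf _ _).1 hy
      · exact h2 n hn _ hy _ hx h' h
      · exact (h'.2 x hx h).elim
    · push Not at h
      refine ⟨x₀, (mf _ _).2 ⟨hn, hx₀, .inr ⟨rfl, h⟩⟩, fun y hy => ?_⟩
      obtain ⟨-, hy, h' | h'⟩ := (mf _ _).1 hy
      · exact (h y hy h').elim
      · exact h'.1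
  · obtain ⟨n, hn, h⟩ := h1 x hx
    exact ⟨n, hn, (mf _ _).2 ⟨hn, hx, .inl h⟩⟩

theorem isSurjF_empty : IsSurjF ∅ ∅ ∅ :=
  ⟨⟨by simp, fun z hz => (ZFSet.notMem_empty z hz).elim⟩,
    fun z hz => (ZFSet.notMem_empty z hz).elim⟩

theorem IsFunc.eq_of_pair {a b f x y y' : ZFSet.{0}} (hf : ZFSet.IsFunc a b f)
    (h : pair x y ∈ f) (h' : pair x y' ∈ f) : y = y' :=
  (hf.2 x (ZFSet.pair_mem_prod.1 (hf.1 h)).1).unique h h'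

/-- `X` is not the image of a natural number in `E`. -/
def InfIn (E : Set ZFSet.{0}) (X : ZFSet.{0}) : Prop :=
  ∀ n, n ∈ ZFSet.omega → ∀ f, f ∈ E → ¬ IsSurjF n X f

include hE in
theorem InfIn.exists_mem {X : ZFSet.{0}} (h : InfIn E X) : ∃ x, x ∈ X := by
  by_contra hc
  push Not at hc
  obtain rfl := (ZFSet.eq_empty X).2 hc
  refine h ∅ ?_ ∅ (Mdl.isOrd_mem (A := A) isOrd_empty) isSurjF_empty
  exact ZFSet.omega_zero

include hE in
theorem Mdl.infIn_mono {X Y : ZFSet.{0}} (hX : X ∈ E) (h : X ⊆ Y)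
    (hi : InfIn E X) : InfIn E Y := by
  rintro n hn f hf hs
  obtain ⟨x₀, hx₀⟩ := hi.exists_mem (A := A)
  obtain ⟨f', hf', hs'⟩ := Mdl.exists_isSurjF (E := E) (A := A)
    (R := fun n x p _ => ZFSet.pair n x ∈ p) inferInstance (d := n) (p := f) (q := f)
    (Mdl.isOrd_mem (A := A) (isOrd_omega.mem hn)) hX hf hf hx₀
    (fun x hx => hs.2 x (h hx)) (fun n hn x hx x' hx' h h' => IsFunc.eq_of_pair hs.1 h h')
  exact hi n hn f' hf' hs'

include hE in
theorem Mdl.ctblInfIn_insert {X γ : ZFSet.{0}} (hX : X ∈ E) (hγ : γ ∈ E) (h : CtblInfIn E X) :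
    CtblInfIn E (insert γ X) := by
  have hY := Mdl.insert_mem (A := A) hγ hX
  refine ⟨.inr ?_, Mdl.infIn_mono (A := A) hX (fun x hx => ZFSet.mem_insert_iff.2 (.inr hx)) h.2⟩
  obtain ⟨f, hf, hs⟩ : ∃ f, f ∈ E ∧ IsSurjF ZFSet.omega X f := by
    refine h.1.resolve_left ?_
    rintro rfl
    obtain ⟨x, hx⟩ := InfIn.exists_mem (A := A) h.2
    exact ZFSet.notMem_empty x hx
  refine Mdl.exists_isSurjF (E := E) (A := A) (R := fun n x p q =>
    (x = q ∧ n = SRPPaper.gp (SRPPaper.natZ 0) (SRPPaper.natZ 0)) ∨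
    ∃ m ∈ ZFSet.omega, n = SRPPaper.gp (SRPPaper.natZ 1) m ∧ ZFSet.pair m x ∈ p) inferInstance
    (Mdl.isOrd_mem (A := A) isOrd_omega) hY hf hγ (ZFSet.mem_insert_iff.2 (.inl rfl)) ?_ ?_
  · intro x hx
    rcases ZFSet.mem_insert_iff.1 hx with rfl | hx
    · exact ⟨_, gp_natZ_mem_omega 0 0, .inl ⟨rfl, rfl⟩⟩
    · obtain ⟨m, hm, hmx⟩ := hs.2 x hx
      refine ⟨gp (natZ 1) m, ?_, .inr ⟨m, hm, rfl, hmx⟩⟩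
      obtain ⟨m, rfl⟩ := mem_omega.1 hm
      exact gp_natZ_mem_omega _ _
  · rintro n hn x - x' - (⟨rfl, h1⟩ | ⟨m, hm, h1, h2⟩) (⟨rfl, h1'⟩ | ⟨m', hm', h1', h2'⟩)
    · rfl
    · rw [h1] at h1'
      exact absurd (gp_label (isOrd_natZ 0) (isOrd_omega.mem hm') h1').1 (by simp)
    · rw [h1] at h1'
      exact absurd (gp_label (isOrd_omega.mem hm) (isOrd_natZ 0) h1').1 (by simp)
    · rw [h1] at h1'
      obtain ⟨-, rfl⟩ := gp_label (isOrd_omega.mem hm) (isOrd_omega.mem hm') h1'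
      exact IsFunc.eq_of_pair hs.1 h2 h2'

end Mdl

variable {A : Set ZFSet.{0}}

theorem mem_imageOf {f y : ZFSet.{0}} : y ∈ imageOf f ↔ ∃ x, pair x y ∈ f := by
  simp only [imageOf, ZFSet.mem_sep, ZFSet.mem_sUnion]
  refine ⟨fun h => h.2, fun h => ⟨?_, h⟩⟩
  obtain ⟨x, h⟩ := h
  exact ⟨{x, y}, ⟨_, h, by simp [pair]⟩, by simp⟩

theorem ctblInfIn_sUnion {D g : ZFSet.{0}} (hDE : D ∈ LOf A)
    (hD : ∀ X ∈ D, CtblInfIn (LOf A) X) (hg : g ∈ LOf A) (hf : ZFSet.IsFunc ZFSet.omega D g) :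
    ⋃₀ (imageOf g) ∈ LOf A ∧ CtblInfIn (LOf A) (⋃₀ (imageOf g)) := by
  have hE := LOf.mdl (A := A)
  have mY : ∀ x, x ∈ ⋃₀ (imageOf g) ↔ ∃ n ∈ ZFSet.omega, ∃ y ∈ D, pair n y ∈ g ∧ x ∈ y := by
    intro x
    simp only [ZFSet.mem_sUnion, mem_imageOf]
    constructor
    · rintro ⟨y, ⟨n, hn⟩, hx⟩
      have := ZFSet.pair_mem_prod.1 (hf.1 hn)
      exact ⟨n, this.1, y, this.2, hn, hx⟩
    · rintro ⟨n, -, y, -, h, hx⟩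
      exact ⟨y, ⟨n, h⟩, hx⟩
  have hY : ⋃₀ (imageOf g) ∈ LOf A := by
    refine Mdl.sep2 (E := LOf A) (A := A) (P := fun x D g => ∃ n ∈ ZFSet.omega, ∃ y ∈ D,
      ZFSet.pair n y ∈ g ∧ x ∈ y) inferInstance hDE hg fun x => ?_
    rw [mY]
    refine ⟨fun h => ⟨?_, h⟩, fun h => h.2⟩
    obtain ⟨n, -, y, hy, -, hx⟩ := h
    exact hE.trans _ (hE.trans _ hDE _ hy) _ hx
  obtain ⟨X₀, hX₀, -⟩ := hf.2 ∅ ZFSet.omega_zero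
  have hX₀D := (ZFSet.pair_mem_prod.1 (hf.1 hX₀)).2
  obtain ⟨x₀, hx₀⟩ := InfIn.exists_mem (A := A) (hD _ hX₀D).2
  refine ⟨hY, .inr ?_, Mdl.infIn_mono (A := A) (hE.trans _ hDE _ hX₀D)
    (fun x hx => (mY x).2 ⟨∅, ZFSet.omega_zero, X₀, hX₀D, hX₀, hx⟩) (hD _ hX₀D).2⟩
  refine Mdl.exists_isSurjF (E := LOf A) (A := A) (R := fun k x g _ => ∃ n ∈ ZFSet.omega,
    ∃ m ∈ ZFSet.omega, k = SRPPaper.gp n m ∧ ∃ y ∈ LOf A, ZFSet.pair n y ∈ g ∧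
    ∃ f ∈ LOf A, IsSurjF ZFSet.omega y f ∧ (∀ f' ∈ LOf A, IsSurjF ZFSet.omega y f' →
      SRPPaper.cd A f' ∉ SRPPaper.cd A f) ∧ ZFSet.pair m x ∈ f) inferInstance
    (Mdl.isOrd_mem (A := A) isOrd_omega) hY hg hg
    ((mY x₀).2 ⟨∅, ZFSet.omega_zero, X₀, hX₀D, hX₀, hx₀⟩) ?_ ?_
  · intro x hx
    obtain ⟨n, hn, y, hy, hny, hxy⟩ := (mY x).1 hx
    have hne : y ≠ ∅ := by
      rintro rfl
      exact ZFSet.notMem_empty x hxy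
    obtain ⟨f, hfm, hmin⟩ := (InvImage.wf (cd A) ZFSet.mem_wf).has_min
      {f | f ∈ LOf A ∧ IsSurjF ZFSet.omega y f} ((hD y hy).1.resolve_left hne)
    obtain ⟨m, hm, hmx⟩ := hfm.2.2 x hxy
    refine ⟨gp n m, ?_, n, hn, m, hm, rfl, y, hE.trans _ hDE _ hy, hny, f, hfm.1, hfm.2,
      fun f' h1 h2 => hmin f' ⟨h1, h2⟩, hmx⟩
    obtain ⟨n, rfl⟩ := mem_omega.1 hn
    obtain ⟨m, rfl⟩ := mem_omega.1 hm
    exact gp_natZ_mem_omega _ _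
  · rintro _ - x - x' - ⟨n, hn, m, hm, rfl, y, -, hny, f, hfE, hs, hmin, hmx⟩
      ⟨n', hn', m', hm', he, y', -, hny', f', hfE', hs', hmin', hmx'⟩
    obtain ⟨rfl, rfl⟩ := gp_inj (isOrd_omega.mem hn) (isOrd_omega.mem hm) (isOrd_omega.mem hn')
      (isOrd_omega.mem hm') he
    obtain rfl := IsFunc.eq_of_pair hf hny hny'
    have : cd A f = cd A f' := by
      rcases (isOrd_cd (A := A) f).trichotomy (isOrd_cd (A := A) f') with h | h | h
      · exact (hmin' f hfE hs h).elim
      · exact h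
      · exact (hmin f' hfE' hs' h).elim
    obtain rfl := cd_inj hfE hfE' this
    exact IsFunc.eq_of_pair hs.1 hmx hmx'

theorem exists_mem_rank_eq {t : ZFSet.{0}} (ht : t.IsTransitive) {o : Ordinal.{0}}
    (ho : o < t.rank) : ∃ y ∈ t, y.rank = o := by
  have : ∀ x : ZFSet.{0}, x ⊆ t → o < x.rank → ∃ y ∈ t, y.rank = o := fun x => by
    induction x using ZFSet.inductionOn with
    | _ x ih =>
      intro hx h
      obtain ⟨y, hy, h⟩ := ZFSet.lt_rank_iff.1 h
      rcases h.eq_or_lt with h | h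
      · exact ⟨y, hx hy, h.symm⟩
      · exact ih y hy (ht y (hx hy)) h
  exact this t (fun _ h => h) ho

theorem rank_lt_of_isInjF {t η f : ZFSet.{0}} (ht : t.IsTransitive) (hη : IsOrd η)
    (hf : IsInjF t η f) : t.rank < (Order.succ η.rank.card).ord := by
  rw [Cardinal.lt_ord, Order.lt_succ_iff]
  choose g hg using fun o : Set.Iio t.rank => exists_mem_rank_eq ht o.2
  choose e he _ using hf.1.2
  have heη : ∀ y (hy : y ∈ t), e y hy ∈ η := fun y hy =>
    (ZFSet.pair_mem_prod.1 (hf.1.1 (he y hy))).2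
  have hinj : Function.Injective (fun o : Set.Iio t.rank =>
      (⟨(e _ (hg o).1).rank, ZFSet.rank_lt_of_mem (heη _ (hg o).1)⟩ : Set.Iio η.rank)) := by
    intro o p hop
    have h1 : (e _ (hg o).1).rank = (e _ (hg p).1).rank := congr_arg Subtype.val hop
    have h2 : e _ (hg o).1 = e _ (hg p).1 := by
      rw [← (hη.mem (heη _ (hg o).1)).toZFSet_rank, h1, (hη.mem (heη _ (hg p).1)).toZFSet_rank]
    have h3 := hf.2 _ (hg o).1 _ (hg p).1 _ (he _ (hg o).1) (h2 ▸ he _ (hg p).1)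
    exact Subtype.ext ((hg o).2.symm.trans (h3 ▸ (hg p).2))
  have := Cardinal.mk_le_of_injective hinj
  rwa [Cardinal.mk_Iio_ordinal, Cardinal.mk_Iio_ordinal, Cardinal.lift_le] at this

theorem exists_HsetIn_subset (E : Set ZFSet.{0}) {θ : ZFSet.{0}} (hθ : IsOrd θ) :
    ∃ s : ZFSet.{0}, ∀ x ∈ HsetIn E θ, x ∈ s := by
  refine ⟨ZFSet.vonNeumann (Order.succ θ.rank.card).ord, ?_⟩
  rintro x ⟨-, t, -, ht, hxt, f, -, η, hη, hf⟩
  rw [ZFSet.mem_vonNeumann]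
  refine (ZFSet.rank_lt_of_mem hxt).trans ((rank_lt_of_isInjF ht (hθ.mem hη) hf).trans_le ?_)
  exact Cardinal.ord_le_ord.2 (Order.succ_le_succ (Ordinal.card_le_card
    (ZFSet.rank_lt_of_mem hη).le))

theorem exists_clubSubIn {γ θ : ZFSet.{0}} (hθ : IsOrd θ) (hγ : γ ∈ HsetIn (LOf A) θ) :
    ∃ D, ClubSubIn (LOf A) (HsetIn (LOf A) θ) D ∧ ∀ X ∈ D, γ ∈ X := by
  have hE := LOf.mdl (A := A)
  obtain ⟨s, hs⟩ := exists_HsetIn_subset (LOf A) hθ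
  let C : ZFSet.{0} → Prop := fun X => X ∈ LOf A ∧ X.toSet ⊆ HsetIn (LOf A) θ ∧ γ ∈ X ∧
    CtblInfIn (LOf A) X
  let D : ZFSet.{0} := ZFSet.sep C (ZFSet.powerset s)
  have mD : ∀ X, X ∈ D ↔ C X := fun X => by
    rw [ZFSet.mem_sep, ZFSet.mem_powerset]
    exact ⟨fun h => h.2, fun h => ⟨fun x hx => hs x (h.2.1 hx), h⟩⟩
  have hDE : D ∈ LOf A := by
    have dH : Dfn (fam (LOf A) A) (fun v => v 0 ∈ HsetIn (LOf A) (v 1)) := by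
      refine Dfn.congrE (P := fun v => ∃ t ∈ LOf A, t.IsTransitive ∧ v 0 ∈ t ∧ ∃ f ∈ LOf A,
        ∃ α ∈ v 1, IsInjF t α f) inferInstance fun v hv => ?_
      exact ⟨fun h => h.2, fun h => ⟨hv 0, h⟩⟩
    have dC : Dfn (fam (LOf A) A) (fun v => CtblInfIn (LOf A) (v 0)) := by
      simp only [CtblInfIn, CtblIn]
      have := Dfn.isEmpty (M := fam (LOf A) A) (f := fun v => v 0)
      have : Dfn (fam (LOf A) A) (fun v => ∀ n ∈ ZFSet.omega, ∀ f ∈ LOf A, ¬ IsSurjF n (v 0) f) :=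
        inferInstance
      infer_instance
    refine Mdl.sep2 (E := LOf A) (A := A) (P := fun X γ θ => (∀ x ∈ X, x ∈ HsetIn (LOf A) θ) ∧
      γ ∈ X ∧ CtblInfIn (LOf A) X) ?_ hγ.1 (Mdl.isOrd_mem (A := A) hθ) mD
    have := fun i j => dH.rename fun | 0 => i | _ => j
    infer_instance
  refine ⟨D, ⟨hDE, fun X hX => ?_, fun X hX h1 h2 => ?_, fun g hg hf _ => ?_⟩,
    fun X hX => ((mD X).1 hX).2.2.1⟩
  · obtain ⟨-, h1, -, h2⟩ := (mD X).1 hX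
    exact ⟨h1, h2⟩
  · refine ⟨insert γ X, (mD _).2 ⟨Mdl.insert_mem (A := A) hγ.1 hX, fun x hx => ?_, by simp,
      Mdl.ctblInfIn_insert (A := A) hX hγ.1 h2⟩, fun x hx => ZFSet.mem_insert_iff.2 (.inr hx)⟩
    rcases ZFSet.mem_insert_iff.1 hx with rfl | hx
    exacts [hγ, h1 hx]
  · obtain ⟨h1, h2⟩ := ctblInfIn_sUnion hDE (fun X hX => ((mD X).1 hX).2.2.2) hg hf
    refine (mD _).2 ⟨h1, fun x hx => ?_, ?_, h2⟩
    · obtain ⟨y, hy, hxy⟩ := ZFSet.mem_sUnion.1 hx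
      obtain ⟨n, hn⟩ := mem_imageOf.1 hy
      exact ((mD y).1 (ZFSet.pair_mem_prod.1 (hf.1 hn)).2).2.1 hxy
    · obtain ⟨y, hy, -⟩ := hf.2 ∅ ZFSet.omega_zero
      exact ZFSet.mem_sUnion.2 ⟨y, mem_imageOf.2 ⟨_, hy⟩,
        ((mD y).1 (ZFSet.pair_mem_prod.1 (hf.1 hy)).2).2.2.1⟩

end Club

/-! ### Sets of the form `H_θ` -/

theorem HsetIn_trans {E A : Set ZFSet.{0}} [hE : Mdl E A] {θ x y : ZFSet.{0}}
    (hx : x ∈ HsetIn E θ) (hy : y ∈ x) : y ∈ HsetIn E θ := by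
  obtain ⟨hxE, t, htE, ht, hxt, h⟩ := hx
  exact ⟨hE.trans _ hxE _ hy, t, htE, ht, ht x hxt hy, h⟩

theorem exists_mem_HsetIn {A : Set ZFSet.{0}} {x : ZFSet.{0}} (hx : x ∈ LOf A) :
    ∃ ν : Ordinal.{0}, ∀ θ, ν.toZFSet ∈ θ → x ∈ HsetIn (LOf A) θ := by
  have hE := LOf.mdl (A := A)
  obtain ⟨o, ho⟩ := mem_LOf.1 hx
  set t := LO A o with ht
  have htE : t ∈ LOf A := mem_LOf.2 ⟨_, LO_mem_LO (Order.lt_succ o)⟩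
  set ν : Ordinal.{0} := (img (cd A) t).rank with hν
  have hνE : ν.toZFSet ∈ LOf A := Mdl.isOrd_mem (A := A) (isOrd_toZFSet ν)
  have hcd : ∀ y ∈ t, cd A y ∈ ν.toZFSet := fun y hy =>
    Ordinal.mem_toZFSet_iff.2 ⟨_, ZFSet.rank_lt_of_mem (mem_img.2 ⟨y, hy, rfl⟩),
      (isOrd_cd y).toZFSet_rank⟩
  set f : ZFSet.{0} := ZFSet.sep (fun w => ∃ y ∈ t, w = pair y (cd A y)) (prod t ν.toZFSet) with hf
  have mf : ∀ y e, pair y e ∈ f ↔ y ∈ t ∧ e = cd A y := fun y e => by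
    rw [hf, ZFSet.mem_sep, ZFSet.pair_mem_prod]
    constructor
    · rintro ⟨-, z, hz, he⟩
      obtain ⟨rfl, rfl⟩ := pair_inj.1 he
      exact ⟨hz, rfl⟩
    · rintro ⟨hy, rfl⟩
      exact ⟨⟨hy, hcd y hy⟩, y, hy, rfl⟩
  refine ⟨ν, fun θ hθ => ⟨hx, t, htE, LO_transitive o, ho, f, ?_, ν.toZFSet, hθ,
    ⟨fun w hw => (ZFSet.mem_sep.1 hw).1, fun y hy => ⟨cd A y, (mf _ _).2 ⟨hy, rfl⟩, fun e he =>
      ((mf _ _).1 he).2⟩⟩, fun y hy y' hy' e h h' => ?_⟩⟩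
  · refine Mdl.sep1 (E := LOf A) (A := A) (P := fun w t => ∃ y ∈ t, w = ZFSet.pair y (cd A y))
      inferInstance htE fun w => ?_
    rw [hf, ZFSet.mem_sep]
    constructor
    · rintro ⟨-, y, hy, rfl⟩
      exact ⟨Mdl.pair_mem (A := A) (hE.trans _ htE _ hy) (hE.trans _ hνE _ (hcd y hy)), y, hy, rfl⟩
    · rintro ⟨-, y, hy, rfl⟩
      exact ⟨ZFSet.pair_mem_prod.2 ⟨hy, hcd y hy⟩, y, hy, rfl⟩
  · exact cd_inj (hE.trans _ htE _ hy) (hE.trans _ htE _ hy')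
      (((mf _ _).1 h).2.symm.trans ((mf _ _).1 h').2)

theorem exists_regularIn (o : Ordinal.{0}) :
    ∃ θ : ZFSet.{0}, IsOrd θ ∧ o.toZFSet ∈ θ ∧ ∀ W, RegularIn W θ := by
  set c : Cardinal.{0} := Order.succ (max Cardinal.aleph0 o.card) with hc
  have hreg : c.IsRegular := Cardinal.isRegular_succ (le_max_left _ _)
  set θ : ZFSet.{0} := c.ord.toZFSet with hθ
  have hord : IsOrd θ := isOrd_toZFSet _
  have bd : ∀ α ∈ θ, ∀ f, ZFSet.IsFunc α θ f →
      ∃ β ∈ θ, ∀ ξ y, ξ ∈ α → pair ξ y ∈ f → y ∈ β := by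
    intro α hα f hf
    obtain ⟨p, hp, rfl⟩ := Ordinal.mem_toZFSet_iff.1 hα
    have hF : ∀ i : Set.Iio p, ∃ q < c.ord, pair i.1.toZFSet q.toZFSet ∈ f := fun i => by
      obtain ⟨y, hy, -⟩ := hf.2 i.1.toZFSet (Ordinal.toZFSet_mem_toZFSet_iff.2 i.2)
      obtain ⟨q, hq, rfl⟩ := Ordinal.mem_toZFSet_iff.1 (ZFSet.pair_mem_prod.1 (hf.1 hy)).2
      exact ⟨q, hq, hy⟩
    choose F hF1 hF2 using hF
    have hsup : ⨆ i, F i < c.ord := by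
      refine Ordinal.lift_iSup_lt_of_lt_cof ?_ hF1
      rw [Cardinal.mk_Iio_ordinal, ← Ordinal.lift_cof, hreg.cof_ord]
      simpa using Cardinal.lift_lt.{0, 1}.2 (Cardinal.lt_ord.1 hp)
    have hsup' : Order.succ (⨆ i, F i) < c.ord :=
      (Cardinal.isSuccLimit_ord hreg.aleph0_le).succ_lt hsup
    refine ⟨_, Ordinal.toZFSet_mem_toZFSet_iff.2 hsup', fun ξ y hξ hy => ?_⟩
    obtain ⟨i, hi, rfl⟩ := Ordinal.mem_toZFSet_iff.1 hξ
    rw [IsFunc.eq_of_pair hf hy (hF2 ⟨i, hi⟩), Ordinal.toZFSet_mem_toZFSet_iff, Order.lt_succ_iff]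
    exact Ordinal.le_iSup F ⟨i, hi⟩
  refine ⟨θ, hord, ?_, fun W => ⟨⟨hord, fun α hα f _ hs => ?_⟩, fun α hα f _ hf => bd α hα f hf⟩⟩
  · rw [hθ, Ordinal.toZFSet_mem_toZFSet_iff, Cardinal.lt_ord, hc, Order.lt_succ_iff]
    exact le_max_right _ _
  · obtain ⟨β, hβ, h⟩ := bd α hα f hs.1
    obtain ⟨ξ, hξ, hm⟩ := hs.2 β hβ
    exact ZFSet.mem_irrefl β (h ξ β hξ hm)

theorem mem_HsetIn_of_subset {E A : Set ZFSet.{0}} [hE : Mdl E A] {T g β : ZFSet.{0}}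
    (hT : T ∈ HsetIn E β) (hTt : T.IsTransitive) (hg : g ∈ E) (hgT : g ⊆ T) : g ∈ HsetIn E β := by
  obtain ⟨hTE, t, htE, ht, hTt', h, hh, η, hη, hf, hinj⟩ := hT
  have hTsub : T ⊆ t := ht T hTt'
  obtain ⟨e, he, -⟩ := hf.2 T hTt'
  let t' : ZFSet.{0} := insert g T
  have ht' : t' ∈ E := Mdl.insert_mem (A := A) hg hTE
  let h' : ZFSet.{0} := ZFSet.sep (fun w => ∃ x ∈ t', ∃ y ∈ E, w = pair x y ∧
    ((x ≠ g ∧ pair x y ∈ h) ∨ (x = g ∧ pair T y ∈ h))) (prod t' η)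
  have hpη : ∀ x y, pair x y ∈ h → y ∈ η := fun x y hm => (ZFSet.pair_mem_prod.1 (hf.1 hm)).2
  have hpE : ∀ x y, pair x y ∈ h → y ∈ E := fun x y hm =>
    Mdl.snd_mem (A := A) (hE.trans _ hh _ hm)
  have mh : ∀ x y, pair x y ∈ h' ↔
      x ∈ t' ∧ ((x ≠ g ∧ pair x y ∈ h) ∨ (x = g ∧ pair T y ∈ h)) := fun x y => by
    simp only [h', ZFSet.mem_sep, ZFSet.pair_mem_prod]
    constructor
    · rintro ⟨-, x', hx', y', -, he, hm⟩
      obtain ⟨rfl, rfl⟩ := pair_inj.1 he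
      exact ⟨hx', hm⟩
    · rintro ⟨hx, hm⟩
      have hy : y ∈ η ∧ y ∈ E := by
        rcases hm with hm | hm
        exacts [⟨hpη _ _ hm.2, hpE _ _ hm.2⟩, ⟨hpη _ _ hm.2, hpE _ _ hm.2⟩]
      exact ⟨⟨hx, hy.1⟩, x, hx, y, hy.2, rfl, hm⟩
  have memT : ∀ x ∈ t', x ≠ g → x ∈ T := fun x hx hne =>
    (ZFSet.mem_insert_iff.1 hx).resolve_left hne
  refine ⟨hg, t', ht', fun x hx z hz => ?_, ZFSet.mem_insert_iff.2 (.inl rfl), h', ?_, η, hη,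
    ⟨fun w hw => (ZFSet.mem_sep.1 hw).1, fun x hx => ?_⟩, fun x hx x' hx' y hm hm' => ?_⟩
  · refine ZFSet.mem_insert_iff.2 (.inr ?_)
    rcases ZFSet.mem_insert_iff.1 hx with rfl | hx
    exacts [hgT hz, hTt x hx hz]
  · refine Mdl.sep3 (E := E) (A := A) (P := fun w T g h => ∃ x ∈ (insert g T : ZFSet.{0}), ∃ y ∈ E,
      w = pair x y ∧ ((x ≠ g ∧ pair x y ∈ h) ∨ (x = g ∧ pair T y ∈ h))) inferInstance hTE hg hh
      fun w => ?_
    constructor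
    · intro hw
      obtain ⟨-, x, hx, y, hy, rfl, hm⟩ := ZFSet.mem_sep.1 hw
      exact ⟨Mdl.pair_mem (A := A) (hE.trans _ ht' _ hx) hy, x, hx, y, hy, rfl, hm⟩
    · rintro ⟨-, x, hx, y, hy, rfl, hm⟩
      exact (mh x y).2 ⟨hx, hm⟩
  · by_cases hxg : x = g
    · refine ⟨e, (mh _ _).2 ⟨hx, .inr ⟨hxg, he⟩⟩, fun y hy => ?_⟩
      obtain ⟨-, hm | hm⟩ := (mh _ _).1 hy
      · exact (hm.1 hxg).elim
      · exact IsFunc.eq_of_pair hf hm.2 he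
    · obtain ⟨y, hy, -⟩ := hf.2 x (hTsub (memT x hx hxg))
      refine ⟨y, (mh _ _).2 ⟨hx, .inl ⟨hxg, hy⟩⟩, fun y' hy' => ?_⟩
      obtain ⟨-, hm | hm⟩ := (mh _ _).1 hy'
      · exact IsFunc.eq_of_pair hf hm.2 hy
      · exact (hxg hm.1).elim
  · have key : ∀ x ∈ t', x ≠ g → ∀ y, pair x y ∈ h → pair T y ∉ h := fun x hx hne y h1 h2 => by
      have hxT := memT x hx hne
      exact ZFSet.mem_irrefl T (hinj x (hTsub hxT) T hTt' y h1 h2 ▸ hxT)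
    obtain ⟨-, hm | hm⟩ := (mh _ _).1 hm <;> obtain ⟨-, hm' | hm'⟩ := (mh _ _).1 hm'
    · exact hinj x (hTsub (memT x hx hm.1)) x' (hTsub (memT x' hx' hm'.1)) y hm.2 hm'.2
    · exact (key x hx hm.1 y hm.2 hm'.2).elim
    · exact (key x' hx' hm'.1 y hm'.2 hm.2).elim
    · exact hm.1.trans hm'.1.symm

/-! ### Elementary maps between transitive structures -/

/-- Replace the atomic formulas for the predicates by false formulas. -/
def Fml.pure : ∀ {n : ℕ}, Fml n → Fml n
  | _, .mem i j => .mem i j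
  | _, .eq i j => .eq i j
  | _, .inA i => .not (.eq i i)
  | _, .inB i => .not (.eq i i)
  | _, .not φ => .not φ.pure
  | _, .and φ ψ => .and φ.pure ψ.pure
  | _, .ex φ => .ex φ.pure

theorem satAB_pure (S A B : Set ZFSet.{0}) {n : ℕ} (φ : Fml n) :
    ∀ v : Fin n → ZFSet.{0}, SatAB S A B φ.pure v ↔ Sat S φ v := by
  induction φ with
  | mem i j => exact fun _ => Iff.rfl
  | eq i j => exact fun _ => Iff.rfl
  | inA i => exact fun v => iff_of_false (fun h => h rfl) id
  | inB i => exact fun v => iff_of_false (fun h => h rfl) id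
  | not φ ih => exact fun v => not_congr (ih v)
  | and φ ψ ih1 ih2 => exact fun v => and_congr (ih1 v) (ih2 v)
  | ex φ ih => exact fun v => exists_congr fun x => and_congr_right fun _ => ih _

theorem sat_image {S : Set ZFSet.{0}} {f : ZFSet.{0} → ZFSet.{0}} (hinj : Set.InjOn f S)
    (hmem : ∀ x ∈ S, ∀ y ∈ S, x ∈ y ↔ f x ∈ f y) {n : ℕ} (φ : Fml n) :
    ∀ v : Fin n → ZFSet.{0}, (∀ i, v i ∈ S) → (Sat S φ v ↔ Sat (f '' S) φ (f ∘ v)) := by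
  induction φ with
  | mem i j => exact fun v hv => hmem _ (hv i) _ (hv j)
  | eq i j => exact fun v hv => (hinj.eq_iff (hv i) (hv j)).symm
  | inA i => exact fun v _ => Iff.rfl
  | inB i => exact fun v _ => Iff.rfl
  | not φ ih => exact fun v hv => not_congr (ih v hv)
  | and φ ψ ih1 ih2 => exact fun v hv => and_congr (ih1 v hv) (ih2 v hv)
  | ex φ ih =>
    intro v hv
    have key : ∀ x ∈ S, (Sat S φ (Fin.cons x v) ↔ Sat (f '' S) φ (Fin.cons (f x) (f ∘ v))) := by
      intro x hx
      rw [ih _ fun i => by refine Fin.cases ?_ (fun i => ?_) i <;> simp [hx, hv]]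
      refine iff_of_eq (congrArg _ ?_)
      funext i
      refine Fin.cases ?_ (fun i => ?_) i <;> simp
    constructor
    · rintro ⟨x, hx, h⟩
      exact ⟨f x, ⟨x, hx, rfl⟩, (key x hx).1 h⟩
    · rintro ⟨_, ⟨x, hx, rfl⟩, h⟩
      exact ⟨x, hx, (key x hx).2 h⟩

theorem mem_collapse {X y w : ZFSet.{0}} :
    w ∈ collapse X y ↔ ∃ z ∈ y, z ∈ X ∧ collapse X z = w := by
  have h : collapse X y = img (fun z => if z ∈ y then collapse X z else ∅)
      (ZFSet.sep (fun z => z ∈ X) y) := by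
    rw [collapse, WellFounded.fix_eq]
    rfl
  rw [h, mem_img]
  constructor
  · rintro ⟨z, hz, rfl⟩
    obtain ⟨hz, hzX⟩ := ZFSet.mem_sep.1 hz
    exact ⟨z, hz, hzX, by rw [if_pos hz]⟩
  · rintro ⟨z, hz, hzX, rfl⟩
    exact ⟨z, ZFSet.mem_sep.2 ⟨hz, hzX⟩, by rw [if_pos hz]⟩

theorem collapse_image {S : Set ZFSet.{0}} {f : ZFSet.{0} → ZFSet.{0}} {X : ZFSet.{0}}
    (hS : ∀ x ∈ S, ∀ y ∈ x, y ∈ S) (hmem : ∀ x ∈ S, ∀ y ∈ S, x ∈ y ↔ f x ∈ f y)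
    (hX : X.toSet = f '' S) : ∀ a ∈ S, collapse X (f a) = a := by
  have mX : ∀ z, z ∈ X ↔ ∃ x ∈ S, f x = z := fun z => by
    change z ∈ X.toSet ↔ _
    rw [hX]
    rfl
  intro a
  induction a using ZFSet.inductionOn with
  | _ a ih =>
    intro ha
    ext w
    rw [mem_collapse]
    constructor
    · rintro ⟨z, hz, hzX, rfl⟩
      obtain ⟨x, hx, rfl⟩ := (mX z).1 hzX
      have hxa := (hmem x hx a ha).2 hz
      rwa [ih x hxa hx]
    · intro hw
      have hwS := hS a ha w hw
      exact ⟨f w, (hmem w hwS a ha).1 hw, (mX _).2 ⟨w, hwS, rfl⟩, ih w hw hwS⟩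

section Transfer

variable {m₁ m₂ : Str} {f : ZFSet.{0} → ZFSet.{0}}

/-- `f` is an elementary embedding of `m₁` into `m₂`. -/
structure ElemMap (m₁ m₂ : Str) (f : ZFSet.{0} → ZFSet.{0}) : Prop where
  mapsTo : Set.MapsTo f m₁.S m₂.S
  sat : ∀ (n : ℕ) (φ : Fml n) (v : Fin n → ZFSet.{0}), (∀ i, v i ∈ m₁.S) →
    (SatAB m₁.S m₁.A m₁.B φ v ↔ SatAB m₂.S m₂.A m₂.B φ (f ∘ v))

theorem ElemMap.iff (hf : ElemMap m₁ m₂ f) {P : (ℕ → ZFSet.{0}) → Prop} (hP : Dfn {m₁, m₂} P)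
    {v : ℕ → ZFSet.{0}} (hv : ∀ k, v k ∈ m₁.S) : P v ↔ P (f ∘ v) := by
  obtain ⟨n, φ, hφ⟩ := hP.out
  rw [hφ m₁ (by simp) v hv, hφ m₂ (by simp) (f ∘ v) fun k => hf.mapsTo (hv k)]
  exact hf.sat n φ _ fun i => hv i

theorem ElemMap.mem_iff (hf : ElemMap m₁ m₂ f) : ∀ x ∈ m₁.S, ∀ y ∈ m₁.S, x ∈ y ↔ f x ∈ f y :=
  fun x hx y hy => hf.iff (P := fun v => v 0 ∈ v 1) inferInstance (v := fun | 0 => x | _ => y)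
    fun k => by cases k <;> assumption

theorem ElemMap.injOn (hf : ElemMap m₁ m₂ f) : Set.InjOn f m₁.S :=
  fun x hx y hy => (hf.iff (P := fun v => v 0 = v 1) inferInstance (v := fun | 0 => x | _ => y)
    fun k => by cases k <;> assumption).2

theorem ElemMap.elemSub (hf : ElemMap m₁ m₂ f) {X : ZFSet.{0}} (hX : X.toSet = f '' m₁.S) :
    ElemSub X m₂.S := by
  rw [ElemSub, hX]
  refine ⟨?_, fun {n} φ v hv => ?_⟩
  · rintro _ ⟨x, hx, rfl⟩
    exact hf.mapsTo hx
  · have : ∀ i, ∃ x ∈ m₁.S, f x = v i := fun i => by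
      have : v i ∈ X.toSet := hv i
      rwa [hX] at this
    choose u hu1 hu2 using this
    obtain rfl : f ∘ u = v := funext hu2
    rw [← sat_image hf.injOn hf.mem_iff φ u hu1, ← satAB_pure m₁.S m₁.A m₁.B,
      ← satAB_pure m₂.S m₂.A m₂.B]
    exact hf.sat n φ.pure u hu1

theorem ElemMap.exists_iff (hf : ElemMap m₁ m₂ f) {Q : ZFSet.{0} → ZFSet.{0} → Prop}
    (hQ : Dfn {m₁, m₂} (fun v => Q (v 0) (v 1))) {y : ZFSet.{0}} (hy : y ∈ m₁.S) :
    (∃ x ∈ m₁.S, Q x y) ↔ ∃ x ∈ m₂.S, Q x (f y) := by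
  obtain ⟨n, φ, hφ⟩ := Dfn.exS (Q := fun x v => Q x (v 0)) hQ
  rw [hφ m₁ (by simp) (fun _ => y) fun _ => hy,
    hφ m₂ (by simp) (fun _ => f y) fun _ => hf.mapsTo hy]
  exact hf.sat n φ _ fun i => hy

end Transfer

theorem exists_transitive_pairs {A : Set ZFSet.{0}} {γ : ZFSet.{0}} (hγ : γ ∈ LOf A) :
    ∃ T ∈ LOf A, T.IsTransitive ∧ ∀ a ∈ γ, ∀ b ∈ γ, pair a b ∈ T := by
  have hE := LOf.mdl (A := A)
  obtain ⟨o, ho⟩ := exists_subset_LO (A := A) (prod γ γ) fun w hw => by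
    obtain ⟨a, ha, b, hb, rfl⟩ := ZFSet.mem_prod.1 hw
    exact Mdl.pair_mem (A := A) (hE.trans _ hγ _ ha) (hE.trans _ hγ _ hb)
  exact ⟨LO A o, mem_LOf.2 ⟨_, LO_mem_LO (Order.lt_succ o)⟩, LO_transitive o,
    fun a ha b hb => ho (ZFSet.pair_mem_prod.2 ⟨ha, hb⟩)⟩

theorem LClass_subset_LOf (A : Set ZFSet.{0}) : LClass ⊆ LOf A := by
  have dB : Dfn (fam (LOf A) A) (fun v => v 0 ∈ (∅ : Set ZFSet.{0})) :=
    Dfn.false.congr fun _ _ _ _ => Iff.rfl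
  exact Mdl.LOf_subset dB

instance transFam_pair {A₁ A₂ W B₁ B₂ : Set ZFSet.{0}} {θ₁ θ₂ : ZFSet.{0}} :
    TransFam {⟨HsetIn (LOf A₁) θ₁, W, B₁⟩, ⟨HsetIn (LOf A₂) θ₂, W, B₂⟩} := by
  constructor
  rintro m (rfl | rfl) x hx y hy
  · exact HsetIn_trans (A := A₁) hx hy
  · exact HsetIn_trans (A := A₂) hx hy

theorem cardIn_of_elemMap {A₁ A₂ B₁ B₂ : Set ZFSet.{0}} {θ₁ θ₂ γ T : ZFSet.{0}}
    {f : ZFSet.{0} → ZFSet.{0}}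
    (hf : ElemMap ⟨HsetIn (LOf A₁) θ₁, LClass, B₁⟩ ⟨HsetIn (LOf A₂) θ₂, LClass, B₂⟩ f)
    (hγ : γ ∈ HsetIn (LOf A₁) θ₁) (hc : LCard (f γ)) (hT : T ∈ HsetIn (LOf A₂) θ₂)
    (hTt : T.IsTransitive) (hTγ : ∀ a ∈ f γ, ∀ b ∈ f γ, pair a b ∈ T) : LCard γ := by
  refine ⟨(hf.iff (P := fun v => IsOrd (v 0)) inferInstance (v := fun _ => γ) fun _ => hγ).2 hc.1,
    fun δ hδ g hg hs => ?_⟩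
  obtain ⟨T', hT', hT't, hT'γ⟩ := (hf.exists_iff (Q := fun T γ => T.IsTransitive ∧
    ∀ a ∈ γ, ∀ b ∈ γ, pair a b ∈ T) inferInstance hγ).2 ⟨T, hT, hTt, hTγ⟩
  have hord := (hf.iff (P := fun v => IsOrd (v 0)) inferInstance (v := fun _ => γ)
    fun _ => hγ).2 hc.1
  have hgH : g ∈ HsetIn (LOf A₁) θ₁ := by
    refine mem_HsetIn_of_subset (A := A₁) hT' hT't (LClass_subset_LOf A₁ hg) fun w hw => ?_
    obtain ⟨a, ha, b, hb, rfl⟩ := ZFSet.mem_prod.1 (hs.1.1 hw)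
    exact hT'γ a (hord.1 δ hδ ha) b hb
  have hδH : δ ∈ HsetIn (LOf A₁) θ₁ := HsetIn_trans (A := A₁) hγ hδ
  have hW : Dfn {⟨HsetIn (LOf A₁) θ₁, LClass, B₁⟩, ⟨HsetIn (LOf A₂) θ₂, LClass, B₂⟩}
      (fun v => v 0 ∈ LClass) := ⟨1, .inA 0, by rintro m (rfl | rfl) v -; exacts [Iff.rfl, Iff.rfl]⟩
  refine hc.2 (f δ) ((hf.mem_iff δ hδH γ hγ).1 hδ) (f g)
    ((hf.iff hW (v := fun _ => g) fun _ => hgH).1 hg) ?_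
  exact (hf.iff (P := fun v => IsSurjF (v 0) (v 1) (v 2)) inferInstance
    (v := fun | 0 => δ | 1 => γ | _ => g) fun k => by
      rcases k with _ | _ | k <;> assumption).1 hs

theorem exists_theta {A : Set ZFSet.{0}} {γ κ T : ZFSet.{0}} (hγ : IsOrd γ)
    (hκ : κ ∈ γ ∨ κ = γ) (hT : T ∈ LOf A) : ∃ θ, IsOrd θ ∧ (∀ W, RegularIn W θ) ∧ γ ∈ θ ∧ κ ∈ θ ∧
      γ ∈ HsetIn (LOf A) θ ∧ T ∈ HsetIn (LOf A) θ := by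
  obtain ⟨ν₁, h1⟩ := exists_mem_HsetIn (A := A) (Mdl.isOrd_mem (E := LOf A) (A := A) hγ)
  obtain ⟨ν₂, h2⟩ := exists_mem_HsetIn hT
  obtain ⟨θ, hθ, hm, hreg⟩ := exists_regularIn (max γ.rank (max ν₁ ν₂))
  have key : ∀ o : Ordinal.{0}, o ≤ max γ.rank (max ν₁ ν₂) → o.toZFSet ∈ θ := fun o ho => by
    rcases ho.eq_or_lt with rfl | ho
    · exact hm
    · exact hθ.trans (Ordinal.toZFSet_mem_toZFSet_iff.2 ho) hm
  have hγθ : γ ∈ θ := hγ.toZFSet_rank ▸ key _ (le_max_left _ _)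
  refine ⟨θ, hθ, hreg, hγθ, ?_, h1 _ (key _ (by simp)), h2 _ (key _ (by simp))⟩
  rcases hκ with h | rfl
  exacts [hθ.trans h hγθ, hγθ]

/-- Corollary 2.16: if `κ` is remarkable in `L` and `G` is
`Col(ω, <κ)`-generic over `L`, then in `L[G]`, `WRP^L(γ)` holds for every
`L`-cardinal `γ ≥ κ`. -/
theorem statement7 (κ G : ZFSet.{0})
    (hrem : RemarkableVia LClass (fun A => LrelClass A) κ)
    (hG : GenericOver LClass (ColLt κ) G) :
    ∀ γ, LCard γ → (κ ∈ γ ∨ κ = γ) → WRPLIn (LrelClass G) γ := by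
  intro γ hγ hκ
  have hE : Mdl (LrelClass G) G.toSet := LOf.mdl
  have hγE : γ ∈ LrelClass G := Mdl.isOrd_mem (A := G.toSet) hγ.1
  obtain ⟨T, hT, hTt, hTγ⟩ := exists_transitive_pairs (A := G.toSet) hγE
  obtain ⟨θ, hθ, hreg, hγθ, hκθ, hγH, hTH⟩ := exists_theta hγ.1 hκ hT
  obtain ⟨D, hD, hDγ⟩ := exists_clubSubIn hθ hγH
  obtain ⟨X, ⟨f, α, β, -, -, -, -, -, -, hmap, hX, hsat⟩, hXD⟩ := hrem θ (hreg _) hκθ G hG D hD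
  set Gα : ZFSet.{0} := ZFSet.sep (fun p => p ∈ HsetIn LClass α) G
  have hf : ElemMap ⟨HsetIn (LOf Gα.toSet) β, LClass, Gα.toSet⟩
      ⟨HsetIn (LOf G.toSet) θ, LClass, G.toSet⟩ f := ⟨hmap, hsat⟩
  obtain ⟨c, hc, rfl⟩ : γ ∈ f '' HsetIn (LOf Gα.toSet) β := hX ▸ hDγ X hXD
  refine ⟨θ, Mdl.isOrd_mem (A := G.toSet) hθ, hreg _, hγθ, X, hE.trans _ hD.1 _ hXD,
    hf.elemSub hX, (hD.2.1 X hXD).2, hDγ X hXD, ?_⟩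
  rw [collapse_image (fun x hx y hy => HsetIn_trans (A := Gα.toSet) hx hy) hf.mem_iff hX c hc]
  have hcard := cardIn_of_elemMap hf hc hγ hTH hTt hTγ
  refine ⟨hcard.1, fun δ hδ g hg => hcard.2 δ hδ g ?_⟩
  obtain ⟨a, ha, -, h⟩ := hg
  exact ⟨a, ha, h⟩

end SRPPaper
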